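/- arXiv:2404.06058 — 5 statements merged into one kernel-verified Lean document; each statement's English description precedes it below -/
import Mathlib

section
/- For every constant C₀ ≥ 1 there exist constants c, C > 0 depending only on C₀ such that the following holds: for every n ∈ ℕ, all 1-symmetric quasi-norms ‖·‖_X and ‖·‖_Y on ℝ^n with quasi-norm constants at most C₀ and with ‖e_i‖_X = ‖e_i‖_Y = 1 for the standard basis vectors e_i, and every k ≥ n, one has c · 2^{−k/n} · φ_Y(n)/φ_X(n) ≤ e_k(id: X → Y) ≤ C · 2^{−k/n} · φ_Y(n)/φ_X(n), where φ_X(n) = ‖(1,…,1)‖_X and φ_Y(n) = ‖(1,…,1)‖_Y. -/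
/-- The `k`-th (dyadic) entropy number of the identity map from `(ℝ^n, NX)` to `(ℝ^n, NY)`:
`e_k = inf {ε > 0 : ∃ y_1, …, y_{2^{k-1}} with B_X ⊆ ⋃ (y_i + ε B_Y)}`. -/
noncomputable def entropyNumber (n : ℕ) (NX NY : (Fin n → ℝ) → ℝ) (k : ℕ) : ℝ :=
  sInf {ε : ℝ | 0 < ε ∧ ∃ T : Finset (Fin n → ℝ), T.card ≤ 2 ^ (k - 1) ∧
    ∀ x : Fin n → ℝ, NX x ≤ 1 → ∃ y ∈ T, NY (x - y) ≤ ε}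

/-- `N` is a quasi-norm on `ℝ^n` with quasi-norm constant at most `C`. -/
def IsQuasiNormWith (n : ℕ) (C : ℝ) (N : (Fin n → ℝ) → ℝ) : Prop :=
  (∀ x, 0 ≤ N x) ∧ (∀ x, N x = 0 ↔ x = 0) ∧
  (∀ (a : ℝ) (x : Fin n → ℝ), N (a • x) = |a| * N x) ∧
  (∀ x y : Fin n → ℝ, N (x + y) ≤ C * (N x + N y))

/-- `N` is `1`-unconditional with respect to the standard basis of `ℝ^n`. -/
def IsUnconditional (n : ℕ) (N : (Fin n → ℝ) → ℝ) : Prop :=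
  ∀ (x ε : Fin n → ℝ), (∀ i, ε i = 1 ∨ ε i = -1) →
    N (fun i => ε i * x i) = N x

/-- `N` is `1`-symmetric with respect to the standard basis of `ℝ^n`. -/
def IsSymmetricNorm (n : ℕ) (N : (Fin n → ℝ) → ℝ) : Prop :=
  ∀ (x ε : Fin n → ℝ) (π : Equiv.Perm (Fin n)), (∀ i, ε i = 1 ∨ ε i = -1) →
    N (fun i => ε i * x (π i)) = N x

section Monotonicity

/-- Truncated dyadic expansions of multipliers with digits `±1`. -/
lemma exists_dyadic_multiplier (C : ℝ) (hC : 1 ≤ C) (m : ℕ) :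
    ∃ K : ℝ, 0 ≤ K ∧ ∀ (n : ℕ) (N : (Fin n → ℝ) → ℝ), IsQuasiNormWith n C N →
      IsSymmetricNorm n N → ∀ x l : Fin n → ℝ, (∀ i, |l i| ≤ 1) →
        ∃ u v : Fin n → ℝ, (∀ i, |v i| ≤ 1) ∧ (∀ i, l i = u i + (1 / 2) ^ m * v i) ∧
          N (fun i => u i * x i) ≤ K * N x := by
  induction m with
  | zero =>
    refine ⟨0, le_rfl, fun n N hN _ x l hl => ⟨fun _ => 0, l, hl, by simp, ?_⟩⟩
    have : (fun i => (0 : ℝ) * x i) = 0 := by ext; simp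
    rw [this, (hN.2.1 0).2 rfl]; simp
  | succ m ih =>
    obtain ⟨K, hK, h⟩ := ih
    refine ⟨C * (K + 1), by positivity, fun n N hN hS x l hl => ?_⟩
    obtain ⟨u, v, hv, hl', hu⟩ := h n N hN hS x l hl
    set s : Fin n → ℝ := fun i => if 0 ≤ v i then 1 else -1 with hs
    have hs1 : ∀ i, s i = 1 ∨ s i = -1 := by
      intro i; simp only [hs]; split_ifs <;> simp
    refine ⟨fun i => u i + (1 / 2) ^ (m + 1) * s i, fun i => 2 * v i - s i, fun i => ?_,
      fun i => ?_, ?_⟩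
    · have := abs_le.1 (hv i)
      simp only [hs]
      split_ifs with h0 <;> rw [abs_le] <;> constructor <;> linarith
    · rw [hl' i]; ring
    · have h1 := hN.2.2.2 (fun i => u i * x i) (((1 : ℝ) / 2) ^ (m + 1) • fun i => s i * x i)
      have h2 : N (((1 : ℝ) / 2) ^ (m + 1) • fun i => s i * x i) ≤ N x := by
        have hsx : N (fun i => s i * x i) = N x := hS x s (Equiv.refl _) hs1
        rw [hN.2.2.1, hsx, abs_of_nonneg (by positivity)]
        exact mul_le_of_le_one_left (hN.1 x) (pow_le_one₀ (by norm_num) (by norm_num))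
      have h3 : ((fun i => u i * x i) + ((1 : ℝ) / 2) ^ (m + 1) • fun i => s i * x i) =
          fun i => (u i + (1 / 2) ^ (m + 1) * s i) * x i := by
        ext i; simp; ring
      rw [h3] at h1
      calc _ ≤ _ := h1
        _ ≤ C * (K * N x + N x) := by gcongr
        _ = _ := by ring

lemma IsQuasiNormWith.exists_multiplier_bound {n : ℕ} {C : ℝ} {N : (Fin n → ℝ) → ℝ}
    (hC : 1 ≤ C) (hN : IsQuasiNormWith n C N) (x : Fin n → ℝ) (S : Finset (Fin n)) :
    ∃ B : ℝ, ∀ l : Fin n → ℝ, (∀ i, |l i| ≤ 1) →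
      N (fun i => if i ∈ S then l i * x i else 0) ≤ B := by
  induction S using Finset.induction_on with
  | empty =>
    refine ⟨0, fun l _ => ?_⟩
    have : (fun i : Fin n => if i ∈ (∅ : Finset (Fin n)) then l i * x i else 0) = 0 := by
      ext; simp
    rw [this, (hN.2.1 0).2 rfl]
  | insert a S ha ih =>
    obtain ⟨B, hB⟩ := ih
    refine ⟨C * (B + N (Pi.single a (x a))), fun l hl => ?_⟩
    have h1 := hN.2.2.2 (fun i => if i ∈ S then l i * x i else 0) (l a • Pi.single a (x a))
    have h2 : (fun i => if i ∈ S then l i * x i else 0) + l a • Pi.single a (x a) =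
        fun i => if i ∈ insert a S then l i * x i else 0 := by
      ext i
      by_cases hi : i = a
      · subst hi; simp [ha]
      · simp [hi]
    rw [h2, hN.2.2.1] at h1
    have h3 : |l a| * N (Pi.single a (x a)) ≤ N (Pi.single a (x a)) :=
      mul_le_of_le_one_left (hN.1 _) (hl a)
    calc _ ≤ _ := h1
      _ ≤ _ := by gcongr; exact hB l hl

/-- A symmetric quasi-norm is a lattice quasi-norm up to a constant depending only on the
quasi-norm constant. -/
lemma exists_monotone_const (C : ℝ) (hC : 1 ≤ C) :
    ∃ L : ℝ, 0 < L ∧ ∀ (n : ℕ) (N : (Fin n → ℝ) → ℝ), IsQuasiNormWith n C N →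
      IsSymmetricNorm n N → ∀ x y : Fin n → ℝ, (∀ i, |x i| ≤ |y i|) → N x ≤ L * N y := by
  obtain ⟨m, hm⟩ := pow_unbounded_of_one_lt (2 * C) (one_lt_two : (1 : ℝ) < 2)
  obtain ⟨K, hK, h⟩ := exists_dyadic_multiplier C hC m
  refine ⟨2 * C * K + 1, by positivity, fun n N hN hS x y hxy => ?_⟩
  have hCm : C * (1 / 2) ^ m ≤ 1 / 2 := by
    rw [one_div, inv_pow, ← div_eq_mul_inv, div_le_iff₀ (by positivity)]; linarith
  set V : Set ℝ := {r | ∃ l : Fin n → ℝ, (∀ i, |l i| ≤ 1) ∧ r = N (fun i => l i * y i)}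
  have hbdd : BddAbove V := by
    obtain ⟨B, hB⟩ := hN.exists_multiplier_bound hC y Finset.univ
    refine ⟨B, ?_⟩
    rintro r ⟨l, hl, rfl⟩
    simpa using hB l hl
  have hne : V.Nonempty := ⟨_, fun _ => 0, by simp, rfl⟩
  have hsup : sSup V ≤ C * (K * N y + (1 / 2) ^ m * sSup V) := by
    refine csSup_le hne ?_
    rintro r ⟨l, hl, rfl⟩
    obtain ⟨u, v, hv, hlu, hu⟩ := h n N hN hS y l hl
    have h1 := hN.2.2.2 (fun i => u i * y i) (((1 : ℝ) / 2) ^ m • fun i => v i * y i)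
    have h3 : ((fun i => u i * y i) + ((1 : ℝ) / 2) ^ m • fun i => v i * y i) =
        fun i => l i * y i := by
      ext i; simp [hlu i]; ring
    rw [h3, hN.2.2.1, abs_of_nonneg (by positivity)] at h1
    have h2 : N (fun i => v i * y i) ≤ sSup V := le_csSup hbdd ⟨v, hv, rfl⟩
    calc _ ≤ _ := h1
      _ ≤ _ := by gcongr
  have hx : N x ≤ sSup V := by
    refine le_csSup hbdd ⟨fun i => x i / y i, fun i => ?_, ?_⟩
    · rw [abs_div]; exact div_le_one_of_le₀ (hxy i) (abs_nonneg _)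
    · congr 1; ext i
      by_cases hy : y i = 0
      · have := hxy i
        rw [hy, abs_zero] at this
        simp [hy, abs_nonpos_iff.1 this]
      · field_simp
  have h0 : 0 ≤ sSup V := (hN.1 x).trans hx
  have := mul_le_mul_of_nonneg_right hCm h0
  have hy := hN.1 y
  nlinarith

end Monotonicity

section Rearrangement

lemma exists_perm_mapsTo_of_card_le {α : Type*} [Fintype α] [DecidableEq α] {A B : Finset α}
    (h : B.card ≤ A.card) : ∃ π : Equiv.Perm α, ∀ i ∈ B, π i ∈ A := by
  obtain ⟨A', hA', hc⟩ := Finset.exists_subset_card_eq h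
  let e : {i // i ∈ B} ≃ {i // i ∈ A'} := Fintype.equivOfCardEq (by simp [hc])
  exact ⟨e.extendSubtype, fun i hi => hA' (e.extendSubtype_mem i hi)⟩

/-- Growth of the fundamental function. -/
lemma IsQuasiNormWith.indicator_le {n : ℕ} {C L : ℝ} {N : (Fin n → ℝ) → ℝ} (hC : 1 ≤ C)
    (hN : IsQuasiNormWith n C N) (hS : IsSymmetricNorm n N)
    (hL : ∀ x y : Fin n → ℝ, (∀ i, |x i| ≤ |y i|) → N x ≤ L * N y)
    (A : Finset (Fin n)) (m : ℕ) (B : Finset (Fin n)) (hB : B.card ≤ 2 ^ m * A.card) :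
    N (fun i => if i ∈ B then 1 else 0) ≤ (2 * C) ^ m * (L * N (fun i => if i ∈ A then 1 else 0)) := by
  induction m generalizing B with
  | zero =>
    obtain ⟨π, hπ⟩ := exists_perm_mapsTo_of_card_le (A := A) (B := B) (by simpa using hB)
    have h1 := hS (fun i => if i ∈ A then 1 else 0) (fun _ => 1) π (by simp)
    rw [← h1, pow_zero, one_mul]
    apply hL
    intro i
    by_cases hi : i ∈ B
    · simp [hi, hπ i hi]
    · simp only [hi, if_false, abs_zero]; positivity
  | succ m ih =>
    obtain ⟨B₁, hB₁, hc⟩ := Finset.exists_subset_card_eq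
      (min_le_left B.card (2 ^ m * A.card))
    have h1 := ih B₁ (hc ▸ min_le_right _ _)
    have h2 := ih (B \ B₁) (by
      rw [Finset.card_sdiff_of_subset hB₁, hc]
      rw [pow_succ] at hB
      rcases min_choice B.card (2 ^ m * A.card) with h | h <;> rw [h]
      · simp
      · have : 2 ^ m * 2 * A.card = 2 ^ m * A.card + 2 ^ m * A.card := by ring
        omega)
    have h3 := hN.2.2.2 (fun i => if i ∈ B₁ then 1 else 0) (fun i => if i ∈ B \ B₁ then 1 else 0)
    have h4 : ((fun i => if i ∈ B₁ then (1 : ℝ) else 0) + fun i => if i ∈ B \ B₁ then 1 else 0) =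
        fun i => if i ∈ B then 1 else 0 := by
      ext i
      by_cases hi : i ∈ B₁
      · simp [hi, hB₁ hi]
      · simp [hi]
    rw [h4] at h3
    calc _ ≤ _ := h3
      _ ≤ _ := mul_le_mul_of_nonneg_left (add_le_add h1 h2) (by positivity)
      _ = _ := by ring

lemma sum_one_div_sqrt_le (n : ℕ) :
    ∑ j ∈ Finset.range n, 1 / √((j : ℝ) + 1) ≤ 2 * √(n : ℝ) := by
  induction n with
  | zero => simp
  | succ n ih =>
    rw [Finset.sum_range_succ]
    push_cast
    have h0 : 0 < √((n : ℝ) + 1) := Real.sqrt_pos.2 (by positivity)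
    have h1 : √(n : ℝ) ^ 2 = n := Real.sq_sqrt (by positivity)
    have h2 : √((n : ℝ) + 1) ^ 2 = n + 1 := Real.sq_sqrt (by positivity)
    have h3 : 1 / √((n : ℝ) + 1) ≤ 2 * (√((n : ℝ) + 1) - √(n : ℝ)) := by
      rw [div_le_iff₀ h0]
      nlinarith [sq_nonneg (√((n : ℝ) + 1) - √(n : ℝ))]
    linarith

lemma one_add_mul_pow_le_exp {ρ u : ℝ} (hρ : 0 ≤ ρ) (hu : 0 ≤ u) {r : ℕ} (hr : r ≠ 0) :
    1 + ρ ^ (2 * r) * u ^ r ≤ Real.exp (2 * r * ρ * √u) := by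
  have hv : 0 ≤ ρ * √u := by positivity
  calc 1 + ρ ^ (2 * r) * u ^ r = 1 ^ (2 * r) + (ρ * √u) ^ (2 * r) := by
        rw [mul_pow, pow_mul (√u), Real.sq_sqrt hu, one_pow]
    _ ≤ (1 + ρ * √u) ^ (2 * r) := pow_add_pow_le zero_le_one hv (by omega)
    _ ≤ Real.exp (ρ * √u) ^ (2 * r) := by
        gcongr
        linarith [Real.add_one_le_exp (ρ * √u)]
    _ = _ := by rw [← Real.exp_nat_mul]; congr 1; push_cast; ring

lemma IsQuasiNormWith.ones_pos {n : ℕ} {C : ℝ} {N : (Fin n → ℝ) → ℝ} (hn : 0 < n)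
    (hN : IsQuasiNormWith n C N) : 0 < N (fun _ => 1) := by
  refine lt_of_le_of_ne (hN.1 _) fun h => ?_
  have := congrFun ((hN.2.1 _).1 h.symm) ⟨0, hn⟩
  simp at this

/-- On the unit ball, the normalized coordinates are controlled by their decreasing
rearrangement, which is at most that of a weak `ℓ_p`-type ball. -/
lemma exists_prod_le (C : ℝ) (hC : 1 ≤ C) :
    ∃ κ : ℝ, 0 < κ ∧ ∀ (n : ℕ), 0 < n → ∀ N : (Fin n → ℝ) → ℝ, IsQuasiNormWith n C N →
      IsSymmetricNorm n N → ∀ x : Fin n → ℝ, N x ≤ 1 →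
        ∏ i, (1 + κ * (N (fun _ => 1) * |x i|)) ^ 2 ≤ (11 / 10 : ℝ) ^ n := by
  obtain ⟨L, hL0, hL⟩ := exists_monotone_const C hC
  obtain ⟨r, hr⟩ := pow_unbounded_of_one_lt (2 * C) (one_lt_two : (1 : ℝ) < 2)
  have hr0 : r ≠ 0 := by
    rintro rfl
    rw [pow_zero] at hr; linarith
  have hr0' : (0 : ℝ) < r := by positivity
  set ρ : ℝ := Real.log (11 / 10) / (8 * r) with hρ
  have hρ0 : 0 < ρ := div_pos (Real.log_pos (by norm_num)) (by positivity)
  set D : ℝ := L * L * 2 ^ r with hD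
  have hD0 : 0 < D := by positivity
  refine ⟨ρ ^ (2 * r) / D, by positivity, fun n hn N hN hS x hx => ?_⟩
  have hn' : (0 : ℝ) < n := by positivity
  set σ : Equiv.Perm (Fin n) := Tuple.sort (fun i => -|x i|) with hσ
  have hmono : Monotone ((fun i => -|x i|) ∘ σ) := Tuple.monotone_sort _
  have hdecay : ∀ j : Fin n, N (fun _ => 1) * |x (σ j)| ≤ D * ((n : ℝ) / ((j : ℝ) + 1)) ^ r := by
    intro j
    set A : Finset (Fin n) := (Finset.Iic j).map σ.toEmbedding with hA
    have hcard : A.card = j + 1 := by simp [hA]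
    have hA1 : |x (σ j)| * N (fun i => if i ∈ A then 1 else 0) ≤ L := by
      have h1 := hL n N hN hS (|x (σ j)| • fun i => if i ∈ A then 1 else 0) x (by
        intro i
        by_cases hi : i ∈ A
        · obtain ⟨l, hl, rfl⟩ := Finset.mem_map.1 hi
          have := hmono (Finset.mem_Iic.1 hl)
          simp only [Function.comp_apply, neg_le_neg_iff] at this
          rw [Pi.smul_apply, if_pos hi, smul_eq_mul, mul_one, abs_abs]
          exact this
        · simp [hi])
      rw [hN.2.2.1, abs_abs] at h1
      calc _ ≤ _ := h1
        _ ≤ L * 1 := by gcongr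
        _ = L := mul_one _
    obtain ⟨m, hm1, hm2⟩ : ∃ m : ℕ, n ≤ 2 ^ m * (j + 1) ∧
        (2 : ℝ) ^ m ≤ 2 * ((n : ℝ) / ((j : ℝ) + 1)) := by
      have hex : ∃ m : ℕ, n ≤ 2 ^ m * ((j : ℕ) + 1) :=
        ⟨n, Nat.lt_two_pow_self.le.trans (Nat.le_mul_of_pos_right _ (by omega))⟩
      refine ⟨Nat.find hex, Nat.find_spec hex, ?_⟩
      have hj1 : (j : ℝ) + 1 ≤ n := by exact_mod_cast j.2
      rcases Nat.eq_zero_or_pos (Nat.find hex) with h0 | h0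
      · rw [h0, pow_zero]
        have : 1 ≤ (n : ℝ) / ((j : ℝ) + 1) := (one_le_div (by positivity)).2 hj1
        linarith
      · have h1 := Nat.find_min hex (Nat.sub_lt h0 one_pos)
        push Not at h1
        have h2 : (2 : ℝ) ^ (Nat.find hex - 1) * ((j : ℝ) + 1) < n := by exact_mod_cast h1
        have h3 : (2 : ℝ) ^ (Nat.find hex) = 2 * 2 ^ (Nat.find hex - 1) := by
          rw [← pow_succ', Nat.sub_add_cancel h0]
        rw [h3]
        have := (lt_div_iff₀ (by positivity)).2 h2
        linarith
    have h2 := hN.indicator_le hC hS (hL n N hN hS) A m Finset.univ (by simpa [hcard] using hm1)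
    simp only [Finset.mem_univ, if_true] at h2
    have h3 : (2 * C) ^ m ≤ 2 ^ r * ((n : ℝ) / ((j : ℝ) + 1)) ^ r := by
      calc (2 * C) ^ m ≤ (2 ^ r) ^ m := by gcongr
        _ = (2 ^ m) ^ r := by rw [← pow_mul, ← pow_mul, mul_comm]
        _ ≤ (2 * ((n : ℝ) / ((j : ℝ) + 1))) ^ r := by gcongr
        _ = _ := mul_pow _ _ _
    calc N (fun _ => 1) * |x (σ j)|
        ≤ ((2 * C) ^ m * (L * N (fun i => if i ∈ A then 1 else 0))) * |x (σ j)| := by gcongr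
      _ = (2 * C) ^ m * L * (|x (σ j)| * N (fun i => if i ∈ A then 1 else 0)) := by ring
      _ ≤ (2 ^ r * ((n : ℝ) / ((j : ℝ) + 1)) ^ r) * L * L :=
          mul_le_mul (mul_le_mul_of_nonneg_right h3 hL0.le) hA1
            (mul_nonneg (abs_nonneg _) (hN.1 _)) (by positivity)
      _ = _ := by rw [hD]; ring
  have hφ := hN.1 (fun _ => 1)
  have hterm : ∀ j : Fin n, (1 + ρ ^ (2 * r) / D * (N (fun _ => 1) * |x (σ j)|)) ^ 2 ≤
      Real.exp (4 * r * ρ * √n * (1 / √((j : ℝ) + 1))) := by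
    intro j
    have h1 : 1 + ρ ^ (2 * r) / D * (N (fun _ => 1) * |x (σ j)|) ≤
        Real.exp (2 * r * ρ * √((n : ℝ) / ((j : ℝ) + 1))) := by
      refine le_trans ?_ (one_add_mul_pow_le_exp hρ0.le (by positivity) hr0)
      calc _ ≤ 1 + ρ ^ (2 * r) / D * (D * ((n : ℝ) / ((j : ℝ) + 1)) ^ r) := by
            gcongr _ + _ * ?_; exact hdecay j
        _ = _ := by field_simp
    calc _ ≤ Real.exp (2 * r * ρ * √((n : ℝ) / ((j : ℝ) + 1))) ^ 2 := by gcongr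
      _ = _ := by
        rw [← Real.exp_nat_mul, Real.sqrt_div hn'.le]; congr 1; push_cast; ring
  rw [← Equiv.prod_comp σ]
  calc _ ≤ ∏ j : Fin n, Real.exp (4 * r * ρ * √n * (1 / √((j : ℝ) + 1))) :=
        Finset.prod_le_prod (fun j _ => by positivity) fun j _ => hterm j
    _ = Real.exp (4 * r * ρ * √n * ∑ j ∈ Finset.range n, 1 / √((j : ℝ) + 1)) := by
        rw [← Real.exp_sum, ← Finset.mul_sum,
          Fin.sum_univ_eq_sum_range (fun j : ℕ => 1 / √((j : ℝ) + 1))]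
    _ ≤ Real.exp (4 * r * ρ * √n * (2 * √n)) := by
        gcongr; exact sum_one_div_sqrt_le n
    _ = Real.exp (n * Real.log (11 / 10)) := by
        congr 1
        have : √(n : ℝ) * √n = n := Real.mul_self_sqrt hn'.le
        calc _ = 8 * r * ρ * (√(n : ℝ) * √n) := by ring
          _ = _ := by rw [this, hρ]; field_simp
    _ = (11 / 10 : ℝ) ^ n := by
        rw [Real.exp_nat_mul, Real.exp_log (by norm_num)]

end Rearrangement

section Counting

lemma sum_range_one_div_sq_le {s : ℝ} (hs : 0 < s) (R : ℕ) :
    ∑ j ∈ Finset.range R, 1 / (1 + s * ((j : ℝ) + 1)) ^ 2 ≤ 1 / s - 1 / (s * (1 + s * R)) := by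
  induction R with
  | zero => simp
  | succ R ih =>
    rw [Finset.sum_range_succ]
    push_cast
    have : 1 / (1 + s * ((R : ℝ) + 1)) ^ 2 ≤
        1 / (s * (1 + s * R)) - 1 / (s * (1 + s * ((R : ℝ) + 1))) := by
      have e : 1 / (s * (1 + s * R)) - 1 / (s * (1 + s * ((R : ℝ) + 1))) =
          1 / ((1 + s * R) * (1 + s * ((R : ℝ) + 1))) := by
        field_simp; ring
      rw [e, sq]
      gcongr
      linarith
    linarith

lemma sum_int_one_div_sq_le {s : ℝ} (hs : 0 < s) (S : Finset ℤ) :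
    ∑ z ∈ S, 1 / (1 + s * |(z : ℝ)|) ^ 2 ≤ 1 + 2 / s := by
  obtain ⟨R, hR⟩ : ∃ R : ℕ, ∀ z ∈ S, z.natAbs ≤ R :=
    ⟨S.sup Int.natAbs, fun z hz => Finset.le_sup (f := Int.natAbs) hz⟩
  set f : ℤ → ℝ := fun z => 1 / (1 + s * |(z : ℝ)|) ^ 2 with hf
  have hf0 : ∀ z, 0 ≤ f z := fun z => by positivity
  have hsub : S ⊆ {0} ∪ ((Finset.range R).image (fun j : ℕ => ((j : ℤ) + 1)) ∪
      (Finset.range R).image (fun j : ℕ => -((j : ℤ) + 1))) := by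
    intro z hz
    have := hR z hz
    simp only [Finset.mem_union, Finset.mem_singleton, Finset.mem_image, Finset.mem_range]
    rcases lt_trichotomy z 0 with h | h | h
    · exact Or.inr (Or.inr ⟨z.natAbs - 1, by omega, by omega⟩)
    · exact Or.inl h
    · exact Or.inr (Or.inl ⟨z.natAbs - 1, by omega, by omega⟩)
  have hun : ∀ P Q : Finset ℤ, ∑ z ∈ P ∪ Q, f z ≤ ∑ z ∈ P, f z + ∑ z ∈ Q, f z := by
    intro P Q
    rw [← Finset.sum_union_inter]
    exact le_add_of_nonneg_right (Finset.sum_nonneg fun z _ => hf0 z)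
  have hR0 : ∑ j ∈ Finset.range R, 1 / (1 + s * ((j : ℝ) + 1)) ^ 2 ≤ 1 / s :=
    (sum_range_one_div_sq_le hs R).trans (sub_le_self _ (by positivity))
  have habs : ∀ j : ℕ, |((j : ℝ) + 1)| = j + 1 := fun j => abs_of_nonneg (by positivity)
  have h1 : ∑ z ∈ (Finset.range R).image (fun j : ℕ => ((j : ℤ) + 1)), f z ≤ 1 / s := by
    rw [Finset.sum_image (by intro a _ b _ h; simpa using h)]
    simpa [hf, habs] using hR0
  have h2 : ∑ z ∈ (Finset.range R).image (fun j : ℕ => -((j : ℤ) + 1)), f z ≤ 1 / s := by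
    rw [Finset.sum_image (by intro a _ b _ h; simp at h; omega)]
    have : ∀ j : ℕ, f (-((j : ℤ) + 1)) = 1 / (1 + s * ((j : ℝ) + 1)) ^ 2 := by
      intro j
      simp only [hf]
      push_cast
      rw [abs_neg, habs]
    simpa only [this] using hR0
  calc ∑ z ∈ S, f z ≤ _ := Finset.sum_le_sum_of_subset_of_nonneg hsub fun z _ _ => hf0 z
    _ ≤ _ := hun _ _
    _ ≤ ∑ z ∈ {0}, f z + (1 / s + 1 / s) := by
        gcongr
        exact (hun _ _).trans (add_le_add h1 h2)
    _ = 1 + 2 / s := by simp [hf]; ring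

/-- Counting lattice points by a product weight. -/
lemma card_le_of_prod_le {n : ℕ} {s W : ℝ} (hs : 0 < s) (hW : 0 ≤ W)
    (F : Finset (Fin n → ℤ)) (hF : ∀ z ∈ F, ∏ i, (1 + s * |(z i : ℝ)|) ^ 2 ≤ W) :
    (F.card : ℝ) ≤ W * (1 + 2 / s) ^ n := by
  calc (F.card : ℝ) = ∑ z ∈ F, (1 : ℝ) := by simp
    _ ≤ ∑ z ∈ F, W * ∏ i, 1 / (1 + s * |(z i : ℝ)|) ^ 2 := by
        refine Finset.sum_le_sum fun z hz => ?_
        have hp : 0 < ∏ i, (1 + s * |(z i : ℝ)|) ^ 2 := Finset.prod_pos fun i _ => by positivity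
        rw [Finset.prod_div_distrib, Finset.prod_const_one, mul_one_div, one_le_div hp]
        exact hF z hz
    _ ≤ ∑ z ∈ Fintype.piFinset (fun i => F.image (fun z : Fin n → ℤ => (z i : ℤ))),
          W * ∏ i, 1 / (1 + s * |(z i : ℝ)|) ^ 2 := by
        refine Finset.sum_le_sum_of_subset_of_nonneg (fun z hz => ?_) fun z _ _ => by positivity
        exact Fintype.mem_piFinset.2 fun i => Finset.mem_image_of_mem _ hz
    _ = W * ∏ i, ∑ a ∈ F.image (fun z : Fin n → ℤ => (z i : ℤ)), 1 / (1 + s * |(a : ℝ)|) ^ 2 := by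
        rw [← Finset.mul_sum, Finset.prod_univ_sum]
    _ ≤ W * ∏ _i : Fin n, (1 + 2 / s) := by
        gcongr with i
        exact sum_int_one_div_sq_le hs _
    _ = _ := by simp

end Counting

section Entropy

lemma Int.exists_abs_le_abs_sub_le_one (t : ℝ) : ∃ z : ℤ, |(z : ℝ)| ≤ |t| ∧ |t - z| ≤ 1 := by
  rcases le_total 0 t with h | h
  · have h0 : (0 : ℝ) ≤ ⌊t⌋ := by exact_mod_cast Int.floor_nonneg.2 h
    have h1 := Int.floor_le t
    have h2 := Int.lt_floor_add_one t
    refine ⟨⌊t⌋, ?_, ?_⟩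
    · rwa [abs_of_nonneg h0, abs_of_nonneg h]
    · rw [abs_le]; constructor <;> linarith
  · have h0 : (⌈t⌉ : ℝ) ≤ 0 := by exact_mod_cast Int.ceil_le.2 (by simpa using h)
    have h1 := Int.le_ceil t
    have h2 := Int.ceil_lt_add_one t
    refine ⟨⌈t⌉, ?_, ?_⟩
    · rw [abs_of_nonpos h0, abs_of_nonpos h]; linarith
    · rw [abs_le]; constructor <;> linarith

/-- The unit ball is covered by few small cubes, hence by few small balls of another
symmetric quasi-norm. -/
lemma exists_cover {n : ℕ} (hn : 0 < n) {C κ L : ℝ} (hκ : 0 < κ)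
    {NX NY : (Fin n → ℝ) → ℝ} (hX : IsQuasiNormWith n C NX)
    (hY : IsQuasiNormWith n C NY)
    (hprod : ∀ x : Fin n → ℝ, NX x ≤ 1 →
        ∏ i, (1 + κ * (NX (fun _ => 1) * |x i|)) ^ 2 ≤ (11 / 10 : ℝ) ^ n)
    (hL : ∀ x y : Fin n → ℝ, (∀ i, |x i| ≤ |y i|) → NY x ≤ L * NY y)
    {s : ℝ} (hs : 0 < s) :
    ∃ T : Finset (Fin n → ℝ), (T.card : ℝ) ≤ (11 / 10 * (1 + 2 / (κ * s))) ^ n ∧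
      ∀ x : Fin n → ℝ, NX x ≤ 1 →
        ∃ y ∈ T, NY (x - y) ≤ L * (s * (NY (fun _ => 1) / NX (fun _ => 1))) := by
  classical
  have hφ := hX.ones_pos hn
  set Z : Set (Fin n → ℤ) := {z | ∏ i, (1 + κ * s * |(z i : ℝ)|) ^ 2 ≤ (11 / 10 : ℝ) ^ n}
  have hcard : ∀ F : Finset (Fin n → ℤ), (F : Set (Fin n → ℤ)) ⊆ Z →
      (F.card : ℝ) ≤ (11 / 10 * (1 + 2 / (κ * s))) ^ n := fun F hF => by
    rw [mul_pow]
    exact card_le_of_prod_le (by positivity) (by positivity) F fun z hz => hF hz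
  have hfin : Z.Finite := by
    by_contra hinf
    obtain ⟨F, hF, hc⟩ := Set.Infinite.exists_subset_card_eq hinf
      (⌊(11 / 10 * (1 + 2 / (κ * s))) ^ n⌋₊ + 1)
    have h1 := hcard F hF
    rw [hc] at h1
    push_cast at h1
    exact absurd (Nat.lt_floor_add_one ((11 / 10 * (1 + 2 / (κ * s))) ^ n)) (not_lt.2 h1)
  refine ⟨hfin.toFinset.image fun z i => s / NX (fun _ => 1) * (z i : ℝ), ?_, fun x hx => ?_⟩
  · exact (Nat.cast_le.2 Finset.card_image_le).trans (hcard _ (by simp))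
  · choose z hz1 hz2 using fun i => Int.exists_abs_le_abs_sub_le_one (NX (fun _ => 1) * x i / s)
    refine ⟨_, Finset.mem_image_of_mem _ (hfin.mem_toFinset.2 (?_ : z ∈ Z)), ?_⟩
    · refine le_trans (Finset.prod_le_prod (fun i _ => by positivity) fun i _ => ?_) (hprod x hx)
      have := hz1 i
      rw [abs_div, abs_mul, abs_of_pos hs, abs_of_pos hφ, le_div_iff₀ hs] at this
      have h2 : κ * s * |(z i : ℝ)| ≤ κ * (NX (fun _ => 1) * |x i|) := by
        rw [mul_assoc, mul_comm s]; gcongr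
      gcongr
    · have h1 := hL (x - fun i => s / NX (fun _ => 1) * (z i : ℝ))
        ((s / NX (fun _ => 1)) • fun _ => 1) (fun i => by
          have e : x i - s / NX (fun _ => 1) * (z i : ℝ) =
              s / NX (fun _ => 1) * (NX (fun _ => 1) * x i / s - z i) := by field_simp
          simp only [Pi.sub_apply, Pi.smul_apply, smul_eq_mul, mul_one]
          rw [e, abs_mul]
          exact mul_le_of_le_one_right (abs_nonneg _) (hz2 i))
      rw [hY.2.2.1, abs_of_pos (by positivity)] at h1
      calc _ ≤ _ := h1
        _ = _ := by ring

/-- A covering of the unit ball by `ε`-balls has many elements. -/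
lemma le_of_cover {n : ℕ} (hn : 0 < n) {C κ L ε : ℝ} (hC : 1 ≤ C) (hκ : 0 < κ) (hL0 : 0 < L)
    {NX NY : (Fin n → ℝ) → ℝ} (hX : IsQuasiNormWith n C NX)
    (hY : IsQuasiNormWith n C NY)
    (hprod : ∀ x : Fin n → ℝ, NY x ≤ 1 →
        ∏ i, (1 + κ * (NY (fun _ => 1) * |x i|)) ^ 2 ≤ (11 / 10 : ℝ) ^ n)
    (hL : ∀ x y : Fin n → ℝ, (∀ i, |x i| ≤ |y i|) → NX x ≤ L * NX y)
    (hε : 0 < ε) {T : Finset (Fin n → ℝ)}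
    (hT : ∀ x : Fin n → ℝ, NX x ≤ 1 → ∃ y ∈ T, NY (x - y) ≤ ε) :
    (NY (fun _ => 1) / (L * NX (fun _ => 1) * (2 * C * ε))) ^ n ≤
      T.card * (11 / 10 * (1 + 2 / κ)) ^ n := by
  classical
  have hφX := hX.ones_pos hn
  have hφY := hY.ones_pos hn
  set δ : ℝ := 2 * C * ε / NY (fun _ => 1) with hδ
  have hδ0 : 0 < δ := by positivity
  set a : ℝ := 1 / (L * NX (fun _ => 1)) with ha
  have ha0 : 0 < a := by positivity
  set m : ℕ := ⌊a / δ⌋₊ with hm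
  have hma : (m : ℝ) * δ ≤ a := by
    rw [← le_div_iff₀ hδ0]; exact Nat.floor_le (by positivity)
  set G : Finset (Fin n → ℤ) := Fintype.piFinset fun _ => Finset.Icc 0 (m : ℤ) with hG
  have hGcard : G.card = (m + 1) ^ n := by simp [hG]
  have hmem : ∀ z ∈ G, ∃ y ∈ T, NY ((fun i => δ * (z i : ℝ)) - y) ≤ ε := by
    intro z hz
    refine hT _ ?_
    have h1 := hL (fun i => δ * (z i : ℝ)) (a • fun _ => 1) (fun i => by
      have h2 := Finset.mem_Icc.1 (Fintype.mem_piFinset.1 hz i)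
      have h3 : (0 : ℝ) ≤ z i := by exact_mod_cast h2.1
      have h4 : (z i : ℝ) ≤ m := by exact_mod_cast h2.2
      simp only [Pi.smul_apply, smul_eq_mul, mul_one]
      rw [abs_of_nonneg (by positivity), abs_of_pos ha0]
      nlinarith)
    rw [hX.2.2.1, abs_of_pos ha0] at h1
    refine h1.trans_eq ?_
    rw [ha]; field_simp
  choose! f hf1 hf2 using hmem
  have hfib : ∀ y ∈ T, (({z ∈ G | f z = y} : Finset (Fin n → ℤ)).card : ℝ) ≤
      (11 / 10 * (1 + 2 / κ)) ^ n := by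
    intro y _
    rcases ({z ∈ G | f z = y} : Finset (Fin n → ℤ)).eq_empty_or_nonempty with h | ⟨z₀, hz₀⟩
    · rw [h]; simp; positivity
    rw [← Finset.card_image_of_injective _ (sub_left_injective (b := z₀)), mul_pow]
    refine card_le_of_prod_le hκ (by positivity) _ fun w hw => ?_
    obtain ⟨z, hz, rfl⟩ := Finset.mem_image.1 hw
    rw [Finset.mem_filter] at hz hz₀
    have h1 := hf2 z hz.1
    have h0 := hf2 z₀ hz₀.1
    rw [hz.2] at h1
    rw [hz₀.2] at h0
    have h2 := hY.2.2.2 ((fun i => δ * (z i : ℝ)) - y)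
      ((-1 : ℝ) • ((fun i => δ * (z₀ i : ℝ)) - y))
    rw [hY.2.2.1, abs_neg, abs_one, one_mul] at h2
    have h3 : NY (((fun i => δ * (z i : ℝ)) - y) +
        (-1 : ℝ) • ((fun i => δ * (z₀ i : ℝ)) - y)) ≤ 2 * C * ε := by
      calc _ ≤ _ := h2
        _ ≤ C * (ε + ε) := by gcongr
        _ = _ := by ring
    have h4 := hprod ((2 * C * ε)⁻¹ • (((fun i => δ * (z i : ℝ)) - y) +
        (-1 : ℝ) • ((fun i => δ * (z₀ i : ℝ)) - y))) (by
      rw [hY.2.2.1, abs_of_pos (by positivity)]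
      exact inv_mul_le_one_of_le₀ h3 (by positivity))
    refine le_of_eq_of_le (Finset.prod_congr rfl fun i _ => ?_) h4
    have e : ((2 * C * ε)⁻¹ • (((fun i => δ * (z i : ℝ)) - y) +
        (-1 : ℝ) • ((fun i => δ * (z₀ i : ℝ)) - y))) i =
        (NY (fun _ => 1))⁻¹ * ((z i : ℝ) - z₀ i) := by
      simp only [Pi.smul_apply, Pi.add_apply, Pi.sub_apply, smul_eq_mul, hδ]
      field_simp
      ring
    rw [e, abs_mul, abs_of_pos (inv_pos.2 hφY), mul_inv_cancel_left₀ hφY.ne']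
    simp
  calc _ = (a / δ) ^ n := by congr 1; rw [ha, hδ]; field_simp
    _ ≤ ((m : ℝ) + 1) ^ n := by gcongr; exact (Nat.lt_floor_add_one _).le
    _ = (G.card : ℝ) := by rw [hGcard]; push_cast; rfl
    _ = ∑ y ∈ T, (({z ∈ G | f z = y} : Finset (Fin n → ℤ)).card : ℝ) := by
        rw [Finset.card_eq_sum_card_fiberwise hf1]; push_cast; rfl
    _ ≤ ∑ _y ∈ T, (11 / 10 * (1 + 2 / κ)) ^ n := Finset.sum_le_sum hfib
    _ = _ := by simp

lemma covering_count_le {n k : ℕ} (hn : 0 < n) (hnk : n ≤ k) (hk : 2 ≤ k) :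
    (11 / 10 * (1 + 1 / 10 * (2 : ℝ) ^ ((k : ℝ) / n))) ^ n ≤ 2 ^ (k - 1) := by
  set t : ℝ := (2 : ℝ) ^ ((k : ℝ) / n) with ht
  have hn' : (0 : ℝ) < n := by positivity
  have htn : t ^ n = 2 ^ k := by
    rw [ht, ← Real.rpow_natCast, ← Real.rpow_mul (by norm_num), div_mul_cancel₀ _ hn'.ne',
      Real.rpow_natCast]
  have hpow : (2 : ℝ) ^ k = 2 * 2 ^ (k - 1) := by
    rw [← pow_succ', Nat.sub_add_cancel (by omega)]
  have ht0 : 0 < t := by positivity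
  rcases Nat.lt_or_ge 1 n with h | h
  · have ht2 : 2 ≤ t := by
      rw [ht]
      calc (2 : ℝ) = 2 ^ (1 : ℝ) := by simp
        _ ≤ _ := Real.rpow_le_rpow_of_exponent_le (by norm_num)
          ((one_le_div hn').2 (by exact_mod_cast hnk))
    calc _ ≤ (7 / 10 * t) ^ n := pow_le_pow_left₀ (by positivity) (by linarith) n
      _ = (7 / 10) ^ n * t ^ n := mul_pow _ _ _
      _ ≤ (7 / 10) ^ 2 * t ^ n := by
          gcongr ?_ * _
          exact pow_le_pow_of_le_one (by norm_num) (by norm_num) h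
      _ ≤ _ := by
          rw [htn, hpow]
          have : (0 : ℝ) < 2 ^ (k - 1) := by positivity
          linarith
  · obtain rfl : n = 1 := by omega
    rw [pow_one] at htn ⊢
    have h4 : (2 : ℝ) ^ 2 ≤ 2 ^ k := pow_le_pow_right₀ (by norm_num) hk
    rw [← htn] at h4
    linarith

end Entropy

/-- For `k ≥ n`, the entropy numbers of the identity between `n`-dimensional symmetric
quasi-Banach spaces with normalized symmetric bases satisfy
`e_k(id : X → Y) ≍ 2^{-k/n} φ_Y(n)/φ_X(n)`, with constants depending only on the
quasi-norm constants. -/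
theorem entropy_symmetric_large_k
    (C₀ : ℝ) (hC₀ : 1 ≤ C₀) :
    ∃ c C : ℝ, 0 < c ∧ 0 < C ∧
      ∀ (n : ℕ), 0 < n → ∀ NX NY : (Fin n → ℝ) → ℝ,
        IsQuasiNormWith n C₀ NX → IsSymmetricNorm n NX →
        IsQuasiNormWith n C₀ NY → IsSymmetricNorm n NY →
        (∀ i : Fin n, NX (Pi.single i 1) = 1) → (∀ i : Fin n, NY (Pi.single i 1) = 1) →
        ∀ k : ℕ, n ≤ k →
          c * ((2 : ℝ) ^ (-(k : ℝ) / (n : ℝ)) * (NY (fun _ => 1) / NX (fun _ => 1))) ≤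
              entropyNumber n NX NY k ∧
            entropyNumber n NX NY k ≤
              C * ((2 : ℝ) ^ (-(k : ℝ) / (n : ℝ)) * (NY (fun _ => 1) / NX (fun _ => 1))) := by
  obtain ⟨κ, hκ, hprod⟩ := exists_prod_le C₀ hC₀
  obtain ⟨L, hL0, hL⟩ := exists_monotone_const C₀ hC₀
  refine ⟨1 / (2 * C₀ * L * (11 / 10 * (1 + 2 / κ))), L * (20 / κ) + 2, by positivity,
    by positivity, ?_⟩
  intro n hn NX NY hX hXs hY hYs _ _ k hk
  have hφX := hX.ones_pos hn
  have hφY := hY.ones_pos hn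
  have hn' : (0 : ℝ) < n := by positivity
  set t : ℝ := (2 : ℝ) ^ ((k : ℝ) / n) with ht
  have ht0 : 0 < t := by positivity
  have htn : t ^ n = 2 ^ k := by
    rw [ht, ← Real.rpow_natCast, ← Real.rpow_mul (by norm_num), div_mul_cancel₀ _ hn'.ne',
      Real.rpow_natCast]
  have htinv : (2 : ℝ) ^ (-(k : ℝ) / (n : ℝ)) = t⁻¹ := by
    rw [neg_div, Real.rpow_neg (by norm_num)]
  rw [htinv]
  have hmem : ∃ ε ≤ (L * (20 / κ) + 2) * (t⁻¹ * (NY (fun _ => 1) / NX (fun _ => 1))),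
      0 < ε ∧ ∃ T : Finset (Fin n → ℝ), T.card ≤ 2 ^ (k - 1) ∧
        ∀ x : Fin n → ℝ, NX x ≤ 1 → ∃ y ∈ T, NY (x - y) ≤ ε := by
    rcases Nat.lt_or_ge 1 k with hk2 | hk1
    · obtain ⟨T, hT, hcov⟩ := exists_cover hn hκ hX hY (hprod n hn NX hX hXs) (hL n NY hY hYs)
        (s := 20 / κ * t⁻¹) (by positivity)
      refine ⟨_, ?_, by positivity, T, ?_, hcov⟩
      · have : 0 < t⁻¹ * (NY (fun _ => 1) / NX (fun _ => 1)) := by positivity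
        linarith
      · have e : 2 / (κ * (20 / κ * t⁻¹)) = 1 / 10 * t := by field_simp; norm_num
        rw [e] at hT
        exact_mod_cast hT.trans (covering_count_le hn hk hk2)
    · obtain rfl : n = 1 := by omega
      obtain rfl : k = 1 := by omega
      refine ⟨NY (fun _ => 1) / NX (fun _ => 1), ?_, by positivity, {0}, by simp,
        fun x hx => ⟨0, by simp, ?_⟩⟩
      · have e : t = 2 := by simpa using htn
        rw [e]
        have h1 : 0 < NY (fun _ => 1) / NX (fun _ => 1) := by positivity
        have h2 : 0 < L * (20 / κ) * (NY (fun _ => 1) / NX (fun _ => 1)) := by positivity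
        linarith
      · have e : x = x 0 • fun _ => 1 := by
          ext i; simp [Subsingleton.elim i 0]
        rw [e, hX.2.2.1] at hx
        rw [sub_zero, e, hY.2.2.1, le_div_iff₀ hφX]
        nlinarith
  obtain ⟨ε, hε, hεmem⟩ := hmem
  constructor
  · refine le_csInf ⟨ε, hεmem⟩ ?_
    rintro ε' ⟨hε', T, hT, hcov⟩
    have h1 := le_of_cover hn hC₀ hκ hL0 hX hY (hprod n hn NY hY hYs) (hL n NX hX hXs) hε' hcov
    have hT' : (T.card : ℝ) ≤ t ^ n := by
      rw [htn]
      calc (T.card : ℝ) ≤ 2 ^ (k - 1) := by exact_mod_cast hT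
        _ ≤ 2 ^ k := pow_le_pow_right₀ (by norm_num) (Nat.sub_le _ _)
    have h2 : (NY (fun _ => 1) / (L * NX (fun _ => 1) * (2 * C₀ * ε'))) ^ n ≤
        (t * (11 / 10 * (1 + 2 / κ))) ^ n := by
      rw [mul_pow]
      exact h1.trans (by gcongr)
    have h3 := le_of_pow_le_pow_left₀ hn.ne' (by positivity) h2
    have hq : 0 < 11 / 10 * (1 + 2 / κ) := by positivity
    rw [div_le_iff₀ (by positivity)] at h3
    generalize 11 / 10 * (1 + 2 / κ) = q at h3 hq ⊢
    have e : 1 / (2 * C₀ * L * q) * (t⁻¹ * (NY (fun _ => 1) / NX (fun _ => 1))) =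
        NY (fun _ => 1) / (t * q * (L * NX (fun _ => 1) * (2 * C₀))) := by
      field_simp
    rw [e, div_le_iff₀ (by positivity)]
    linarith
  · exact (csInf_le ⟨(0 : ℝ), fun (r : ℝ) hr => hr.1.le⟩ hεmem).trans hε
end

section
/- For every constant C₀ ≥ 1 there exist constants c, C > 0 depending only on C₀ such that the following holds: for every n ∈ ℕ and every 1-symmetric quasi-norm ‖·‖_X on ℝ^n with quasi-norm constant at most C₀ and with ‖e_i‖_X = 1 for the standard basis vectors, the Lebesgue volume of the unit ball B_X = {x ∈ ℝ^n : ‖x‖_X ≤ 1} satisfies c · φ_X(n)^{−1} ≤ vol(B_X)^{1/n} ≤ C · φ_X(n)^{−1}, where φ_X(n) = ‖(1, …, 1)‖_X. -/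
open MeasureTheory

lemma IsQuasiNormWith.exists_near_mul_le {n : ℕ} {C : ℝ} (hC : 1 ≤ C) {N : (Fin n → ℝ) → ℝ}
    (hN : IsQuasiNormWith n C N) (hU : IsUnconditional n N) (x : Fin n → ℝ) (b : ℕ) :
    ∀ u : Fin n → ℝ, (∀ i, |u i| ≤ b + 1) →
      ∃ w : Fin n → ℝ, (∀ i, |u i - w i| ≤ 1) ∧ N (w * x) ≤ b * C ^ b * N x := by
  obtain ⟨hpos, hzero, -, htri⟩ := hN
  induction b with
  | zero =>
    intro u hu
    refine ⟨0, fun i => by simpa using hu i, ?_⟩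
    simp [(hzero 0).2 rfl]
  | succ b ih =>
    intro u hu
    set ε : Fin n → ℝ := fun i => if 0 ≤ u i then 1 else -1 with hε
    have hε_one : ∀ i, ε i = 1 ∨ ε i = -1 := fun i => by
      by_cases h : 0 ≤ u i <;> simp [hε, h]
    obtain ⟨w, hw, hNw⟩ := ih (u - ε) fun i => by
      have h1 := abs_le.1 (hu i)
      push_cast at h1
      have hb : (0 : ℝ) ≤ b := b.cast_nonneg
      rw [abs_le, Pi.sub_apply]
      by_cases h : 0 ≤ u i
      · simp only [hε, if_pos h]; constructor <;> linarith
      · simp only [hε, if_neg h]; constructor <;> linarith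
    refine ⟨ε + w, fun i => by simpa [sub_sub] using hw i, ?_⟩
    have hεx : N (ε * x) = N x := hU x ε hε_one
    have hp : (1 : ℝ) ≤ C ^ b := one_le_pow₀ hC
    calc N ((ε + w) * x) = N (ε * x + w * x) := by rw [add_mul]
      _ ≤ C * (N (ε * x) + N (w * x)) := htri _ _
      _ ≤ C * (C ^ b * N x + b * C ^ b * N x) := by
        rw [hεx]
        have := hpos x
        gcongr
        nlinarith
      _ = ((b + 1 : ℕ) : ℝ) * C ^ (b + 1) * N x := by push_cast; ring

lemma IsQuasiNormWith.sum_le {n : ℕ} {C : ℝ} (hC : 1 ≤ C) {N : (Fin n → ℝ) → ℝ}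
    (hN : IsQuasiNormWith n C N) {ι : Type*} (s : Finset ι) (f : ι → Fin n → ℝ) :
    N (∑ i ∈ s, f i) ≤ C ^ s.card * ∑ i ∈ s, N (f i) := by
  classical
  obtain ⟨hpos, hzero, -, htri⟩ := hN
  induction s using Finset.induction_on with
  | empty => simp [(hzero 0).2 rfl]
  | insert a s ha ih =>
    rw [Finset.sum_insert ha, Finset.sum_insert ha, Finset.card_insert_of_notMem ha]
    have hp : (1 : ℝ) ≤ C ^ s.card := one_le_pow₀ hC
    calc N (f a + ∑ i ∈ s, f i) ≤ C * (N (f a) + N (∑ i ∈ s, f i)) := htri _ _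
      _ ≤ C * (C ^ s.card * N (f a) + C ^ s.card * ∑ i ∈ s, N (f i)) := by
        have := hpos (f a)
        gcongr
        nlinarith
      _ = C ^ (s.card + 1) * (N (f a) + ∑ i ∈ s, N (f i)) := by ring

lemma IsQuasiNormWith.bddAbove_mul {n : ℕ} {C : ℝ} (hC : 1 ≤ C) {N : (Fin n → ℝ) → ℝ}
    (hN : IsQuasiNormWith n C N) (x : Fin n → ℝ) :
    BddAbove ((fun t => N (t * x)) '' {t : Fin n → ℝ | ∀ i, |t i| ≤ 1}) := by
  refine ⟨C ^ (Finset.univ : Finset (Fin n)).card * ∑ i, N (Pi.single i (x i)), ?_⟩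
  rintro _ ⟨t, ht, rfl⟩
  have h := hN.sum_le hC Finset.univ (fun i => Pi.single i ((t * x) i))
  rw [Finset.univ_sum_single] at h
  refine h.trans ?_
  gcongr with i
  have : (Pi.single i ((t * x) i) : Fin n → ℝ) = t i • Pi.single i (x i) := by
    rw [← Pi.single_smul]; rfl
  rw [this, hN.2.2.1]
  exact mul_le_of_le_one_left (hN.1 _) (ht i)

/-- The lattice constant of an unconditional quasi-norm with quasi-norm constant `C`. -/
noncomputable def latticeConst (C : ℝ) : ℝ := ⌈2 * C⌉₊ * C ^ ⌈2 * C⌉₊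

lemma one_le_latticeConst {C : ℝ} (hC : 1 ≤ C) : 1 ≤ latticeConst C := by
  have h : 2 * C ≤ ⌈2 * C⌉₊ := Nat.le_ceil _
  exact one_le_mul_of_one_le_of_one_le (by linarith) (one_le_pow₀ hC)

lemma IsQuasiNormWith.mul_le {n : ℕ} {C : ℝ} (hC : 1 ≤ C) {N : (Fin n → ℝ) → ℝ}
    (hN : IsQuasiNormWith n C N) (hU : IsUnconditional n N) (x t : Fin n → ℝ)
    (ht : ∀ i, |t i| ≤ 1) : N (t * x) ≤ latticeConst C * N x := by
  set b := ⌈2 * C⌉₊ with hb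
  have hbC : 2 * C ≤ b := Nat.le_ceil _
  have hb0 : (0 : ℝ) < b := by linarith
  set T := (fun t => N (t * x)) '' {t : Fin n → ℝ | ∀ i, |t i| ≤ 1} with hT
  have hbdd : BddAbove T := hN.bddAbove_mul hC x
  have key : ∀ v ∈ T, v ≤ (latticeConst C * N x + sSup T) / 2 := by
    rintro _ ⟨t, ht, rfl⟩
    obtain ⟨w, hw, hNw⟩ := hN.exists_near_mul_le hC hU x b ((b : ℝ) • t) fun i => by
      rw [Pi.smul_apply, smul_eq_mul, abs_mul, abs_of_pos hb0]
      nlinarith [ht i]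
    set r := (b : ℝ) • t - w with hr
    have hrS : N (r * x) ≤ sSup T := le_csSup hbdd ⟨r, fun i => hw i, rfl⟩
    have hsum : (b : ℝ) • (t * x) = w * x + r * x := by
      rw [hr, ← add_mul, add_sub_cancel, smul_mul_assoc]
    have h1 : b * N (t * x) ≤ C * (N (w * x) + N (r * x)) := by
      rw [← abs_of_pos hb0, ← hN.2.2.1, hsum]
      exact hN.2.2.2 _ _
    have h2 : C * (N (w * x) + N (r * x)) ≤ b / 2 * (N (w * x) + N (r * x)) := by
      have := hN.1 (w * x)
      have := hN.1 (r * x)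
      gcongr
      linarith
    have h3 : b * N (t * x) ≤ b * ((N (w * x) + N (r * x)) / 2) := by linarith
    have h4 := le_of_mul_le_mul_left h3 hb0
    have h5 : N (w * x) ≤ latticeConst C * N x := hNw
    change N (t * x) ≤ _
    linarith
  have hmem : N (t * x) ∈ T := ⟨t, ht, rfl⟩
  have hS : sSup T ≤ (latticeConst C * N x + sSup T) / 2 := csSup_le ⟨_, hmem⟩ key
  have := le_csSup hbdd hmem
  linarith

lemma IsQuasiNormWith.le_of_abs_le {n : ℕ} {C : ℝ} (hC : 1 ≤ C) {N : (Fin n → ℝ) → ℝ}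
    (hN : IsQuasiNormWith n C N) (hU : IsUnconditional n N) {x y : Fin n → ℝ}
    (h : ∀ i, |x i| ≤ |y i|) : N x ≤ latticeConst C * N y := by
  have hx : x = (x / y) * y := by
    ext i
    by_cases hy : y i = 0
    · have := h i
      simp_all
    · simp [hy]
  rw [hx]
  refine hN.mul_le hC hU y _ fun i => ?_
  rw [Pi.div_apply, abs_div]
  exact div_le_one_of_le₀ (h i) (abs_nonneg _)

lemma IsSymmetricNorm.isUnconditional {n : ℕ} {N : (Fin n → ℝ) → ℝ}
    (hS : IsSymmetricNorm n N) : IsUnconditional n N :=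
  fun x ε hε => hS x ε 1 hε

lemma IsSymmetricNorm.indicator_eq {n : ℕ} {N : (Fin n → ℝ) → ℝ} (hS : IsSymmetricNorm n N)
    {A B : Finset (Fin n)} (h : A.card = B.card) :
    N (Set.indicator A 1) = N (Set.indicator B 1) := by
  classical
  let e : {i // i ∈ A} ≃ {i // i ∈ B} := Finset.equivOfCardEq h
  rw [← hS (Set.indicator B 1) 1 e.extendSubtype fun _ => Or.inl rfl]
  congr 1
  ext i
  by_cases hi : i ∈ A
  · simp [hi, e.extendSubtype_mem i hi]
  · simp [hi, e.extendSubtype_not_mem i hi]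

lemma IsQuasiNormWith.indicator_le_of_card_le {n : ℕ} {C : ℝ} (hC : 1 ≤ C)
    {N : (Fin n → ℝ) → ℝ} (hN : IsQuasiNormWith n C N) (hS : IsSymmetricNorm n N)
    (A : Finset (Fin n)) (j : ℕ) :
    ∀ S : Finset (Fin n), S.card ≤ 2 ^ j * A.card →
      N (Set.indicator S 1) ≤ (2 * C) ^ j * (latticeConst C * N (Set.indicator A 1)) := by
  induction j with
  | zero =>
    intro S hSA
    obtain ⟨B, hSB, hB⟩ := Finset.exists_superset_card_eq (by simpa using hSA)
      (Finset.card_le_univ A)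
    rw [← hS.indicator_eq hB, pow_zero, one_mul]
    refine hN.le_of_abs_le hC hS.isUnconditional fun i => ?_
    by_cases hi : i ∈ S
    · simp [hi, hSB hi]
    · simp [hi]
  | succ j ih =>
    intro S hSA
    obtain ⟨T, hTS, hT⟩ := Finset.exists_subset_card_eq
      (min_le_left S.card (2 ^ j * A.card))
    have h1 := ih T (by omega)
    have h2 := ih (S \ T) (by
      rw [Finset.card_sdiff_of_subset hTS]
      rw [pow_succ, mul_right_comm] at hSA
      omega)
    have hsplit : (Set.indicator S 1 : Fin n → ℝ)
        = Set.indicator T 1 + Set.indicator (↑(S \ T)) 1 := by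
      ext i
      by_cases hi : i ∈ T
      · simp [hi, hTS hi]
      · by_cases hi' : i ∈ S <;> simp [hi, hi']
    rw [hsplit]
    refine (hN.2.2.2 _ _).trans ?_
    rw [pow_succ]
    nlinarith

lemma IsQuasiNormWith.one_le_indicator {n : ℕ} {C : ℝ} (hC : 1 ≤ C)
    {N : (Fin n → ℝ) → ℝ} (hN : IsQuasiNormWith n C N) (hS : IsSymmetricNorm n N)
    {A : Finset (Fin n)} (hA : A.Nonempty) {q : ℕ} (hq : 2 * C ≤ 2 ^ q) :
    N 1 ≤ (2 * n / A.card) ^ q * (latticeConst C * N (Set.indicator A 1)) := by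
  have hk : 0 < A.card := hA.card_pos
  have hkn : A.card ≤ n := by simpa using Finset.card_le_univ A
  have hd : n / A.card ≠ 0 := (Nat.div_pos hkn hk).ne'
  set m := Nat.log 2 (n / A.card) with hm
  have hlt : n < 2 ^ (m + 1) * A.card := by
    rw [← Nat.div_lt_iff_lt_mul hk]
    exact Nat.lt_pow_succ_log_self one_lt_two _
  have hle : 2 ^ m * A.card ≤ n := by
    rw [← Nat.le_div_iff_mul_le hk]
    exact Nat.pow_log_le_self 2 hd
  have h := hN.indicator_le_of_card_le hC hS A (m + 1) Finset.univ (by simpa using hlt.le)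
  rw [Finset.coe_univ, Set.indicator_univ] at h
  refine h.trans ?_
  have hL : 0 ≤ latticeConst C := zero_le_one.trans (one_le_latticeConst hC)
  have := hN.1 (Set.indicator A 1)
  gcongr
  calc (2 * C) ^ (m + 1) ≤ (2 ^ q) ^ (m + 1) := by gcongr
    _ = (2 ^ (m + 1)) ^ q := by rw [← pow_mul, ← pow_mul, mul_comm]
    _ ≤ (2 * n / A.card) ^ q := by
      gcongr
      rw [le_div_iff₀ (by exact_mod_cast hk), pow_succ]
      have : (2 : ℝ) ^ m * A.card ≤ n := by exact_mod_cast hle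
      linarith

lemma Finset.factorial_card_le_prod_card_filter_le {ι : Type*} (f : ι → ℝ) (s : Finset ι) :
    s.card.factorial ≤ ∏ i ∈ s, (s.filter fun j => f i ≤ f j).card := by
  classical
  induction s using Finset.induction_on_min_value f with
  | empty => simp
  | insert a s ha hmin ih =>
    rw [Finset.prod_insert ha, Finset.card_insert_of_notMem ha, Nat.factorial_succ]
    refine Nat.mul_le_mul ?_ (ih.trans (Finset.prod_le_prod' fun i _ => ?_))
    · rw [Finset.filter_true_of_mem, Finset.card_insert_of_notMem ha]
      simpa using hmin
    · exact Finset.card_le_card (Finset.filter_subset_filter _ (Finset.subset_insert _ _))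

lemma volume_prod_one_add_sq_le (n : ℕ) {R : ℝ} (hR : 0 < R) :
    volume {x : Fin n → ℝ | ∏ i, (1 + x i ^ 2) ≤ R} ≤ ENNReal.ofReal (R * Real.pi ^ n) := by
  have hint : Integrable fun x : Fin n → ℝ => ∏ i, (1 + x i ^ 2)⁻¹ :=
    Integrable.fintype_prod (f := fun _ y => (1 + y ^ 2)⁻¹) fun _ => integrable_inv_one_add_sq
  have hI : ∫ x : Fin n → ℝ, ∏ i, (1 + x i ^ 2)⁻¹ = Real.pi ^ n := by
    rw [integral_fintype_prod_volume_eq_pow fun y : ℝ => (1 + y ^ 2)⁻¹,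
      integral_univ_inv_one_add_sq, Fintype.card_fin]
  rw [ENNReal.ofReal_mul hR.le, ← hI, ofReal_integral_eq_lintegral_ofReal hint
    (ae_of_all _ fun x => Finset.prod_nonneg fun i _ => by positivity),
    mul_comm, ← ENNReal.div_le_iff_le_mul (Or.inl (by simpa using hR))
      (Or.inl ENNReal.ofReal_ne_top), ENNReal.div_eq_inv_mul, ← ENNReal.ofReal_inv_of_pos hR]
  refine le_trans ?_ (mul_meas_ge_le_lintegral₀ hint.aestronglyMeasurable.aemeasurable.ennreal_ofReal
    (ENNReal.ofReal R⁻¹))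
  gcongr with x
  intro hx
  refine ENNReal.ofReal_le_ofReal ?_
  have hpos : 0 < ∏ i, (1 + x i ^ 2) := Finset.prod_pos fun i _ => by positivity
  rw [Finset.prod_inv_distrib]
  exact inv_anti₀ hpos hx

lemma Finset.prod_two_mul_div_card_filter_le {n : ℕ} (f : Fin n → ℝ) :
    ∏ i, (2 * n / (Finset.univ.filter fun j => f i ≤ f j).card : ℝ) ≤
      (2 * Real.exp 1) ^ n := by
  have hfac : (n.factorial : ℝ) ≤
      ∏ i, ((Finset.univ.filter fun j => f i ≤ f j).card : ℝ) := by
    have := Finset.factorial_card_le_prod_card_filter_le f Finset.univ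
    rw [Finset.card_fin] at this
    exact_mod_cast this
  have hexp := Real.pow_div_factorial_le_exp (n : ℝ) n.cast_nonneg n
  rw [Finset.prod_div_distrib, Finset.prod_const, Finset.card_fin]
  calc (2 * n : ℝ) ^ n / ∏ i, ((Finset.univ.filter fun j => f i ≤ f j).card : ℝ)
      ≤ (2 * n : ℝ) ^ n / n.factorial := by
        have := n.factorial_pos
        gcongr
    _ = 2 ^ n * (n ^ n / n.factorial) := by rw [mul_pow, mul_div_assoc]
    _ ≤ 2 ^ n * Real.exp n := by gcongr
    _ = (2 * Real.exp 1) ^ n := by rw [mul_pow, ← Real.exp_nat_mul, mul_one]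

lemma IsQuasiNormWith.prod_one_add_sq_le {n : ℕ} {C : ℝ} (hC : 1 ≤ C)
    {N : (Fin n → ℝ) → ℝ} (hN : IsQuasiNormWith n C N) (hS : IsSymmetricNorm n N)
    {q : ℕ} (hq : 2 * C ≤ 2 ^ q) {x : Fin n → ℝ} (hx : N x ≤ 1) :
    ∏ i, (1 + (N 1 * x i) ^ 2) ≤
      ((1 + latticeConst C ^ 4) * (2 * Real.exp 1) ^ (2 * q)) ^ n := by
  set M := latticeConst C
  have hM : 1 ≤ M := one_le_latticeConst hC
  set k : Fin n → ℕ := fun i => (Finset.univ.filter fun j => |x i| ≤ |x j|).card with hk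
  have hbound : ∀ i, 1 + (N 1 * x i) ^ 2 ≤ (1 + M ^ 4) * (2 * n / k i : ℝ) ^ (2 * q) := by
    intro i
    set A := Finset.univ.filter fun j => |x i| ≤ |x j| with hA
    have hAne : A.Nonempty := ⟨i, by simp [hA]⟩
    have hki : (0 : ℝ) < k i := by exact_mod_cast hAne.card_pos
    have hkn : (k i : ℝ) ≤ n := by
      have : k i ≤ n := by simpa using Finset.card_le_univ A
      exact_mod_cast this
    have hr : (1 : ℝ) ≤ 2 * n / k i := by
      rw [le_div_iff₀ hki]
      linarith
    have h1 : |x i| * N (Set.indicator A 1) ≤ M := by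
      rw [← abs_abs, ← hN.2.2.1]
      refine (hN.le_of_abs_le hC hS.isUnconditional (y := x) fun j => ?_).trans
        (mul_le_of_le_one_right (by linarith) hx)
      by_cases hj : j ∈ A
      · simpa [hj] using (Finset.mem_filter.1 hj).2
      · simp [hj]
    have h2 := hN.one_le_indicator hC hS hAne hq
    have h3 : |N 1 * x i| ≤ M ^ 2 * (2 * n / k i : ℝ) ^ q := by
      rw [abs_mul, abs_of_nonneg (hN.1 1)]
      calc N 1 * |x i|
          ≤ (2 * n / k i) ^ q * (M * N (Set.indicator A 1)) * |x i| := by gcongr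
        _ = (2 * n / k i) ^ q * M * (|x i| * N (Set.indicator A 1)) := by ring
        _ ≤ (2 * n / k i) ^ q * M * M := by gcongr
        _ = M ^ 2 * (2 * n / k i : ℝ) ^ q := by ring
    have h4 : (N 1 * x i) ^ 2 ≤ M ^ 4 * (2 * n / k i : ℝ) ^ (2 * q) := by
      rw [← sq_abs]
      calc |N 1 * x i| ^ 2 ≤ (M ^ 2 * (2 * n / k i : ℝ) ^ q) ^ 2 := by gcongr
        _ = M ^ 4 * (2 * n / k i : ℝ) ^ (2 * q) := by ring
    have h5 : (1 : ℝ) ≤ (2 * n / k i : ℝ) ^ (2 * q) := one_le_pow₀ hr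
    linarith
  calc ∏ i, (1 + (N 1 * x i) ^ 2)
      ≤ ∏ i, ((1 + M ^ 4) * (2 * n / k i : ℝ) ^ (2 * q)) :=
        Finset.prod_le_prod (fun i _ => by positivity) fun i _ => hbound i
    _ = (1 + M ^ 4) ^ n * (∏ i, (2 * n / k i : ℝ)) ^ (2 * q) := by
        rw [Finset.prod_mul_distrib, Finset.prod_const, Finset.card_fin, Finset.prod_pow]
    _ ≤ (1 + M ^ 4) ^ n * ((2 * Real.exp 1) ^ n) ^ (2 * q) := by
        refine mul_le_mul_of_nonneg_left (pow_le_pow_left₀ ?_ ?_ _) (by positivity)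
        · exact Finset.prod_nonneg fun i _ => by positivity
        · exact Finset.prod_two_mul_div_card_filter_le fun i => |x i|
    _ = ((1 + M ^ 4) * (2 * Real.exp 1) ^ (2 * q)) ^ n := by
        rw [mul_pow _ (_ ^ (2 * q)) n, pow_right_comm]

lemma IsQuasiNormWith.volume_le {n : ℕ} {C : ℝ} (hC : 1 ≤ C)
    {N : (Fin n → ℝ) → ℝ} (hN : IsQuasiNormWith n C N) (hS : IsSymmetricNorm n N)
    (h0 : 0 < N 1) {q : ℕ} (hq : 2 * C ≤ 2 ^ q) :
    volume {x : Fin n → ℝ | N x ≤ 1} ≤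
      ENNReal.ofReal (((1 + latticeConst C ^ 4) * (2 * Real.exp 1) ^ (2 * q) * Real.pi
        * (N 1)⁻¹) ^ n) := by
  set D := (1 + latticeConst C ^ 4) * (2 * Real.exp 1) ^ (2 * q)
  have hD : 0 < D := by positivity
  have hsub : {x : Fin n → ℝ | N x ≤ 1} ⊆
      (N 1 • ·) ⁻¹' {x : Fin n → ℝ | ∏ i, (1 + x i ^ 2) ≤ D ^ n} :=
    fun x hx => hN.prod_one_add_sq_le hC hS hq hx
  refine (measure_mono hsub).trans ?_
  rw [Measure.addHaar_preimage_smul _ h0.ne', Module.finrank_fin_fun,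
    abs_of_pos (by positivity)]
  calc ENNReal.ofReal ((N 1 ^ n)⁻¹) * volume {x : Fin n → ℝ | ∏ i, (1 + x i ^ 2) ≤ D ^ n}
      ≤ ENNReal.ofReal ((N 1 ^ n)⁻¹) * ENNReal.ofReal (D ^ n * Real.pi ^ n) := by
        gcongr
        exact volume_prod_one_add_sq_le n (by positivity)
    _ = ENNReal.ofReal ((D * Real.pi * (N 1)⁻¹) ^ n) := by
        rw [← ENNReal.ofReal_mul (by positivity)]
        congr 1
        rw [mul_pow _ (N 1)⁻¹, mul_pow D, inv_pow, mul_comm]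

lemma IsQuasiNormWith.le_volume {n : ℕ} {C : ℝ} (hC : 1 ≤ C)
    {N : (Fin n → ℝ) → ℝ} (hN : IsQuasiNormWith n C N) (hU : IsUnconditional n N)
    (h0 : 0 < N 1) :
    ENNReal.ofReal (((latticeConst C)⁻¹ * (N 1)⁻¹) ^ n) ≤
      volume {x : Fin n → ℝ | N x ≤ 1} := by
  have hM : 0 < latticeConst C := zero_lt_one.trans_le (one_le_latticeConst hC)
  set a := (latticeConst C)⁻¹ * (N 1)⁻¹ with ha
  have ha0 : 0 < a := by positivity
  have hsub : Set.Icc (0 : Fin n → ℝ) (fun _ => a) ⊆ {x : Fin n → ℝ | N x ≤ 1} := by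
    intro x hx
    have h := hN.le_of_abs_le hC hU (x := x) (y := a • 1) fun i => by
      simpa [abs_of_nonneg (hx.1 i), abs_of_pos ha0] using hx.2 i
    rw [hN.2.2.1, abs_of_pos ha0, ha] at h
    refine h.trans_eq ?_
    field_simp
  refine le_trans ?_ (measure_mono hsub)
  rw [Real.volume_Icc_pi]
  simp [ENNReal.ofReal_pow ha0.le]

/-- For every `C₀ ≥ 1` there are `c, C > 0` depending only on `C₀` such that for every
`1`-symmetric quasi-norm `‖·‖_X` on `ℝ^n` with quasi-norm constant at most `C₀` and
normalized basis vectors, `vol(B_X)^{1/n} ≍ φ_X(n)^{-1}` where `φ_X(n) = ‖(1,…,1)‖_X`. -/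
theorem volume_unitBall_symmetric
    (C₀ : ℝ) (hC₀ : 1 ≤ C₀) :
    ∃ c C : ℝ, 0 < c ∧ 0 < C ∧
      ∀ (n : ℕ), 0 < n → ∀ N : (Fin n → ℝ) → ℝ,
        IsQuasiNormWith n C₀ N → IsSymmetricNorm n N →
        (∀ i : Fin n, N (Pi.single i 1) = 1) →
        c * (N (fun _ => 1))⁻¹ ≤
            (volume {x : Fin n → ℝ | N x ≤ 1}).toReal ^ ((n : ℝ)⁻¹) ∧
          (volume {x : Fin n → ℝ | N x ≤ 1}).toReal ^ ((n : ℝ)⁻¹) ≤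
            C * (N (fun _ => 1))⁻¹ := by
  obtain ⟨q, hq⟩ := pow_unbounded_of_one_lt (2 * C₀) one_lt_two
  have hM : 0 < latticeConst C₀ := zero_lt_one.trans_le (one_le_latticeConst hC₀)
  refine ⟨(latticeConst C₀)⁻¹,
    (1 + latticeConst C₀ ^ 4) * (2 * Real.exp 1) ^ (2 * q) * Real.pi,
    by positivity, by positivity, fun n hn N hN hS _ => ?_⟩
  change _ * (N 1)⁻¹ ≤ _ ∧ _ ≤ _ * (N 1)⁻¹
  have h0 : 0 < N 1 := by
    refine (hN.1 1).lt_of_ne' fun h => ?_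
    have := congrFun ((hN.2.1 1).1 h) ⟨0, hn⟩
    simp at this
  have hlow := hN.le_volume hC₀ hS.isUnconditional h0
  have hup := hN.volume_le hC₀ hS h0 hq.le
  constructor
  · rw [Real.le_rpow_inv_iff_of_pos (by positivity) ENNReal.toReal_nonneg (by positivity),
      Real.rpow_natCast]
    exact (ENNReal.ofReal_le_iff_le_toReal (hup.trans_lt ENNReal.ofReal_lt_top).ne).1 hlow
  · rw [Real.rpow_inv_le_iff_of_pos ENNReal.toReal_nonneg (by positivity) (by positivity),
      Real.rpow_natCast]
    exact ENNReal.toReal_le_of_le_ofReal (by positivity) hup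
end

section
/- For all constants C₀ ≥ 1 and A ≥ 1 there exist constants c, C > 0 depending only on C₀ and A such that the following holds: for every n ∈ ℕ and all 1-symmetric quasi-norms ‖·‖_X, ‖·‖_Y on ℝ^n with quasi-norm constants at most C₀, with ‖e_i‖_X = ‖e_i‖_Y = 1 for the standard basis vectors, and satisfying ‖id: X → Y‖ ≤ A · rv(X,Y) where rv(X,Y) = (vol(B_X)/vol(B_Y))^{1/n}, one has for every k ∈ ℕ: c · 2^{−k/n} rv(X,Y) ≤ e_k(id: X → Y) ≤ C · 2^{−k/n} rv(X,Y). -/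
open MeasureTheory

/-- The operator norm of the identity map from `(ℝ^n, NX)` to `(ℝ^n, NY)`:
`‖id‖ = sup {NY x : NX x ≤ 1}`. -/
noncomputable def opNorm (n : ℕ) (NX NY : (Fin n → ℝ) → ℝ) : ℝ :=
  sSup {t : ℝ | ∃ x : Fin n → ℝ, NX x ≤ 1 ∧ t = NY x}

namespace IsQuasiNormWith

open scoped Pointwise

variable {n : ℕ} {C : ℝ} {N : (Fin n → ℝ) → ℝ}

lemma map_zero (h : IsQuasiNormWith n C N) : N 0 = 0 := (h.2.1 0).2 rfl

lemma map_neg (h : IsQuasiNormWith n C N) (x : Fin n → ℝ) : N (-x) = N x := by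
  simpa using h.2.2.1 (-1) x

lemma map_sub_rev (h : IsQuasiNormWith n C N) (x y : Fin n → ℝ) : N (x - y) = N (y - x) := by
  rw [← h.map_neg, neg_sub]

/-- A quasi-norm is dominated by a multiple of the sup norm. -/
lemma exists_le_mul_norm (h : IsQuasiNormWith n C N) (hC : 1 ≤ C) :
    ∃ K : ℝ, 0 < K ∧ ∀ x, N x ≤ K * ‖x‖ := by
  have key : ∀ s : Finset (Fin n), ∃ K : ℝ, 0 ≤ K ∧
      ∀ x : Fin n → ℝ, N (∑ i ∈ s, x i • Pi.single i (1 : ℝ)) ≤ K * ‖x‖ := by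
    intro s
    induction s using Finset.induction_on with
    | empty => exact ⟨0, le_rfl, fun x => by simp [h.map_zero]⟩
    | insert i s hi ih =>
      obtain ⟨K, hK, hb⟩ := ih
      have hi0 : 0 ≤ N (Pi.single i (1 : ℝ)) := h.1 _
      refine ⟨C * (N (Pi.single i (1 : ℝ)) + K), by positivity, fun x => ?_⟩
      rw [Finset.sum_insert hi]
      refine (h.2.2.2 _ _).trans ?_
      rw [h.2.2.1, mul_assoc, add_mul]
      have h1 : |x i| ≤ ‖x‖ := norm_le_pi_norm x i
      have h2 := mul_le_mul_of_nonneg_right h1 hi0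
      have h3 := hb x
      exact mul_le_mul_of_nonneg_left (by linarith) (by linarith)
  obtain ⟨K, hK, hb⟩ := key Finset.univ
  refine ⟨K + 1, by linarith, fun x => ?_⟩
  have hx : x = ∑ i, x i • Pi.single i (1 : ℝ) := pi_eq_sum_univ' x
  have h1 := hb x
  rw [← hx] at h1
  nlinarith [norm_nonneg x]

/-- The sup norm is dominated by `C` times a normalized symmetric quasi-norm. -/
lemma norm_le_mul (h : IsQuasiNormWith n C N) (hC : 1 ≤ C) (hs : IsSymmetricNorm n N)
    (he : ∀ i : Fin n, N (Pi.single i 1) = 1) (x : Fin n → ℝ) : ‖x‖ ≤ C * N x := by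
  refine (pi_norm_le_iff_of_nonneg (mul_nonneg (by linarith) (h.1 x))).2 fun i => ?_
  have hflip := hs x (fun j => if j = i then 1 else -1) (Equiv.refl _)
    (fun j => by by_cases hj : j = i <;> simp [hj])
  have hsum : x + (fun j => (if j = i then 1 else -1) * x ((Equiv.refl _) j)) =
      (2 * x i) • Pi.single i (1 : ℝ) := by
    ext j
    by_cases hj : j = i
    · subst hj; simp; ring
    · simp [hj]
  have h1 := h.2.2.2 x (fun j => (if j = i then 1 else -1) * x ((Equiv.refl _) j))
  rw [hsum, h.2.2.1, he, hflip, abs_mul, abs_two] at h1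
  rw [Real.norm_eq_abs]
  linarith

lemma volume_ball_lt_top (h : IsQuasiNormWith n C N) (hC : 1 ≤ C) (hs : IsSymmetricNorm n N)
    (he : ∀ i : Fin n, N (Pi.single i 1) = 1) : volume {x | N x ≤ 1} < ⊤ := by
  refine (measure_mono (t := Metric.closedBall 0 C) fun x hx => ?_).trans_lt
    measure_closedBall_lt_top
  have h1 := h.norm_le_mul hC hs he x
  have h2 : N x ≤ 1 := hx
  rw [mem_closedBall_zero_iff]
  nlinarith

lemma volume_ball_pos (h : IsQuasiNormWith n C N) (hC : 1 ≤ C) : 0 < volume {x | N x ≤ 1} := by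
  obtain ⟨K, hK, hb⟩ := h.exists_le_mul_norm hC
  refine (Metric.measure_closedBall_pos volume (0 : Fin n → ℝ) (inv_pos.2 hK)).trans_le
    (measure_mono fun x hx => ?_)
  rw [mem_closedBall_zero_iff] at hx
  refine (hb x).trans ?_
  calc K * ‖x‖ ≤ K * K⁻¹ := by gcongr
    _ = 1 := mul_inv_cancel₀ hK.ne'

lemma volume_ball_scaled (h : IsQuasiNormWith n C N) (a : Fin n → ℝ) {r : ℝ} (hr : 0 < r) :
    volume {x | N (x - a) ≤ r} = ENNReal.ofReal (r ^ n) * volume {x | N x ≤ 1} := by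
  have h1 : {x | N (x - a) ≤ r} = (fun x => x + -a) ⁻¹' (r • {x | N x ≤ 1}) := by
    ext x
    rw [Set.mem_preimage, Set.mem_smul_set_iff_inv_smul_mem₀ hr.ne', Set.mem_ofPred_eq,
      Set.mem_ofPred_eq, h.2.2.1, abs_of_pos (inv_pos.2 hr), ← sub_eq_add_neg,
      inv_mul_le_one₀ hr]
  rw [h1, measure_preimage_add_right, Measure.addHaar_smul_of_nonneg _ hr.le]
  simp

/-- The ball of radius `r` lies in the interior of the ball of radius `2 * C * r`. -/
lemma ball_subset_interior (h : IsQuasiNormWith n C N) (hC : 1 ≤ C) (a : Fin n → ℝ) {r : ℝ}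
    (hr : 0 < r) : {x | N (x - a) ≤ r} ⊆ interior {x | N (x - a) ≤ 2 * C * r} := by
  obtain ⟨K, hK, hb⟩ := h.exists_le_mul_norm hC
  intro x hx
  rw [mem_interior_iff_mem_nhds]
  refine Filter.mem_of_superset (Metric.closedBall_mem_nhds x (div_pos hr hK)) fun z hz => ?_
  rw [mem_closedBall_iff_norm] at hz
  have h1 : N (z - x) ≤ r := by
    refine (hb _).trans ?_
    calc K * ‖z - x‖ ≤ K * (r / K) := by gcongr
      _ = r := mul_div_cancel₀ r hK.ne'
  have h2 := h.2.2.2 (z - x) (x - a)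
  rw [sub_add_sub_cancel] at h2
  have h3 : N (x - a) ≤ r := hx
  have h4 : C * (N (z - x) + N (x - a)) ≤ C * (r + r) :=
    mul_le_mul_of_nonneg_left (by linarith) (by linarith)
  change N (z - a) ≤ 2 * C * r
  linarith

/-- Volumetric bound for the cardinality of an `ε`-separated subset of a ball of radius `R`. -/
lemma card_separated_le (h : IsQuasiNormWith n C N) (hC : 1 ≤ C)
    (hfin : volume {x | N x ≤ 1} < ⊤) {R ε : ℝ} (hε : 0 < ε) (hεR : ε ≤ R)
    (T : Finset (Fin n → ℝ)) (hT : ∀ y ∈ T, N y ≤ R)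
    (hsep : ∀ y ∈ T, ∀ z ∈ T, y ≠ z → ε < N (y - z)) :
    (T.card : ℝ) ≤ (8 * C ^ 3 * R / ε) ^ n := by
  have hC0 : 0 < C := by linarith
  have hR : 0 < R := hε.trans_le hεR
  set δ : ℝ := ε / (4 * C ^ 2) with hδ
  have hδ0 : 0 < δ := by positivity
  have hδε : 4 * C ^ 2 * δ = ε := by rw [hδ]; field_simp
  set V : (Fin n → ℝ) → Set (Fin n → ℝ) := fun y => interior {x | N (x - y) ≤ 2 * C * δ}
  have hdisj : (T : Set (Fin n → ℝ)).PairwiseDisjoint V := by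
    intro y hy z hz hyz
    refine Set.disjoint_left.2 fun x hxy hxz => ?_
    have h1 : N (x - y) ≤ 2 * C * δ :=
      interior_subset (s := {x | N (x - y) ≤ 2 * C * δ}) hxy
    have h2 : N (x - z) ≤ 2 * C * δ :=
      interior_subset (s := {x | N (x - z) ≤ 2 * C * δ}) hxz
    have h3 := h.2.2.2 (y - x) (x - z)
    rw [sub_add_sub_cancel, h.map_sub_rev y x] at h3
    have h4 := hsep y hy z hz hyz
    have h5 : C * (N (x - y) + N (x - z)) ≤ C * (2 * C * δ + 2 * C * δ) :=
      mul_le_mul_of_nonneg_left (by linarith) hC0.le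
    nlinarith
  have hsub : (⋃ y ∈ T, V y) ⊆ {x | N (x - 0) ≤ 2 * C * R} := by
    refine Set.iUnion₂_subset fun y hy x hx => ?_
    have h1 : N (x - y) ≤ 2 * C * δ :=
      interior_subset (s := {x | N (x - y) ≤ 2 * C * δ}) hx
    have h2 := h.2.2.2 (x - y) y
    rw [sub_add_cancel] at h2
    have h3 : 2 * C * δ ≤ R := by nlinarith
    have h4 : C * (N (x - y) + N y) ≤ C * (R + R) :=
      mul_le_mul_of_nonneg_left (by linarith [hT y hy]) hC0.le
    rw [Set.mem_ofPred_eq, sub_zero]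
    linarith
  have hvol : (T.card : ENNReal) * (ENNReal.ofReal (δ ^ n) * volume {x | N x ≤ 1}) ≤
      ENNReal.ofReal ((2 * C * R) ^ n) * volume {x | N x ≤ 1} := by
    calc (T.card : ENNReal) * (ENNReal.ofReal (δ ^ n) * volume {x | N x ≤ 1})
        = ∑ y ∈ T, volume {x | N (x - y) ≤ δ} := by
          simp [h.volume_ball_scaled _ hδ0]
      _ ≤ ∑ y ∈ T, volume (V y) :=
          Finset.sum_le_sum fun y _ => measure_mono (h.ball_subset_interior hC y hδ0)
      _ = volume (⋃ y ∈ T, V y) :=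
          (measure_biUnion_finset hdisj fun y _ => isOpen_interior.measurableSet).symm
      _ ≤ volume {x | N (x - 0) ≤ 2 * C * R} := measure_mono hsub
      _ = _ := h.volume_ball_scaled 0 (by positivity)
  rw [← mul_assoc, ENNReal.mul_le_mul_iff_left (h.volume_ball_pos hC).ne' hfin.ne,
    ← ENNReal.ofReal_natCast, ← ENNReal.ofReal_mul (by positivity),
    ENNReal.ofReal_le_ofReal_iff (by positivity)] at hvol
  have hq : 8 * C ^ 3 * R / ε = 2 * C * R / δ := by
    rw [← hδε]; field_simp; ring
  rwa [hq, div_pow, le_div_iff₀ (by positivity)]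

/-- A subset of a ball of radius `R` is covered by few balls of radius `ε`. -/
lemma exists_finset_cover (h : IsQuasiNormWith n C N) (hC : 1 ≤ C)
    (hfin : volume {x | N x ≤ 1} < ⊤) {R ε : ℝ} (hε : 0 < ε) (S : Set (Fin n → ℝ))
    (hS : ∀ x ∈ S, N x ≤ R) (m : ℕ) (hm1 : 1 ≤ m) (hm : (8 * C ^ 3 * R / ε) ^ n ≤ m) :
    ∃ T : Finset (Fin n → ℝ), T.card ≤ m ∧ ∀ x ∈ S, ∃ y ∈ T, N (x - y) ≤ ε := by
  classical
  rcases le_total R ε with hRε | hεR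
  · exact ⟨{0}, by simpa using hm1, fun x hx => ⟨0, by simp, by simpa using (hS x hx).trans hRε⟩⟩
  let P : ℕ → Prop := fun j => ∃ T : Finset (Fin n → ℝ), T.card = j ∧ (∀ y ∈ T, y ∈ S) ∧
    ∀ y ∈ T, ∀ z ∈ T, y ≠ z → ε < N (y - z)
  have hP : ∀ j, P j → j ≤ m := by
    rintro j ⟨T, rfl, hTS, hsep⟩
    exact_mod_cast (h.card_separated_le hC hfin hε hεR T (fun y hy => hS y (hTS y hy)) hsep).trans hm
  have hP0 : P 0 := ⟨∅, by simp⟩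
  obtain ⟨T, hcard, hTS, hsep⟩ : P (Nat.findGreatest P m) := Nat.findGreatest_spec (Nat.zero_le m) hP0
  refine ⟨T, hcard ▸ Nat.findGreatest_le m, fun x hx => ?_⟩
  by_contra! hcon
  have hxT : x ∉ T := fun hxT => by
    have := hcon x hxT
    rw [sub_self, h.map_zero] at this
    linarith
  have hins : P (T.card + 1) := by
    refine ⟨insert x T, Finset.card_insert_of_notMem hxT, ?_, ?_⟩
    · intro y hy
      rcases Finset.mem_insert.1 hy with rfl | hy
      exacts [hx, hTS y hy]
    · intro y hy z hz hyz
      rcases Finset.mem_insert.1 hy with hyx | hyT <;> rcases Finset.mem_insert.1 hz with hzx | hzT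
      · exact absurd (hyx.trans hzx.symm) hyz
      · exact hyx ▸ hcon z hzT
      · rw [h.map_sub_rev, hzx]; exact hcon y hyT
      · exact hsep y hyT z hzT hyz
  have := Nat.le_findGreatest (hP _ hins) hins
  omega

/-- Volume comparison for a covering by balls of radius `ε`. -/
lemma volume_le_of_cover (h : IsQuasiNormWith n C N) {ε : ℝ} (hε : 0 < ε)
    (S : Set (Fin n → ℝ)) (T : Finset (Fin n → ℝ)) (hcov : ∀ x ∈ S, ∃ y ∈ T, N (x - y) ≤ ε) :
    volume S ≤ T.card * (ENNReal.ofReal (ε ^ n) * volume {x | N x ≤ 1}) := by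
  calc volume S ≤ volume (⋃ y ∈ T, {x | N (x - y) ≤ ε}) :=
        measure_mono fun x hx => by simpa using hcov x hx
    _ ≤ ∑ y ∈ T, volume {x | N (x - y) ≤ ε} := measure_biUnion_finset_le _ _
    _ = _ := by simp [h.volume_ball_scaled _ hε]

end IsQuasiNormWith

/-- The operator norm bounds `NY` on the unit ball of `NX`. -/
lemma le_opNorm_of_le_one {n : ℕ} {C : ℝ} (hC : 1 ≤ C) {NX NY : (Fin n → ℝ) → ℝ}
    (hX : IsQuasiNormWith n C NX) (hXs : IsSymmetricNorm n NX)
    (hXe : ∀ i : Fin n, NX (Pi.single i 1) = 1) (hY : IsQuasiNormWith n C NY)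
    {x : Fin n → ℝ} (hx : NX x ≤ 1) : NY x ≤ opNorm n NX NY := by
  obtain ⟨K, hK, hb⟩ := hY.exists_le_mul_norm hC
  refine le_csSup ⟨K * C, ?_⟩ ⟨x, hx, rfl⟩
  rintro t ⟨z, hz, rfl⟩
  have h1 := hX.norm_le_mul hC hXs hXe z
  have h2 : C * NX z ≤ C * 1 := mul_le_mul_of_nonneg_left hz (by linarith)
  exact (hb z).trans (mul_le_mul_of_nonneg_left (by linarith) hK.le)

/-- If the operator norm of `id : X → Y` is bounded by a multiple of the normalized volume
ratio `rv(X,Y) = (vol B_X / vol B_Y)^{1/n}`, then `e_k(id : X → Y) ≍ 2^{-k/n} rv(X,Y)` for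
all `k`, with constants depending only on `C₀` and `A`. -/
theorem entropy_eq_volume_ratio_of_opNorm_le
    (C₀ A : ℝ) (hC₀ : 1 ≤ C₀) (hA : 1 ≤ A) :
    ∃ c C : ℝ, 0 < c ∧ 0 < C ∧
      ∀ (n : ℕ), 0 < n → ∀ NX NY : (Fin n → ℝ) → ℝ,
        IsQuasiNormWith n C₀ NX → IsSymmetricNorm n NX →
        IsQuasiNormWith n C₀ NY → IsSymmetricNorm n NY →
        (∀ i : Fin n, NX (Pi.single i 1) = 1) → (∀ i : Fin n, NY (Pi.single i 1) = 1) →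
        opNorm n NX NY ≤
          A * ((volume {x : Fin n → ℝ | NX x ≤ 1}).toReal /
            (volume {x : Fin n → ℝ | NY x ≤ 1}).toReal) ^ ((n : ℝ)⁻¹) →
        ∀ k : ℕ, 0 < k →
          c * ((2 : ℝ) ^ (-(k : ℝ) / (n : ℝ)) *
              ((volume {x : Fin n → ℝ | NX x ≤ 1}).toReal /
                (volume {x : Fin n → ℝ | NY x ≤ 1}).toReal) ^ ((n : ℝ)⁻¹)) ≤
              entropyNumber n NX NY k ∧
            entropyNumber n NX NY k ≤
              C * ((2 : ℝ) ^ (-(k : ℝ) / (n : ℝ)) *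
              ((volume {x : Fin n → ℝ | NX x ≤ 1}).toReal /
                (volume {x : Fin n → ℝ | NY x ≤ 1}).toReal) ^ ((n : ℝ)⁻¹)) := by
  have hC0 : 0 < C₀ := by linarith
  have hA0 : 0 < A := by linarith
  refine ⟨1, 16 * C₀ ^ 3 * A, one_pos, by positivity, ?_⟩
  intro n hn NX NY hX hXs hY hYs hXe hYe hop k hk
  have hn0 : (0 : ℝ) < n := by exact_mod_cast hn
  have hXfin := hX.volume_ball_lt_top hC₀ hXs hXe
  have hYfin := hY.volume_ball_lt_top hC₀ hYs hYe
  have hvX : 0 < (volume {x : Fin n → ℝ | NX x ≤ 1}).toReal :=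
    ENNReal.toReal_pos (hX.volume_ball_pos hC₀).ne' hXfin.ne
  have hvY : 0 < (volume {x : Fin n → ℝ | NY x ≤ 1}).toReal :=
    ENNReal.toReal_pos (hY.volume_ball_pos hC₀).ne' hYfin.ne
  set ρ : ℝ := ((volume {x : Fin n → ℝ | NX x ≤ 1}).toReal /
    (volume {x : Fin n → ℝ | NY x ≤ 1}).toReal) ^ ((n : ℝ)⁻¹) with hρ
  have hρ0 : 0 < ρ := Real.rpow_pos_of_pos (div_pos hvX hvY) _
  have hρn : ρ ^ n = (volume {x : Fin n → ℝ | NX x ≤ 1}).toReal /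
      (volume {x : Fin n → ℝ | NY x ≤ 1}).toReal :=
    Real.rpow_inv_natCast_pow (div_pos hvX hvY).le hn.ne'
  set q : ℝ := (2 : ℝ) ^ (-(k : ℝ) / (n : ℝ)) with hq
  have hq0 : 0 < q := Real.rpow_pos_of_pos two_pos _
  have hqn : q ^ n * 2 ^ k = 1 := by
    rw [hq, ← Real.rpow_natCast, ← Real.rpow_mul two_pos.le, div_mul_cancel₀ _ hn0.ne',
      Real.rpow_neg two_pos.le, Real.rpow_natCast]
    exact inv_mul_cancel₀ (by positivity)
  have hk2 : (2 : ℝ) ^ k = 2 * 2 ^ (k - 1) := by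
    rw [← pow_succ', Nat.sub_add_cancel hk]
  have hBX : ∀ x, NX x ≤ 1 → NY x ≤ A * ρ := fun x hx =>
    (le_opNorm_of_le_one hC₀ hX hXs hXe hY hx).trans hop
  have hmem : 16 * C₀ ^ 3 * A * (q * ρ) ∈ {ε : ℝ | 0 < ε ∧ ∃ T : Finset (Fin n → ℝ),
      T.card ≤ 2 ^ (k - 1) ∧ ∀ x : Fin n → ℝ, NX x ≤ 1 → ∃ y ∈ T, NY (x - y) ≤ ε} := by
    refine ⟨by positivity, hY.exists_finset_cover hC₀ hYfin (by positivity) {x | NX x ≤ 1} hBX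
      _ Nat.one_le_two_pow ?_⟩
    have h1 : 8 * C₀ ^ 3 * (A * ρ) / (16 * C₀ ^ 3 * A * (q * ρ)) = 1 / (2 * q) := by
      field_simp; norm_num
    have h2 : (2 : ℝ) ≤ 2 ^ n := le_self_pow₀ one_le_two hn.ne'
    have h3 : 0 < q ^ n := by positivity
    have h4 : (0 : ℝ) < 2 ^ (k - 1) := by positivity
    rw [h1, div_pow, one_pow, mul_pow, div_le_iff₀ (by positivity)]
    push_cast
    rw [hk2] at hqn
    nlinarith [mul_le_mul_of_nonneg_right h2 (mul_pos h3 h4).le]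
  refine ⟨le_csInf ⟨_, hmem⟩ ?_, csInf_le ⟨0, fun ε hε => hε.1.le⟩ hmem⟩
  rintro ε ⟨hε, T, hT, hcov⟩
  have h1 := hY.volume_le_of_cover hε {x | NX x ≤ 1} T hcov
  have h2 := ENNReal.toReal_mono (by finiteness) h1
  rw [ENNReal.toReal_mul, ENNReal.toReal_mul, ENNReal.toReal_natCast,
    ENNReal.toReal_ofReal (by positivity), ← mul_assoc, ← div_le_iff₀ hvY, ← hρn] at h2
  have h3 : (T.card : ℝ) ≤ 2 ^ (k - 1) := by exact_mod_cast hT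
  have h4 : (T.card : ℝ) ≤ 2 ^ k := h3.trans (pow_le_pow_right₀ one_le_two (Nat.sub_le k 1))
  have h5 : (q * ρ) ^ n ≤ ε ^ n := by
    calc (q * ρ) ^ n = q ^ n * ρ ^ n := mul_pow _ _ _
      _ ≤ q ^ n * (2 ^ k * ε ^ n) := by gcongr; exact h2.trans (by gcongr)
      _ = ε ^ n := by rw [← mul_assoc, hqn, one_mul]
  rw [one_mul]
  exact le_of_pow_le_pow_left₀ hn.ne' hε.le h5
end

section
/- Let 0 < p, u ≤ ∞. Then there exist constants c, C > 0 depending only on p and u such that for all n ∈ ℕ the Lebesgue volume of the unit ball B_{p,u}^n = {x ∈ ℝ^n : ‖x‖_{p,u} ≤ 1} of the Lorentz space ℓ_{p,u}^n satisfies: if p < ∞, then c · n^{−1/p} ≤ vol(B_{p,u}^n)^{1/n} ≤ C · n^{−1/p}; and if p = ∞, then c · (log(n+1))^{−1/u} ≤ vol(B_{∞,u}^n)^{1/n} ≤ C · (log(n+1))^{−1/u}. -/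
open scoped ENNReal Classical
open MeasureTheory

/-- The non-increasing rearrangement of `x : ℝ^n`: for `1 ≤ i ≤ n`,
`rearr n x i` is the `i`-th largest of the absolute values of the entries of `x`,
defined via `x_i^* = inf {t ≥ 0 : #{j : |x j| > t} ≤ i - 1}`. -/
noncomputable def rearr (n : ℕ) (x : Fin n → ℝ) (i : ℕ) : ℝ :=
  sInf {t : ℝ | 0 ≤ t ∧ ((Finset.univ : Finset (Fin n)).filter (fun j => t < |x j|)).card ≤ i - 1}

/-- The Lorentz quasi-norm `‖x‖_{p,u}` on `ℝ^n` for `p, u ∈ (0,∞]`, with the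
convention `1/∞ = 0`:  `‖x‖_{p,u} = (∑_{i=1}^n i^{u/p-1} (x_i^*)^u)^{1/u}` for `u < ∞`
and `‖x‖_{p,∞} = max_{1 ≤ i ≤ n} i^{1/p} x_i^*`. -/
noncomputable def lorentzNorm (n : ℕ) (p u : ℝ≥0∞) (x : Fin n → ℝ) : ℝ :=
  if u = ⊤ then
    sSup {t : ℝ | ∃ i ∈ Finset.Icc 1 n, t = (i : ℝ) ^ (1 / p).toReal * rearr n x i}
  else
    (∑ i ∈ Finset.Icc 1 n, (i : ℝ) ^ ((u / p).toReal - 1) * rearr n x i ^ u.toReal) ^ (1 / u.toReal)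

theorem integral_exp_neg_mul_abs_rpow {r b : ℝ} (hr : 0 < r) (hb : 0 < b) :
    ∫ t : ℝ, Real.exp (-b * |t| ^ r) = 2 * (b ^ (-1 / r) * Real.Gamma (1 / r + 1)) := by
  rw [integral_comp_abs (f := fun t => Real.exp (-b * t ^ r)), integral_exp_neg_mul_rpow hr hb]

/-- A set on which `b * ∑ |x j| ^ r ≤ D * n` has volume at most that of a scaled cube. -/
theorem volume_le_of_sum_rpow_le {n : ℕ} {S : Set (Fin n → ℝ)} {r b D : ℝ} (hr : 0 < r)
    (hb : 0 < b) (h : ∀ x ∈ S, b * ∑ j, |x j| ^ r ≤ D * n) :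
    volume S ≤ ENNReal.ofReal
      ((Real.exp D * (2 * (b ^ (-1 / r) * Real.Gamma (1 / r + 1)))) ^ n) := by
  set f : (Fin n → ℝ) → ℝ := fun x => ∏ j, Real.exp D * Real.exp (-b * |x j| ^ r) with hf
  have hint : ∫ x, f x =
      (Real.exp D * (2 * (b ^ (-1 / r) * Real.Gamma (1 / r + 1)))) ^ n := by
    rw [hf, integral_fintype_prod_volume_eq_pow
      (fun t : ℝ => Real.exp D * Real.exp (-b * |t| ^ r)), integral_const_mul,
      integral_exp_neg_mul_abs_rpow hr hb, Fintype.card_fin]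
  have hG : 0 < Real.Gamma (1 / r + 1) := Real.Gamma_pos_of_pos (by positivity)
  have hfi : Integrable f := .of_integral_ne_zero (by rw [hint]; positivity)
  have hf0 : ∀ x, 0 ≤ f x := fun x => Finset.prod_nonneg fun j _ => by positivity
  have hmeas : Measurable fun x => ENNReal.ofReal (f x) := by fun_prop
  rw [← hint, ofReal_integral_eq_lintegral_ofReal hfi (.of_forall hf0)]
  have hM := mul_meas_ge_le_lintegral (μ := volume) hmeas 1
  rw [one_mul] at hM
  refine (measure_mono fun x hx => ?_).trans hM
  have h1 : 1 ≤ f x := by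
    simp only [hf, ← Real.exp_add, ← Real.exp_sum]
    rw [Real.one_le_exp_iff]
    have := h x hx
    simp only [Finset.sum_add_distrib, Finset.sum_const, ← Finset.mul_sum, Finset.card_univ,
      Fintype.card_fin, nsmul_eq_mul]
    linarith
  simpa using h1

theorem rearr_nonneg (n : ℕ) (x : Fin n → ℝ) (i : ℕ) : 0 ≤ rearr n x i :=
  Real.sInf_nonneg fun _ ht => ht.1

theorem rearr_set_nonempty (n : ℕ) (x : Fin n → ℝ) (i : ℕ) :
    {t : ℝ | 0 ≤ t ∧
      ((Finset.univ : Finset (Fin n)).filter (fun j => t < |x j|)).card ≤ i - 1}.Nonempty := by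
  refine ⟨‖x‖, norm_nonneg _, ?_⟩
  rw [Finset.filter_false_of_mem fun j _ =>
    not_lt.2 ((Real.norm_eq_abs (x j)).symm.le.trans (norm_le_pi_norm x j))]
  simp

theorem rearr_le {n : ℕ} {x : Fin n → ℝ} {s : ℝ} (hs : 0 ≤ s) (h : ∀ j, |x j| ≤ s) (i : ℕ) :
    rearr n x i ≤ s := by
  refine csInf_le ⟨0, fun _ ht => ht.1⟩ ⟨hs, ?_⟩
  rw [Finset.filter_false_of_mem fun j _ => not_lt.2 (h j)]
  simp

theorem rearr_antitone (n : ℕ) (x : Fin n → ℝ) : Antitone (rearr n x) := fun i _ hij =>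
  csInf_le_csInf ⟨0, fun _ ht => ht.1⟩ (rearr_set_nonempty n x i)
    fun _ ht => ⟨ht.1, ht.2.trans (Nat.sub_le_sub_right hij 1)⟩

/-- After sorting, the entries of `x` are dominated by the rearrangement. -/
theorem exists_perm_abs_le_rearr (n : ℕ) (x : Fin n → ℝ) :
    ∃ σ : Equiv.Perm (Fin n), ∀ k : Fin n, |x (σ k)| ≤ rearr n x (k + 1) := by
  refine ⟨Tuple.sort fun j => -|x j|, fun k => ?_⟩
  have hmono := Tuple.monotone_sort fun j => -|x j|
  set σ := Tuple.sort fun j => -|x j|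
  refine le_csInf (rearr_set_nonempty n x _) fun t ht => ?_
  by_contra! hlt
  have hsub : (Finset.Iic k).map σ.toEmbedding ⊆
      (Finset.univ : Finset (Fin n)).filter (fun j => t < |x j|) := by
    intro j hj
    obtain ⟨i, hi, rfl⟩ := Finset.mem_map.1 hj
    have := hmono (Finset.mem_Iic.1 hi)
    simp only [Function.comp_apply] at this
    simp only [Finset.mem_filter, Finset.mem_univ, true_and, Equiv.coe_toEmbedding]
    linarith
  have hc := Finset.card_le_card hsub
  rw [Finset.card_map, Fin.card_Iic] at hc
  have := ht.2
  omega

theorem sum_abs_rpow_le (n : ℕ) (x : Fin n → ℝ) {r : ℝ} (hr : 0 < r) :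
    ∑ j, |x j| ^ r ≤ ∑ i ∈ Finset.Icc 1 n, rearr n x i ^ r := by
  obtain ⟨σ, hσ⟩ := exists_perm_abs_le_rearr n x
  have hIcc : ∑ i ∈ Finset.Icc 1 n, rearr n x i ^ r =
      ∑ k : Fin n, rearr n x (k + 1) ^ r := by
    rw [Fin.sum_univ_eq_sum_range fun k => rearr n x (k + 1) ^ r, Finset.range_eq_Ico,
      Finset.sum_Ico_add' (fun k => rearr n x k ^ r) 0 n 1, zero_add,
      Finset.Ico_add_one_right_eq_Icc]
  rw [hIcc, ← Equiv.sum_comp σ]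
  exact Finset.sum_le_sum fun k _ => Real.rpow_le_rpow (abs_nonneg _) (hσ k) hr.le

theorem natCast_rpow_sub_rpow {a : ℝ} (m : ℕ) :
    ((m : ℝ) + 1) ^ a - (m : ℝ) ^ a =
      ((m : ℝ) + 1) ^ (a - 1) * ((m + 1) * (1 - (1 + -((m : ℝ) + 1)⁻¹) ^ a)) := by
  have hm : (0 : ℝ) < m + 1 := by positivity
  have h1 : (1 : ℝ) + -((m : ℝ) + 1)⁻¹ = m / (m + 1) := by field_simp; ring
  rw [h1, Real.div_rpow (by positivity) hm.le, Real.rpow_sub_one hm.ne']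
  have : ((m : ℝ) + 1) ^ a ≠ 0 := by positivity
  field_simp

theorem rpow_le_sum_rpow {a : ℝ} (ha : 0 < a) (k : ℕ) :
    (k : ℝ) ^ a ≤ max 1 a * ∑ i ∈ Finset.Icc 1 k, (i : ℝ) ^ (a - 1) := by
  induction k with
  | zero => simp [Real.zero_rpow ha.ne']
  | succ m ih =>
    rw [Finset.sum_Icc_succ_top (by omega), mul_add]
    have hm : (0 : ℝ) < m + 1 := by positivity
    have hs : -1 ≤ -((m : ℝ) + 1)⁻¹ := by
      rw [neg_le_neg_iff]; exact inv_le_one_of_one_le₀ (by linarith [m.cast_nonneg (α := ℝ)])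
    have h2 : ((m : ℝ) + 1) * (1 - (1 + -((m : ℝ) + 1)⁻¹) ^ a) ≤ max 1 a := by
      rcases le_total a 1 with h | h
      · have h3 : 1 + -((m : ℝ) + 1)⁻¹ ≤ (1 + -((m : ℝ) + 1)⁻¹) ^ a := by
          rw [← Real.rpow_le_rpow_iff (z := a⁻¹) (by linarith) (by
            have : 0 ≤ 1 + -((m : ℝ) + 1)⁻¹ := by linarith
            positivity) (by positivity), Real.rpow_rpow_inv (by linarith) ha.ne']
          have := Real.rpow_le_rpow_of_exponent_ge' (x := 1 + -((m : ℝ) + 1)⁻¹) (y := a⁻¹)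
            (z := 1) (by linarith) (by have := inv_pos.2 hm; linarith) zero_le_one
            ((one_le_inv₀ ha).2 h)
          simpa using this
        calc _ ≤ ((m : ℝ) + 1) * (1 - (1 + -((m : ℝ) + 1)⁻¹)) := by gcongr
          _ = 1 := by field_simp; ring
          _ ≤ _ := le_max_left _ _
      · have h3 := one_add_mul_self_le_rpow_one_add hs h
        calc _ ≤ ((m : ℝ) + 1) * (1 - (1 + a * -((m : ℝ) + 1)⁻¹)) := by gcongr
          _ = a := by field_simp; ring
          _ ≤ _ := le_max_right _ _
    have h4 := natCast_rpow_sub_rpow (a := a) m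
    have h5 : ((m : ℝ) + 1) ^ a - (m : ℝ) ^ a ≤ max 1 a * ((m : ℝ) + 1) ^ (a - 1) := by
      rw [h4, mul_comm (max 1 a)]; gcongr
    push_cast
    linarith

theorem sum_rpow_le_rpow {a : ℝ} (ha : 0 < a) (k : ℕ) :
    ∑ i ∈ Finset.Icc 1 k, (i : ℝ) ^ (a - 1) ≤ max 1 a⁻¹ * (k : ℝ) ^ a := by
  rcases le_total a 1 with h | h
  · suffices a * ∑ i ∈ Finset.Icc 1 k, (i : ℝ) ^ (a - 1) ≤ (k : ℝ) ^ a by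
      calc _ = a⁻¹ * (a * ∑ i ∈ Finset.Icc 1 k, (i : ℝ) ^ (a - 1)) := by field_simp
        _ ≤ a⁻¹ * (k : ℝ) ^ a := by gcongr
        _ ≤ _ := by gcongr; exact le_max_right _ _
    induction k with
    | zero => simp [Real.zero_rpow ha.ne']
    | succ m ih =>
      rw [Finset.sum_Icc_succ_top (by omega), mul_add]
      have hm : (0 : ℝ) < m + 1 := by positivity
      have hs : -1 ≤ -((m : ℝ) + 1)⁻¹ := by
        rw [neg_le_neg_iff]; exact inv_le_one_of_one_le₀ (by linarith [m.cast_nonneg (α := ℝ)])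
      have h3 := rpow_one_add_le_one_add_mul_self hs ha.le h
      have h2 : a ≤ ((m : ℝ) + 1) * (1 - (1 + -((m : ℝ) + 1)⁻¹) ^ a) := by
        calc a = ((m : ℝ) + 1) * (1 - (1 + a * -((m : ℝ) + 1)⁻¹)) := by field_simp; ring
          _ ≤ _ := by gcongr
      have h4 := natCast_rpow_sub_rpow (a := a) m
      have h5 : a * ((m : ℝ) + 1) ^ (a - 1) ≤ ((m : ℝ) + 1) ^ a - (m : ℝ) ^ a := by
        rw [h4, mul_comm a]; gcongr
      push_cast
      linarith
  · calc _ ≤ ∑ i ∈ Finset.Icc 1 k, (k : ℝ) ^ (a - 1) := by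
          refine Finset.sum_le_sum fun i hi => ?_
          have := (Finset.mem_Icc.1 hi).2
          exact Real.rpow_le_rpow (by positivity) (by exact_mod_cast this) (by linarith)
      _ = 1 * (k : ℝ) ^ a := by
          rcases Nat.eq_zero_or_pos k with rfl | hk
          · simp [Real.zero_rpow ha.ne']
          · have : (k : ℝ) ≠ 0 := by positivity
            simp [Real.rpow_sub_one this]; field_simp
      _ ≤ _ := by gcongr; exact le_max_left _ _

theorem sum_sqrt_div_le (n : ℕ) :
    ∑ k ∈ Finset.Icc 1 n, Real.sqrt ((n : ℝ) / k) ≤ 2 * n := by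
  have h := sum_rpow_le_rpow (a := 1 / 2) (by norm_num) n
  have hmax : max (1 : ℝ) (1 / 2)⁻¹ = 2 := by norm_num
  have hterm : ∀ k : ℕ, Real.sqrt ((n : ℝ) / k) = Real.sqrt n * (k : ℝ) ^ ((1 : ℝ) / 2 - 1) := by
    intro k
    rw [Real.sqrt_div (by positivity), div_eq_mul_inv, Real.sqrt_eq_rpow (k : ℝ),
      ← Real.rpow_neg (by positivity)]
    norm_num
  rw [hmax, ← Real.sqrt_eq_rpow] at h
  simp_rw [hterm, ← Finset.mul_sum]
  calc _ ≤ Real.sqrt n * (2 * Real.sqrt n) := by gcongr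
    _ = 2 * (Real.sqrt n * Real.sqrt n) := by ring
    _ = 2 * n := by rw [Real.mul_self_sqrt (by positivity)]

/-- Two-sided volume estimate for a set containing a cube and controlled through the
rearrangement. -/
theorem volume_rpow_inv_bounds {n : ℕ} (hn : 0 < n) {S : Set (Fin n → ℝ)} {r b D s : ℝ}
    (hr : 0 < r) (hb : 0 < b) (hD : 0 ≤ D) (hs : 0 ≤ s)
    (hcube : ∀ x : Fin n → ℝ, (∀ j, |x j| ≤ s) → x ∈ S)
    (hS : ∀ x ∈ S, ∀ k ∈ Finset.Icc 1 n, b * rearr n x k ^ r ≤ D * Real.sqrt ((n : ℝ) / k)) :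
    2 * s ≤ (volume S).toReal ^ ((n : ℝ)⁻¹) ∧ (volume S).toReal ^ ((n : ℝ)⁻¹) ≤
      Real.exp (D * 2) * (2 * Real.Gamma (1 / r + 1)) * b ^ (-1 / r) := by
  have hG : 0 < Real.Gamma (1 / r + 1) := Real.Gamma_pos_of_pos (by positivity)
  have hle := volume_le_of_sum_rpow_le (S := S) (D := D * 2) hr hb fun x hx => by
    calc _ ≤ b * ∑ i ∈ Finset.Icc 1 n, rearr n x i ^ r := by
          gcongr; exact sum_abs_rpow_le n x hr
      _ ≤ ∑ i ∈ Finset.Icc 1 n, D * Real.sqrt ((n : ℝ) / i) := by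
          rw [Finset.mul_sum]; exact Finset.sum_le_sum (hS x hx)
      _ ≤ D * (2 * n) := by
          rw [← Finset.mul_sum]; gcongr; exact sum_sqrt_div_le n
      _ = _ := by ring
  have hfin : volume S ≠ ⊤ := ne_top_of_le_ne_top ENNReal.ofReal_ne_top hle
  constructor
  · have hball : ENNReal.ofReal ((2 * s) ^ n) ≤ volume S := by
      have hvol := Real.volume_pi_closedBall (0 : Fin n → ℝ) hs
      rw [Fintype.card_fin] at hvol
      rw [← hvol]
      refine measure_mono fun x hx => hcube x fun j => ?_
      rw [mem_closedBall_zero_iff] at hx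
      exact (norm_le_pi_norm x j).trans hx
    calc 2 * s = ((2 * s) ^ n) ^ ((n : ℝ)⁻¹) :=
          (Real.pow_rpow_inv_natCast (by positivity) hn.ne').symm
      _ ≤ _ := by
          gcongr
          exact (ENNReal.ofReal_le_iff_le_toReal hfin).1 hball
  · calc _ ≤ ((Real.exp (D * 2) * (2 * (b ^ (-1 / r) * Real.Gamma (1 / r + 1)))) ^ n) ^
          ((n : ℝ)⁻¹) := by
          gcongr
          exact ENNReal.toReal_le_of_le_ofReal (by positivity) hle
      _ = Real.exp (D * 2) * (2 * (b ^ (-1 / r) * Real.Gamma (1 / r + 1))) :=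
          Real.pow_rpow_inv_natCast (by positivity) hn.ne'
      _ = _ := by ring

/-- Volume asymptotics for a family of sets, from a cube contained in each of them and a bound on
the rearrangement of their elements. -/
theorem exists_volume_bounds {S : (n : ℕ) → Set (Fin n → ℝ)} {Φ b : ℕ → ℝ} {r c D : ℝ}
    (hr : 0 < r) (hc : 0 < c) (hD : 0 ≤ D) (hb : ∀ n, 0 < n → 0 < b n)
    (hΦ : ∀ n, 0 < n → b n ^ (-1 / r) = Φ n)
    (hcube : ∀ n, 0 < n → ∀ x : Fin n → ℝ, (∀ j, |x j| ≤ c * Φ n) → x ∈ S n)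
    (hS : ∀ n, 0 < n → ∀ x ∈ S n, ∀ k ∈ Finset.Icc 1 n,
      b n * rearr n x k ^ r ≤ D * Real.sqrt ((n : ℝ) / k)) :
    ∃ c C : ℝ, 0 < c ∧ 0 < C ∧ ∀ n : ℕ, 0 < n →
      c * Φ n ≤ (volume (S n)).toReal ^ ((n : ℝ)⁻¹) ∧
        (volume (S n)).toReal ^ ((n : ℝ)⁻¹) ≤ C * Φ n := by
  have hG : 0 < Real.Gamma (1 / r + 1) := Real.Gamma_pos_of_pos (by positivity)
  refine ⟨2 * c, Real.exp (D * 2) * (2 * Real.Gamma (1 / r + 1)), by positivity, by positivity,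
    fun n hn => ?_⟩
  have hΦ0 : 0 ≤ Φ n := by
    have := hb n hn
    rw [← hΦ n hn]; positivity
  have := volume_rpow_inv_bounds hn hr (hb n hn) hD (mul_nonneg hc.le hΦ0) (hcube n hn) (hS n hn)
  rwa [hΦ n hn, ← mul_assoc] at this

theorem rpow_mul_rearr_rpow_le {n k : ℕ} {P M : ℝ} (hP : 0 < P) (hM : 0 ≤ M) {x : Fin n → ℝ}
    (h : rearr n x k ≤ M * (k : ℝ) ^ (-(1 / P))) :
    (n : ℝ) ^ ((1 : ℝ) / 2) * rearr n x k ^ (P / 2) ≤ M ^ (P / 2) * Real.sqrt ((n : ℝ) / k) := by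
  calc _ ≤ (n : ℝ) ^ ((1 : ℝ) / 2) * (M * (k : ℝ) ^ (-(1 / P))) ^ (P / 2) := by
        gcongr; exact rearr_nonneg n x k
    _ = _ := by
        have : -(1 / P) * (P / 2) = -(1 / 2) := by field_simp
        rw [Real.mul_rpow hM (by positivity), ← Real.rpow_mul (by positivity), this,
          Real.rpow_neg (by positivity), ← Real.sqrt_eq_rpow, ← Real.sqrt_eq_rpow,
          Real.sqrt_div (by positivity)]
        ring

theorem natCast_rpow_half_rpow {P : ℝ} (n : ℕ) :
    ((n : ℝ) ^ ((1 : ℝ) / 2)) ^ (-1 / (P / 2)) = (n : ℝ) ^ (-(1 / P)) := by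
  rw [← Real.rpow_mul (by positivity)]
  congr 1
  field_simp

theorem lorentzNorm_top_le_one_iff {n : ℕ} (hn : 0 < n) (p : ℝ≥0∞) (x : Fin n → ℝ) :
    lorentzNorm n p ⊤ x ≤ 1 ↔
      ∀ i ∈ Finset.Icc 1 n, (i : ℝ) ^ (1 / p).toReal * rearr n x i ≤ 1 := by
  have hset : {t : ℝ | ∃ i ∈ Finset.Icc 1 n, t = (i : ℝ) ^ (1 / p).toReal * rearr n x i} =
      (fun i : ℕ => (i : ℝ) ^ (1 / p).toReal * rearr n x i) '' (Finset.Icc 1 n : Finset ℕ) := by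
    ext t; simp [eq_comm]
  have hfin := ((Finset.Icc 1 n).finite_toSet.image
    fun i : ℕ => (i : ℝ) ^ (1 / p).toReal * rearr n x i).bddAbove
  rw [lorentzNorm, if_pos rfl, hset,
    csSup_le_iff hfin
      ⟨_, Set.mem_image_of_mem _ (Finset.mem_coe.2 (Finset.mem_Icc.2 ⟨le_rfl, hn⟩))⟩,
    Set.forall_mem_image]
  simp only [Finset.mem_coe]

theorem lorentzNorm_le_one_iff {n : ℕ} {p u : ℝ≥0∞} (hu : 0 < u) (hu' : u ≠ ⊤) (x : Fin n → ℝ) :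
    lorentzNorm n p u x ≤ 1 ↔
      ∑ i ∈ Finset.Icc 1 n, (i : ℝ) ^ ((u / p).toReal - 1) * rearr n x i ^ u.toReal ≤ 1 := by
  have hU : 0 < u.toReal := ENNReal.toReal_pos hu.ne' hu'
  have h0 : 0 ≤ ∑ i ∈ Finset.Icc 1 n,
      (i : ℝ) ^ ((u / p).toReal - 1) * rearr n x i ^ u.toReal :=
    Finset.sum_nonneg fun i _ => by
      have := rearr_nonneg n x i
      positivity
  rw [lorentzNorm, if_neg hu', ← Real.rpow_le_rpow_iff h0 zero_le_one (one_div_pos.2 hU),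
    Real.one_rpow]

theorem sum_mul_rearr_rpow_le_one {n k : ℕ} {p u : ℝ≥0∞} (hu : 0 < u) (hu' : u ≠ ⊤)
    {x : Fin n → ℝ} (hx : lorentzNorm n p u x ≤ 1) (hk : k ∈ Finset.Icc 1 n) :
    (∑ i ∈ Finset.Icc 1 k, (i : ℝ) ^ ((u / p).toReal - 1)) * rearr n x k ^ u.toReal ≤ 1 := by
  have h0 := rearr_nonneg n x
  refine le_trans ?_ ((lorentzNorm_le_one_iff hu hu' x).1 hx)
  rw [Finset.sum_mul]
  calc _ ≤ ∑ i ∈ Finset.Icc 1 k, (i : ℝ) ^ ((u / p).toReal - 1) * rearr n x i ^ u.toReal := by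
        refine Finset.sum_le_sum fun i hi => ?_
        have := rearr_antitone n x (Finset.mem_Icc.1 hi).2
        have := h0 k
        gcongr
    _ ≤ _ := by
        refine Finset.sum_le_sum_of_subset_of_nonneg
          (Finset.Icc_subset_Icc_right (Finset.mem_Icc.1 hk).2) fun i _ _ => ?_
        have := h0 i
        positivity

theorem lorentzNorm_le_one_of_abs_le {n : ℕ} {p u : ℝ≥0∞} {s : ℝ} (hu : 0 < u) (hu' : u ≠ ⊤)
    (hs : 0 ≤ s) (h : (∑ i ∈ Finset.Icc 1 n, (i : ℝ) ^ ((u / p).toReal - 1)) * s ^ u.toReal ≤ 1)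
    {x : Fin n → ℝ} (hx : ∀ j, |x j| ≤ s) : lorentzNorm n p u x ≤ 1 := by
  rw [lorentzNorm_le_one_iff hu hu']
  refine le_trans ?_ h
  rw [Finset.sum_mul]
  refine Finset.sum_le_sum fun i _ => ?_
  have := rearr_le hs hx i
  have := rearr_nonneg n x i
  gcongr

theorem exists_volume_bounds_of_top_right {p : ℝ≥0∞} (hp : 0 < p) (hp' : p ≠ ⊤) :
    ∃ c C : ℝ, 0 < c ∧ 0 < C ∧ ∀ n : ℕ, 0 < n →
      c * (n : ℝ) ^ (-(1 / p).toReal) ≤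
          (volume {x : Fin n → ℝ | lorentzNorm n p ⊤ x ≤ 1}).toReal ^ ((n : ℝ)⁻¹) ∧
        (volume {x : Fin n → ℝ | lorentzNorm n p ⊤ x ≤ 1}).toReal ^ ((n : ℝ)⁻¹) ≤
          C * (n : ℝ) ^ (-(1 / p).toReal) := by
  have hP : 0 < p.toReal := ENNReal.toReal_pos hp.ne' hp'
  have hpP : (1 / p).toReal = 1 / p.toReal := by simp
  rw [hpP]
  refine exists_volume_bounds (S := fun n => {x : Fin n → ℝ | lorentzNorm n p ⊤ x ≤ 1})
    (b := fun n => (n : ℝ) ^ ((1 : ℝ) / 2)) (r := p.toReal / 2) (c := 1)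
    (D := 1 ^ (p.toReal / 2)) (by positivity) one_pos (by positivity) (fun n hn => by positivity)
    (fun n _ => natCast_rpow_half_rpow n) ?_ ?_
  · intro n hn x hx
    rw [Set.mem_ofPred_eq, lorentzNorm_top_le_one_iff hn, hpP]
    intro i hi
    have h1 := rearr_le (by positivity) hx i
    have hin : (i : ℝ) ≤ n := by exact_mod_cast (Finset.mem_Icc.1 hi).2
    calc _ ≤ (n : ℝ) ^ (1 / p.toReal) * (1 * (n : ℝ) ^ (-(1 / p.toReal))) := by
          gcongr
          exact rearr_nonneg n x i
      _ = 1 := by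
          rw [one_mul, ← Real.rpow_add (by positivity)]; simp
  · intro n hn x hx k hk
    refine rpow_mul_rearr_rpow_le hP zero_le_one ?_
    rw [Set.mem_ofPred_eq, lorentzNorm_top_le_one_iff hn, hpP] at hx
    have hk0 : (0 : ℝ) < k := by exact_mod_cast (Finset.mem_Icc.1 hk).1
    rw [Real.rpow_neg hk0.le, one_mul, ← one_div, le_div_iff₀ (by positivity), mul_comm]
    exact hx k hk

theorem exists_volume_bounds_of_ne_top {p u : ℝ≥0∞} (hp : 0 < p) (hp' : p ≠ ⊤) (hu : 0 < u)
    (hu' : u ≠ ⊤) :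
    ∃ c C : ℝ, 0 < c ∧ 0 < C ∧ ∀ n : ℕ, 0 < n →
      c * (n : ℝ) ^ (-(1 / p).toReal) ≤
          (volume {x : Fin n → ℝ | lorentzNorm n p u x ≤ 1}).toReal ^ ((n : ℝ)⁻¹) ∧
        (volume {x : Fin n → ℝ | lorentzNorm n p u x ≤ 1}).toReal ^ ((n : ℝ)⁻¹) ≤
          C * (n : ℝ) ^ (-(1 / p).toReal) := by
  have hP : 0 < p.toReal := ENNReal.toReal_pos hp.ne' hp'
  have hU : 0 < u.toReal := ENNReal.toReal_pos hu.ne' hu'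
  have hpP : (1 / p).toReal = 1 / p.toReal := by simp
  have ha : 0 < (u / p).toReal := by rw [ENNReal.toReal_div]; positivity
  have haU : ∀ k : ℕ, ((k : ℝ) ^ (-(1 / p.toReal))) ^ u.toReal = ((k : ℝ) ^ (u / p).toReal)⁻¹ := by
    intro k
    rw [← Real.rpow_mul (by positivity), ← Real.rpow_neg (by positivity), ENNReal.toReal_div]
    congr 1
    field_simp
  set a := (u / p).toReal with ha_def
  have hm : 0 < max 1 a := by positivity
  have hm' : 0 < max 1 a⁻¹ := by positivity
  rw [hpP]
  refine exists_volume_bounds (S := fun n => {x : Fin n → ℝ | lorentzNorm n p u x ≤ 1})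
    (b := fun n => (n : ℝ) ^ ((1 : ℝ) / 2)) (r := p.toReal / 2)
    (c := ((max 1 a⁻¹)⁻¹) ^ (u.toReal)⁻¹)
    (D := ((max 1 a) ^ (u.toReal)⁻¹) ^ (p.toReal / 2)) (by positivity) (by positivity)
    (by positivity) (fun n hn => by positivity) (fun n _ => natCast_rpow_half_rpow n) ?_ ?_
  · intro n hn x hx
    refine lorentzNorm_le_one_of_abs_le hu hu' (by positivity) ?_ hx
    rw [Real.mul_rpow (by positivity) (by positivity), Real.rpow_inv_rpow (by positivity) hU.ne',
      haU]
    have := sum_rpow_le_rpow ha n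
    calc _ ≤ (max 1 a⁻¹ * (n : ℝ) ^ a) * ((max 1 a⁻¹)⁻¹ * ((n : ℝ) ^ a)⁻¹) := by gcongr
      _ = 1 := by
        have : (n : ℝ) ^ a ≠ 0 := by positivity
        field_simp
  · intro n hn x hx k hk
    refine rpow_mul_rearr_rpow_le hP (by positivity) ?_
    have h0 := rearr_nonneg n x k
    have hk0 : (0 : ℝ) < k := by exact_mod_cast (Finset.mem_Icc.1 hk).1
    have h1 := sum_mul_rearr_rpow_le_one hu hu' hx hk
    have h2 := rpow_le_sum_rpow ha k
    rw [← Real.rpow_le_rpow_iff h0 (by positivity) hU, Real.mul_rpow (by positivity)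
      (by positivity), Real.rpow_inv_rpow (by positivity) hU.ne', haU, ← div_eq_mul_inv,
      le_div_iff₀ (by positivity)]
    calc _ ≤ rearr n x k ^ u.toReal *
          (max 1 a * ∑ i ∈ Finset.Icc 1 k, (i : ℝ) ^ (a - 1)) := by gcongr
      _ = max 1 a * ((∑ i ∈ Finset.Icc 1 k, (i : ℝ) ^ (a - 1)) * rearr n x k ^ u.toReal) := by
          ring
      _ ≤ max 1 a * 1 := by gcongr
      _ = _ := mul_one _

theorem log_natCast_add_one_le {k n : ℕ} (hk : 0 < k) (hkn : k ≤ n) :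
    Real.log (n + 1) ≤ 5 * Real.sqrt ((n : ℝ) / k) * Real.log (k + 1) := by
  have hk0 : (1 : ℝ) ≤ k := by exact_mod_cast hk
  have hkn' : (k : ℝ) ≤ n := by exact_mod_cast hkn
  have hq : 1 ≤ (n : ℝ) / k := by rwa [one_le_div (by linarith)]
  have hs : 1 ≤ Real.sqrt ((n : ℝ) / k) := Real.one_le_sqrt.2 hq
  have hl : Real.log ((n : ℝ) / k) ≤ 2 * Real.sqrt ((n : ℝ) / k) := by
    have := Real.log_le_self (Real.sqrt_nonneg ((n : ℝ) / k))
    rw [Real.log_sqrt (by positivity)] at this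
    linarith
  have h2 : 1 / 2 ≤ Real.log (k + 1) := by
    have := Real.log_le_log (x := 2) (y := k + 1) (by norm_num) (by linarith)
    linarith [Real.log_two_gt_d9]
  have h3 : Real.log (n + 1) ≤ Real.log (k + 1) + Real.log ((n : ℝ) / k) := by
    rw [← Real.log_mul (by positivity) (by positivity)]
    refine Real.log_le_log (by positivity) ?_
    have : ((k : ℝ) + 1) * (n / k) = n + n / k := by field_simp
    linarith
  nlinarith

theorem exists_volume_bounds_of_top_left {u : ℝ≥0∞} (hu : 0 < u) (hu' : u ≠ ⊤) :
    ∃ c C : ℝ, 0 < c ∧ 0 < C ∧ ∀ n : ℕ, 0 < n →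
      c * Real.log ((n : ℝ) + 1) ^ (-(1 / u).toReal) ≤
          (volume {x : Fin n → ℝ | lorentzNorm n ⊤ u x ≤ 1}).toReal ^ ((n : ℝ)⁻¹) ∧
        (volume {x : Fin n → ℝ | lorentzNorm n ⊤ u x ≤ 1}).toReal ^ ((n : ℝ)⁻¹) ≤
          C * Real.log ((n : ℝ) + 1) ^ (-(1 / u).toReal) := by
  have hU : 0 < u.toReal := ENNReal.toReal_pos hu.ne' hu'
  have hsum : ∀ k : ℕ, ∑ i ∈ Finset.Icc 1 k, (i : ℝ) ^ ((u / ⊤).toReal - 1) = harmonic k := by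
    intro k
    simp [harmonic_eq_sum_Icc, Real.rpow_neg_one]
  have hlog : ∀ n : ℕ, 0 < n → 1 / 2 ≤ Real.log ((n : ℝ) + 1) := by
    intro n hn
    have h1 : (1 : ℝ) ≤ n := by exact_mod_cast hn
    have := Real.log_le_log (x := 2) (y := n + 1) (by norm_num) (by linarith)
    linarith [Real.log_two_gt_d9]
  have hexp : -(1 / u).toReal = -1 / u.toReal := by simp [neg_div]
  rw [hexp]
  refine exists_volume_bounds (S := fun n => {x : Fin n → ℝ | lorentzNorm n ⊤ u x ≤ 1})
    (b := fun n => Real.log ((n : ℝ) + 1)) (r := u.toReal) (c := 3⁻¹ ^ (u.toReal)⁻¹) (D := 5)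
    hU (by positivity) (by norm_num) (fun n hn => by linarith [hlog n hn])
    (fun n _ => rfl) ?_ ?_
  · intro n hn x hx
    have hL := hlog n hn
    have hL0 : 0 < Real.log ((n : ℝ) + 1) := by linarith
    refine lorentzNorm_le_one_of_abs_le hu hu' (by positivity) ?_ hx
    rw [Real.mul_rpow (by positivity) (by positivity), Real.rpow_inv_rpow (by positivity) hU.ne',
      ← Real.rpow_mul hL0.le, div_mul_cancel₀ _ hU.ne', Real.rpow_neg_one, hsum]
    have h1 := harmonic_le_one_add_log n
    have h2 : Real.log n ≤ Real.log ((n : ℝ) + 1) :=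
      Real.log_le_log (by positivity) (by linarith)
    calc _ ≤ (3 * Real.log ((n : ℝ) + 1)) * (3⁻¹ * (Real.log ((n : ℝ) + 1))⁻¹) := by
          gcongr; linarith
      _ = 1 := by field_simp
  · intro n hn x hx k hk
    have h0 := rearr_nonneg n x k
    obtain ⟨hk1, hkn⟩ := Finset.mem_Icc.1 hk
    have h1 := sum_mul_rearr_rpow_le_one hu hu' hx hk
    rw [hsum] at h1
    have h2 := log_add_one_le_harmonic k
    push_cast at h2
    have h3 := log_natCast_add_one_le hk1 hkn
    calc _ ≤ 5 * Real.sqrt ((n : ℝ) / k) * Real.log (k + 1) * rearr n x k ^ u.toReal := by gcongr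
      _ ≤ 5 * Real.sqrt ((n : ℝ) / k) * harmonic k * rearr n x k ^ u.toReal := by gcongr
      _ = 5 * Real.sqrt ((n : ℝ) / k) * (harmonic k * rearr n x k ^ u.toReal) := by ring
      _ ≤ 5 * Real.sqrt ((n : ℝ) / k) * 1 := by gcongr
      _ = _ := mul_one _

theorem exists_volume_bounds_of_top_top :
    ∃ c C : ℝ, 0 < c ∧ 0 < C ∧ ∀ n : ℕ, 0 < n →
      c * Real.log ((n : ℝ) + 1) ^ (-(1 / (⊤ : ℝ≥0∞)).toReal) ≤
          (volume {x : Fin n → ℝ | lorentzNorm n ⊤ ⊤ x ≤ 1}).toReal ^ ((n : ℝ)⁻¹) ∧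
        (volume {x : Fin n → ℝ | lorentzNorm n ⊤ ⊤ x ≤ 1}).toReal ^ ((n : ℝ)⁻¹) ≤
          C * Real.log ((n : ℝ) + 1) ^ (-(1 / (⊤ : ℝ≥0∞)).toReal) := by
  refine exists_volume_bounds (S := fun n => {x : Fin n → ℝ | lorentzNorm n ⊤ ⊤ x ≤ 1})
    (b := fun _ => 1) (r := 1) (c := 1) (D := 1) one_pos one_pos zero_le_one
    (fun _ _ => one_pos) (fun n _ => by simp) ?_ ?_
  · intro n hn x hx
    rw [Set.mem_ofPred_eq, lorentzNorm_top_le_one_iff hn]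
    intro i _
    have h1 := rearr_le (s := 1) zero_le_one (by simpa using hx) i
    simpa using h1
  · intro n hn x hx k hk
    rw [Set.mem_ofPred_eq, lorentzNorm_top_le_one_iff hn] at hx
    have h1 : rearr n x k ≤ 1 := by simpa using hx k hk
    obtain ⟨hk1, hkn⟩ := Finset.mem_Icc.1 hk
    have hk0 : (0 : ℝ) < k := by exact_mod_cast hk1
    have hs : 1 ≤ Real.sqrt ((n : ℝ) / k) :=
      Real.one_le_sqrt.2 ((one_le_div hk0).2 (by exact_mod_cast hkn))
    simpa using h1.trans hs

/-- Asymptotics for the volume of the Lorentz unit ball `B_{p,u}^n`: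
`vol(B_{p,u}^n)^{1/n} ≍ n^{-1/p}` for `p < ∞` and `≍ (log(n+1))^{-1/u}` for `p = ∞`,
with constants depending only on `p` and `u`. -/
theorem volume_lorentz_ball
    (p u : ℝ≥0∞) (hp : 0 < p) (hu : 0 < u) :
    ∃ c C : ℝ, 0 < c ∧ 0 < C ∧ ∀ n : ℕ, 0 < n →
      (p ≠ ⊤ →
        c * (n : ℝ) ^ (-(1 / p).toReal) ≤
            (volume {x : Fin n → ℝ | lorentzNorm n p u x ≤ 1}).toReal ^ ((n : ℝ)⁻¹) ∧
          (volume {x : Fin n → ℝ | lorentzNorm n p u x ≤ 1}).toReal ^ ((n : ℝ)⁻¹) ≤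
            C * (n : ℝ) ^ (-(1 / p).toReal)) ∧
      (p = ⊤ →
        c * Real.log ((n : ℝ) + 1) ^ (-(1 / u).toReal) ≤
            (volume {x : Fin n → ℝ | lorentzNorm n p u x ≤ 1}).toReal ^ ((n : ℝ)⁻¹) ∧
          (volume {x : Fin n → ℝ | lorentzNorm n p u x ≤ 1}).toReal ^ ((n : ℝ)⁻¹) ≤
            C * Real.log ((n : ℝ) + 1) ^ (-(1 / u).toReal)) := by
  rcases eq_or_ne p ⊤ with rfl | hp'
  · rcases eq_or_ne u ⊤ with rfl | hu'
    · obtain ⟨c, C, hc, hC, h⟩ := exists_volume_bounds_of_top_top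
      exact ⟨c, C, hc, hC, fun n hn => ⟨fun hne => absurd rfl hne, fun _ => h n hn⟩⟩
    · obtain ⟨c, C, hc, hC, h⟩ := exists_volume_bounds_of_top_left hu hu'
      exact ⟨c, C, hc, hC, fun n hn => ⟨fun hne => absurd rfl hne, fun _ => h n hn⟩⟩
  · rcases eq_or_ne u ⊤ with rfl | hu'
    · obtain ⟨c, C, hc, hC, h⟩ := exists_volume_bounds_of_top_right hp hp'
      exact ⟨c, C, hc, hC, fun n hn => ⟨fun _ => h n hn, fun he => absurd he hp'⟩⟩
    · obtain ⟨c, C, hc, hC, h⟩ := exists_volume_bounds_of_ne_top hp hp' hu hu'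
      exact ⟨c, C, hc, hC, fun n hn => ⟨fun _ => h n hn, fun he => absurd he hp'⟩⟩
end

section
/- Let 0 < p, q, u, v ≤ ∞ and for integers 1 ≤ s ≤ n define u(ℓ_{p,u}^n, ℓ_{q,v}^n, s) = sup{ ‖(min{x_s^*, x_i^*})_{i=1}^n‖_{q,v} : x ∈ ℝ^n, ‖x‖_{p,u} ≤ 1 }. Then there exist constants c, C > 0 depending only on p, q, u, v such that for all integers n and s with 1 ≤ s < n/log 3: (i) if p < ∞ and q = ∞, then c · s^{−1/p}(log(s+1))^{1/v} ≤ u(ℓ_{p,u}^n, ℓ_{∞,v}^n, s) ≤ C · s^{−1/p}(log(s+1))^{1/v}; (ii) if p = q < ∞ and u > v, then c · (log(n/s + 1))^{1/v − 1/u} ≤ u(ℓ_{p,u}^n, ℓ_{p,v}^n, s) ≤ C · (log(n/s + 1))^{1/v − 1/u}; (iii) if p = q = ∞ and u < v, then c · (log(s+1))^{1/v − 1/u} ≤ u(ℓ_{∞,u}^n, ℓ_{∞,v}^n, s) ≤ C · (log(s+1))^{1/v − 1/u}. -/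
open scoped ENNReal Classical
open MeasureTheory

/-- The truncation functional `u(ℓ_{p,u}^n, ℓ_{q,v}^n, s)
= sup { ‖(min{x_s^*, x_i^*})_{i=1}^n‖_{q,v} : ‖x‖_{p,u} ≤ 1 }`. -/
noncomputable def truncFunctional (n : ℕ) (p u q v : ℝ≥0∞) (s : ℕ) : ℝ :=
  sSup {t : ℝ | ∃ x : Fin n → ℝ, lorentzNorm n p u x ≤ 1 ∧
    t = lorentzNorm n q v (fun i : Fin n => min (rearr n x s) (rearr n x (i.1 + 1)))}

open Finset in
theorem sum_Icc_one_split {s n : ℕ} (hsn : s ≤ n) (f : ℕ → ℝ) :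
    ∑ i ∈ Icc 1 n, f i = ∑ i ∈ Icc 1 s, f i + ∑ i ∈ Ioc s n, f i := by
  have h (m : ℕ) : Icc 1 m = Ioc 0 m := by ext; simp; omega
  rw [h, h, sum_Ioc_consecutive _ (Nat.zero_le s) hsn]

/-! ### Power sums -/

/-- Telescoping bound for the sum over `Icc 1 k`. -/
theorem sum_Icc_one_le_of_sub_le {f F : ℕ → ℝ} (h0 : 0 ≤ F 0)
    (h : ∀ m : ℕ, f (m + 1) ≤ F (m + 1) - F m) (k : ℕ) :
    ∑ i ∈ Finset.Icc 1 k, f i ≤ F k := by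
  induction k with
  | zero => simpa using h0
  | succ m ih => rw [Finset.sum_Icc_succ_top (by omega)]; linarith [h m]

theorem le_sum_Icc_one_of_le_sub {f F : ℕ → ℝ} (h0 : F 0 ≤ 0)
    (h : ∀ m : ℕ, F (m + 1) - F m ≤ f (m + 1)) (k : ℕ) :
    F k ≤ ∑ i ∈ Finset.Icc 1 k, f i := by
  induction k with
  | zero => simpa using h0
  | succ m ih => rw [Finset.sum_Icc_succ_top (by omega)]; linarith [h m]

theorem sum_Ioc_le_of_le_sub {f F : ℕ → ℝ} {s n : ℕ} (hsn : s ≤ n)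
    (h : ∀ m : ℕ, s ≤ m → f (m + 1) ≤ F (m + 1) - F m) :
    ∑ i ∈ Finset.Ioc s n, f i ≤ F n - F s := by
  induction n, hsn using Nat.le_induction with
  | base => simp
  | succ m hm ih =>
    rw [Finset.sum_Ioc_succ_top (by omega)]; linarith [h m hm]

theorem le_sum_Ioc_of_sub_le {f F : ℕ → ℝ} {s n : ℕ} (hsn : s ≤ n)
    (h : ∀ m : ℕ, s ≤ m → F (m + 1) - F m ≤ f (m + 1)) :
    F n - F s ≤ ∑ i ∈ Finset.Ioc s n, f i := by
  induction n, hsn using Nat.le_induction with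
  | base => simp
  | succ m hm ih =>
    rw [Finset.sum_Ioc_succ_top (by omega)]; linarith [h m hm]

theorem natCast_rpow_eq_mul_one_add (m : ℕ) (r : ℝ) :
    (m : ℝ) ^ r = ((m + 1 : ℕ) : ℝ) ^ r * (1 + -((m + 1 : ℕ) : ℝ)⁻¹) ^ r := by
  have hpos : (0 : ℝ) < ((m + 1 : ℕ) : ℝ) := by positivity
  have h : 1 + -((m + 1 : ℕ) : ℝ)⁻¹ = m / ((m + 1 : ℕ) : ℝ) := by
    field_simp; push_cast; ring
  rw [h, ← Real.mul_rpow hpos.le (by positivity)]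
  congr 1
  field_simp

theorem neg_one_le_neg_inv_succ (m : ℕ) : (-1 : ℝ) ≤ -((m + 1 : ℕ) : ℝ)⁻¹ := by
  have : ((m + 1 : ℕ) : ℝ)⁻¹ ≤ 1 := inv_le_one_of_one_le₀ (by push_cast; linarith [m.cast_nonneg (α := ℝ)])
  linarith

/-- `∑_{i ≤ k} i^{r-1} ≍ k^r` for `r > 0`. -/
theorem exists_sum_rpow_bounds {r : ℝ} (hr : 0 < r) :
    ∃ c C : ℝ, 0 < c ∧ 0 < C ∧ ∀ k : ℕ,
      c * (k : ℝ) ^ r ≤ ∑ i ∈ Finset.Icc 1 k, (i : ℝ) ^ (r - 1) ∧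
      ∑ i ∈ Finset.Icc 1 k, (i : ℝ) ^ (r - 1) ≤ C * (k : ℝ) ^ r := by
  have hsub (m : ℕ) : ((m + 1 : ℕ) : ℝ) ^ (r - 1) = ((m + 1 : ℕ) : ℝ) ^ r * ((m + 1 : ℕ) : ℝ)⁻¹ := by
    rw [Real.rpow_sub_one (by positivity), div_eq_mul_inv]
  have hcard (k : ℕ) : ∑ _i ∈ Finset.Icc 1 k, (k : ℝ) ^ (r - 1) = 1 * (k : ℝ) ^ r := by
    rcases k.eq_zero_or_pos with rfl | hk
    · simp [hr.ne']
    · have : (0 : ℝ) < k := by exact_mod_cast hk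
      rw [Finset.sum_const, Nat.card_Icc, Nat.add_sub_cancel, nsmul_eq_mul,
        Real.rpow_sub_one this.ne']
      field_simp
  rcases le_total 1 r with h1 | h1
  · refine ⟨r⁻¹, 1, by positivity, one_pos, fun k => ⟨?_, ?_⟩⟩
    · refine le_sum_Icc_one_of_le_sub (F := fun k : ℕ => r⁻¹ * (k : ℝ) ^ r) (by simp [hr.ne'])
        (fun m => ?_) k
      have hb := one_add_mul_self_le_rpow_one_add (neg_one_le_neg_inv_succ m) h1
      have hP : (0 : ℝ) < ((m + 1 : ℕ) : ℝ) ^ r := by positivity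
      rw [hsub, natCast_rpow_eq_mul_one_add m r, ← mul_sub, inv_mul_le_iff₀ hr]
      nlinarith [mul_le_mul_of_nonneg_left hb hP.le]
    · rw [← hcard]
      refine Finset.sum_le_sum fun i hi => ?_
      have := (Finset.mem_Icc.1 hi).2
      gcongr
  · refine ⟨1, r⁻¹, one_pos, by positivity, fun k => ⟨?_, ?_⟩⟩
    · rw [← hcard]
      refine Finset.sum_le_sum fun i hi => ?_
      obtain ⟨hi1, hi2⟩ := Finset.mem_Icc.1 hi
      exact Real.rpow_le_rpow_of_nonpos (by exact_mod_cast hi1) (by exact_mod_cast hi2) (by linarith)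
    · refine sum_Icc_one_le_of_sub_le (F := fun k : ℕ => r⁻¹ * (k : ℝ) ^ r) (by simp [hr.ne'])
        (fun m => ?_) k
      have hb := rpow_one_add_le_one_add_mul_self (neg_one_le_neg_inv_succ m) hr.le h1
      have hP : (0 : ℝ) < ((m + 1 : ℕ) : ℝ) ^ r := by positivity
      rw [hsub, natCast_rpow_eq_mul_one_add m r, ← mul_sub, le_inv_mul_iff₀ hr]
      nlinarith [mul_le_mul_of_nonneg_left hb hP.le]

theorem sum_Ioc_rpow_le {r : ℝ} (hr : 0 < r) {s n : ℕ} (hs : 1 ≤ s) (hsn : s ≤ n) :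
    ∑ i ∈ Finset.Ioc s n, (i : ℝ) ^ (-r - 1) ≤ r⁻¹ * (s : ℝ) ^ (-r) := by
  refine (sum_Ioc_le_of_le_sub (F := fun k : ℕ => -(r⁻¹ * (k : ℝ) ^ (-r))) hsn fun m hm => ?_).trans ?_
  · have hm0 : (0 : ℝ) < m := by exact_mod_cast (by omega : 0 < m)
    have hQ : 0 < 1 + -((m + 1 : ℕ) : ℝ)⁻¹ := by
      have : ((m + 1 : ℕ) : ℝ)⁻¹ < 1 := inv_lt_one_of_one_lt₀ (by push_cast; linarith)
      linarith
    have hb : 1 + r * ((m + 1 : ℕ) : ℝ)⁻¹ ≤ (1 + -((m + 1 : ℕ) : ℝ)⁻¹) ^ (-r) := by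
      rw [Real.rpow_def_of_pos hQ]
      have := Real.log_le_sub_one_of_pos hQ
      refine le_trans ?_ (Real.add_one_le_exp _)
      nlinarith
    have hP : (0 : ℝ) < ((m + 1 : ℕ) : ℝ) ^ (-r) := by positivity
    rw [natCast_rpow_eq_mul_one_add m (-r), Real.rpow_sub_one (by positivity) (-r), div_eq_mul_inv,
      neg_sub_neg, ← mul_sub, le_inv_mul_iff₀ hr]
    nlinarith [mul_le_mul_of_nonneg_left hb hP.le]
  · have : 0 ≤ r⁻¹ * (n : ℝ) ^ (-r) := by positivity
    linarith

theorem sum_Ioc_inv_le {s n : ℕ} (hs : 1 ≤ s) (hsn : s ≤ n) :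
    ∑ i ∈ Finset.Ioc s n, (i : ℝ)⁻¹ ≤ Real.log ((n : ℝ) / s) := by
  have hs0 : (0 : ℝ) < s := by exact_mod_cast hs
  have hn0 : (0 : ℝ) < n := by exact_mod_cast hs.trans hsn
  rw [Real.log_div hn0.ne' hs0.ne']
  refine sum_Ioc_le_of_le_sub (F := fun k : ℕ => Real.log k) hsn fun m hm => ?_
  have hm0 : (0 : ℝ) < m := by exact_mod_cast (by omega : 0 < m)
  have h := Real.log_le_sub_one_of_pos (x := m / ((m + 1 : ℕ) : ℝ)) (by positivity)
  rw [Real.log_div hm0.ne' (by positivity)] at h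
  have h2 : (m : ℝ) / ((m + 1 : ℕ) : ℝ) - 1 = -((m + 1 : ℕ) : ℝ)⁻¹ := by
    field_simp; push_cast; ring
  linarith

theorem le_sum_Ioc_inv {s n : ℕ} (hsn : s ≤ n) :
    Real.log (((n : ℝ) + 1) / (s + 1)) ≤ ∑ i ∈ Finset.Ioc s n, (i : ℝ)⁻¹ := by
  rw [Real.log_div (by positivity) (by positivity)]
  refine le_sum_Ioc_of_sub_le (F := fun k : ℕ => Real.log ((k : ℝ) + 1)) hsn fun m hm => ?_
  have h := Real.log_le_sub_one_of_pos (x := (((m + 1 : ℕ) : ℝ) + 1) / (m + 1)) (by positivity)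
  rw [Real.log_div (by positivity) (by positivity)] at h
  have h2 : (((m + 1 : ℕ) : ℝ) + 1) / (m + 1) - 1 = ((m + 1 : ℕ) : ℝ)⁻¹ := by
    field_simp; push_cast; ring
  linarith

theorem half_le_log_of_two_le {x : ℝ} (hx : 2 ≤ x) : 1 / 2 ≤ Real.log x := by
  have h1 := Real.log_two_gt_d9
  have h2 := Real.log_le_log (by norm_num) hx
  linarith

theorem log_succ_le_sum_inv (s : ℕ) :
    Real.log ((s : ℝ) + 1) ≤ ∑ i ∈ Finset.Icc 1 s, (i : ℝ)⁻¹ := by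
  have h := le_sum_Ioc_inv (Nat.zero_le s)
  have hI : Finset.Icc 1 s = Finset.Ioc 0 s := by ext; simp; omega
  rw [hI]
  simpa using h

theorem sum_inv_le_log_succ {s : ℕ} (hs : 1 ≤ s) :
    ∑ i ∈ Finset.Icc 1 s, (i : ℝ)⁻¹ ≤ 3 * Real.log ((s : ℝ) + 1) := by
  have hs' : (1 : ℝ) ≤ s := by exact_mod_cast hs
  rw [sum_Icc_one_split hs]
  have h1 := sum_Ioc_inv_le le_rfl hs
  have h2 := half_le_log_of_two_le (x := (s : ℝ) + 1) (by linarith)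
  have h3 : Real.log ((s : ℝ) / (1 : ℕ)) ≤ Real.log ((s : ℝ) + 1) := by
    rw [Nat.cast_one, div_one]
    exact Real.log_le_log (by linarith) (by linarith)
  have h4 : ∑ i ∈ Finset.Icc 1 1, ((i : ℕ) : ℝ)⁻¹ = 1 := by simp
  linarith

/-- `∑_{i ≤ n} i^{r-1} max(i,s)^{-r} ≍ log (n/s + 1)` for `r > 0`. -/
theorem exists_sum_rpow_mul_max_bounds {r : ℝ} (hr : 0 < r) :
    ∃ c C : ℝ, 0 < c ∧ 0 < C ∧ ∀ n s : ℕ, 1 ≤ s → s ≤ n →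
      c * Real.log ((n : ℝ) / s + 1) ≤
        ∑ i ∈ Finset.Icc 1 n, (i : ℝ) ^ (r - 1) * ((max i s : ℕ) : ℝ) ^ (-r) ∧
      ∑ i ∈ Finset.Icc 1 n, (i : ℝ) ^ (r - 1) * ((max i s : ℕ) : ℝ) ^ (-r) ≤
        C * Real.log ((n : ℝ) / s + 1) := by
  obtain ⟨c, C, hc, hC, hb⟩ := exists_sum_rpow_bounds hr
  have hlog4 : 0 < Real.log 4 := Real.log_pos (by norm_num)
  refine ⟨min 1 (c / Real.log 4), 2 * C + 1, by positivity, by positivity, fun n s hs hsn => ?_⟩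
  have hs0 : (0 : ℝ) < s := by exact_mod_cast hs
  have hsn' : (s : ℝ) ≤ n := by exact_mod_cast hsn
  have hns : 1 ≤ (n : ℝ) / s := (one_le_div hs0).2 hsn'
  have hL := half_le_log_of_two_le (x := (n : ℝ) / s + 1) (by linarith)
  have e1 : ∑ i ∈ Finset.Icc 1 s, (i : ℝ) ^ (r - 1) * ((max i s : ℕ) : ℝ) ^ (-r) =
      (∑ i ∈ Finset.Icc 1 s, (i : ℝ) ^ (r - 1)) * (s : ℝ) ^ (-r) := by
    rw [Finset.sum_mul]
    refine Finset.sum_congr rfl fun i hi => ?_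
    rw [max_eq_right (Finset.mem_Icc.1 hi).2]
  have e2 : ∑ i ∈ Finset.Ioc s n, (i : ℝ) ^ (r - 1) * ((max i s : ℕ) : ℝ) ^ (-r) =
      ∑ i ∈ Finset.Ioc s n, (i : ℝ)⁻¹ := by
    refine Finset.sum_congr rfl fun i hi => ?_
    have hi' := (Finset.mem_Ioc.1 hi).1
    have hi0 : (0 : ℝ) < i := by exact_mod_cast (by omega : 0 < i)
    rw [max_eq_left hi'.le, ← Real.rpow_add hi0, ← Real.rpow_neg_one]
    congr 1; ring
  have e3 : (s : ℝ) ^ r * (s : ℝ) ^ (-r) = 1 := by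
    rw [← Real.rpow_add hs0]; simp
  have hP : (0 : ℝ) < (s : ℝ) ^ (-r) := by positivity
  rw [sum_Icc_one_split hsn, e1, e2]
  constructor
  · have h1 := mul_le_mul_of_nonneg_right (hb s).1 hP.le
    rw [mul_assoc, e3] at h1
    have h2 := le_sum_Ioc_inv hsn
    have h3 : Real.log ((n : ℝ) / s + 1) ≤ Real.log 4 + Real.log (((n : ℝ) + 1) / (s + 1)) := by
      rw [← Real.log_mul (by norm_num) (by positivity)]
      apply Real.log_le_log (by positivity)
      have hs1 : (1 : ℝ) ≤ s := by exact_mod_cast hs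
      rw [div_add_one hs0.ne', ← mul_div_assoc, div_le_div_iff₀ hs0 (by positivity)]
      nlinarith
    have h4 : 0 ≤ Real.log (((n : ℝ) + 1) / (s + 1)) :=
      Real.log_nonneg ((one_le_div (by positivity)).2 (by linarith))
    have h5 : min 1 (c / Real.log 4) * Real.log 4 ≤ c := by
      have := mul_le_mul_of_nonneg_right (min_le_right 1 (c / Real.log 4)) hlog4.le
      rwa [div_mul_cancel₀ _ hlog4.ne'] at this
    have h6 := mul_le_mul_of_nonneg_right (min_le_left 1 (c / Real.log 4)) h4
    have h7 := mul_le_mul_of_nonneg_left h3 (by positivity : 0 ≤ min 1 (c / Real.log 4))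
    linarith
  · have h1 := mul_le_mul_of_nonneg_right (hb s).2 hP.le
    rw [mul_assoc, e3] at h1
    have h2 := sum_Ioc_inv_le hs hsn
    have h3 : Real.log ((n : ℝ) / s) ≤ Real.log ((n : ℝ) / s + 1) :=
      Real.log_le_log (by positivity) (by linarith)
    nlinarith

/-- A non-increasing non-negative sequence is its own rearrangement. -/
theorem rearr_of_antitone {n : ℕ} {f : ℕ → ℝ} (hf : Antitone f) (hf0 : ∀ i, 0 ≤ f i) {i : ℕ}
    (hi : 1 ≤ i) (hin : i ≤ n) : rearr n (fun j : Fin n => f (j.1 + 1)) i = f i := by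
  have hset : {t : ℝ | 0 ≤ t ∧ ((Finset.univ : Finset (Fin n)).filter
      (fun j => t < |f (j.1 + 1)|)).card ≤ i - 1} = Set.Ici (f i) := by
    ext t
    simp only [Set.mem_ofPred_eq, Set.mem_Ici, abs_of_nonneg (hf0 _)]
    constructor
    · rintro ⟨-, ht⟩
      by_contra! hlt
      have : (Finset.univ : Finset (Fin i)).card ≤
          ((Finset.univ : Finset (Fin n)).filter (fun j => t < f (j.1 + 1))).card := by
        refine Finset.card_le_card_of_injOn (Fin.castLE hin) (fun k _ => ?_)
          (Fin.castLE_injective hin).injOn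
        have : f i ≤ f (k.1 + 1) := hf k.2
        simpa using hlt.trans_le this
      rw [Finset.card_univ, Fintype.card_fin] at this
      omega
    · intro ht
      refine ⟨(hf0 i).trans ht, ?_⟩
      have : ((Finset.univ : Finset (Fin n)).filter (fun j => t < f (j.1 + 1))).card ≤
          (Finset.range (i - 1)).card := by
        refine Finset.card_le_card_of_injOn (fun k => k.1) (fun k hk => ?_)
          Fin.val_injective.injOn
        have hk' : t < f (k.1 + 1) := by simpa using hk
        have : ¬ i ≤ k.1 + 1 := fun h => absurd (hf h) (not_le.2 (ht.trans_lt hk'))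
        simp only [Finset.coe_range, Set.mem_Iio]
        omega
      simpa using this
  unfold rearr
  rw [hset, csInf_Ici]

/-! ### Lorentz norms -/

theorem lorentzNorm_top_le_iff {n : ℕ} {p : ℝ≥0∞} {x : Fin n → ℝ} {M : ℝ} (hM : 0 ≤ M) :
    lorentzNorm n p ⊤ x ≤ M ↔
      ∀ i ∈ Finset.Icc 1 n, (i : ℝ) ^ (1 / p).toReal * rearr n x i ≤ M := by
  rw [lorentzNorm, if_pos rfl]
  have hset : {t : ℝ | ∃ i ∈ Finset.Icc 1 n, t = (i : ℝ) ^ (1 / p).toReal * rearr n x i} =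
      (fun i : ℕ => (i : ℝ) ^ (1 / p).toReal * rearr n x i) '' (Finset.Icc 1 n : Finset ℕ) := by
    ext t; simp [eq_comm]
  constructor
  · intro h i hi
    have hb : BddAbove {t : ℝ | ∃ i ∈ Finset.Icc 1 n,
        t = (i : ℝ) ^ (1 / p).toReal * rearr n x i} := by
      rw [hset]
      exact ((Finset.finite_toSet _).image _).bddAbove
    exact (le_csSup hb ⟨i, hi, rfl⟩).trans h
  · intro h
    refine Real.sSup_le ?_ hM
    rintro _ ⟨i, hi, rfl⟩
    exact h i hi

theorem le_lorentzNorm_top {n : ℕ} {p : ℝ≥0∞} {x : Fin n → ℝ} {i : ℕ} (hi : i ∈ Finset.Icc 1 n) :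
    (i : ℝ) ^ (1 / p).toReal * rearr n x i ≤ lorentzNorm n p ⊤ x := by
  refine (lorentzNorm_top_le_iff ?_).1 le_rfl i hi
  rw [lorentzNorm, if_pos rfl]
  refine Real.sSup_nonneg ?_
  rintro _ ⟨j, -, rfl⟩
  exact mul_nonneg (by positivity) (rearr_nonneg _ _ _)

theorem lorentzNorm_of_ne_top {n : ℕ} {p u : ℝ≥0∞} (hu : u ≠ ⊤) (x : Fin n → ℝ) :
    lorentzNorm n p u x = (∑ i ∈ Finset.Icc 1 n,
      (i : ℝ) ^ (u.toReal * (1 / p).toReal - 1) * rearr n x i ^ u.toReal) ^ (1 / u.toReal) := by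
  rw [lorentzNorm, if_neg hu]
  simp [div_eq_mul_inv]

theorem lorentz_sum_nonneg {n : ℕ} {r t : ℝ} (x : Fin n → ℝ) :
    0 ≤ ∑ i ∈ Finset.Icc 1 n, (i : ℝ) ^ r * rearr n x i ^ t :=
  Finset.sum_nonneg fun i _ =>
    mul_nonneg (by positivity) (Real.rpow_nonneg (rearr_nonneg _ _ _) _)

theorem lorentzNorm_le_iff {n : ℕ} {p u : ℝ≥0∞} (hu0 : 0 < u) (hu : u ≠ ⊤) {x : Fin n → ℝ}
    {M : ℝ} (hM : 0 ≤ M) :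
    lorentzNorm n p u x ≤ M ↔ ∑ i ∈ Finset.Icc 1 n,
      (i : ℝ) ^ (u.toReal * (1 / p).toReal - 1) * rearr n x i ^ u.toReal ≤ M ^ u.toReal := by
  rw [lorentzNorm_of_ne_top hu, one_div u.toReal,
    Real.rpow_inv_le_iff_of_pos (lorentz_sum_nonneg x) hM (ENNReal.toReal_pos hu0.ne' hu)]

theorem le_lorentzNorm_iff {n : ℕ} {p u : ℝ≥0∞} (hu0 : 0 < u) (hu : u ≠ ⊤) {x : Fin n → ℝ}
    {M : ℝ} (hM : 0 ≤ M) :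
    M ≤ lorentzNorm n p u x ↔ M ^ u.toReal ≤ ∑ i ∈ Finset.Icc 1 n,
      (i : ℝ) ^ (u.toReal * (1 / p).toReal - 1) * rearr n x i ^ u.toReal := by
  rw [lorentzNorm_of_ne_top hu, one_div u.toReal,
    Real.le_rpow_inv_iff_of_pos hM (lorentz_sum_nonneg x) (ENNReal.toReal_pos hu0.ne' hu)]

/-- In `ℓ_{p,u}` with `p < ∞`, elements of the unit ball satisfy `x_k^* ≤ K k^{-1/p}`. -/
theorem exists_rearr_le {p u : ℝ≥0∞} (hp0 : 0 < p) (hp : p ≠ ⊤) (hu0 : 0 < u) :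
    ∃ K : ℝ, 0 < K ∧ ∀ (n : ℕ) (x : Fin n → ℝ), lorentzNorm n p u x ≤ 1 →
      ∀ k ∈ Finset.Icc 1 n, rearr n x k ≤ K * (k : ℝ) ^ (-(1 / p).toReal) := by
  have hα : 0 < (1 / p).toReal := by
    simpa using ENNReal.toReal_pos hp0.ne' hp
  by_cases hu : u = ⊤
  · subst hu
    refine ⟨1, one_pos, fun n x hx k hk => ?_⟩
    have hk0 : (0 : ℝ) < k := by exact_mod_cast (Finset.mem_Icc.1 hk).1
    have h := (lorentzNorm_top_le_iff zero_le_one).1 hx k hk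
    rw [one_mul, Real.rpow_neg hk0.le, ← one_div, le_div_iff₀ (by positivity)]
    linarith
  · have hU := ENNReal.toReal_pos hu0.ne' hu
    set U := u.toReal
    set α := (1 / p).toReal
    obtain ⟨c, C, hc, -, hb⟩ := exists_sum_rpow_bounds (mul_pos hU hα)
    refine ⟨(c⁻¹) ^ U⁻¹, by positivity, fun n x hx k hk => ?_⟩
    obtain ⟨hk1, hkn⟩ := Finset.mem_Icc.1 hk
    have hk0 : (0 : ℝ) < k := by exact_mod_cast hk1
    have hak := rearr_nonneg n x k
    have h1 := (lorentzNorm_le_iff hu0 hu zero_le_one).1 hx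
    rw [Real.one_rpow] at h1
    have h2 : (∑ i ∈ Finset.Icc 1 k, (i : ℝ) ^ (U * α - 1)) * rearr n x k ^ U ≤ 1 := by
      rw [Finset.sum_mul]
      refine le_trans (Finset.sum_le_sum fun i hi => ?_) (le_trans
        (Finset.sum_le_sum_of_subset_of_nonneg (Finset.Icc_subset_Icc_right hkn) fun i _ _ => ?_) h1)
      · have := rearr_antitone n x (Finset.mem_Icc.1 hi).2
        gcongr
      · have := rearr_nonneg n x i
        positivity
    have h3 := mul_le_mul_of_nonneg_right (hb k).1 (Real.rpow_nonneg hak U)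
    have h4 : rearr n x k ^ U ≤ c⁻¹ * (k : ℝ) ^ (-(U * α)) := by
      rw [Real.rpow_neg hk0.le, ← mul_inv, ← one_div, le_div_iff₀ (by positivity)]
      linarith
    have h5 : c⁻¹ * (k : ℝ) ^ (-(U * α)) = ((c⁻¹) ^ U⁻¹ * (k : ℝ) ^ (-α)) ^ U := by
      rw [Real.mul_rpow (by positivity) (by positivity), Real.rpow_inv_rpow (by positivity) hU.ne',
        ← Real.rpow_mul hk0.le]
      congr 2; ring
    rw [h5] at h4
    exact (Real.rpow_le_rpow_iff hak (by positivity) hU).1 h4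

/-! ### Truncations -/

theorem rearr_truncation {n s i : ℕ} (x : Fin n → ℝ) (hi : i ∈ Finset.Icc 1 n) :
    rearr n (fun j : Fin n => min (rearr n x s) (rearr n x (j.1 + 1))) i =
      min (rearr n x s) (rearr n x i) :=
  rearr_of_antitone (f := fun k => min (rearr n x s) (rearr n x k))
    (fun _ _ h => min_le_min_left _ (rearr_antitone n x h))
    (fun _ => le_min (rearr_nonneg _ _ _) (rearr_nonneg _ _ _))
    (Finset.mem_Icc.1 hi).1 (Finset.mem_Icc.1 hi).2

theorem truncFunctional_bounds {n s : ℕ} {p u q v : ℝ≥0∞} {a b : ℝ} (hs : 1 ≤ s) (hsn : s ≤ n)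
    {f : ℕ → ℝ} (hf : Antitone f) (hf0 : ∀ i, 0 ≤ f i) (hfs : ∀ i, f i ≤ f s)
    (hf1 : lorentzNorm n p u (fun j : Fin n => f (j.1 + 1)) ≤ 1)
    (ha : a ≤ lorentzNorm n q v (fun j : Fin n => f (j.1 + 1)))
    (hb : ∀ x : Fin n → ℝ, lorentzNorm n p u x ≤ 1 →
      lorentzNorm n q v (fun i : Fin n => min (rearr n x s) (rearr n x (i.1 + 1))) ≤ b) :
    a ≤ truncFunctional n p u q v s ∧ truncFunctional n p u q v s ≤ b := by
  have hub : ∀ t ∈ {t : ℝ | ∃ x : Fin n → ℝ, lorentzNorm n p u x ≤ 1 ∧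
      t = lorentzNorm n q v (fun i : Fin n => min (rearr n x s) (rearr n x (i.1 + 1)))}, t ≤ b := by
    rintro _ ⟨x, hx, rfl⟩
    exact hb x hx
  have hmem : lorentzNorm n q v (fun j : Fin n => f (j.1 + 1)) ∈
      {t : ℝ | ∃ x : Fin n → ℝ, lorentzNorm n p u x ≤ 1 ∧
      t = lorentzNorm n q v (fun i : Fin n => min (rearr n x s) (rearr n x (i.1 + 1)))} := by
    refine ⟨_, hf1, ?_⟩
    congr 1
    funext j
    rw [rearr_of_antitone hf hf0 hs hsn, rearr_of_antitone hf hf0 (by omega) (by omega),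
      min_eq_right (hfs _)]
  exact ⟨ha.trans (le_csSup ⟨b, hub⟩ hmem), csSup_le ⟨_, hmem⟩ hub⟩

/-- The sequence equal to `t` up to index `s` and to `0` afterwards. -/
noncomputable def stepSeq (t : ℝ) (s k : ℕ) : ℝ := if k ≤ s then t else 0

theorem stepSeq_nonneg {t : ℝ} (ht : 0 ≤ t) (s k : ℕ) : 0 ≤ stepSeq t s k := by
  unfold stepSeq; split_ifs <;> linarith

theorem stepSeq_self (t : ℝ) (s : ℕ) : stepSeq t s s = t := if_pos le_rfl

theorem stepSeq_le {t : ℝ} (ht : 0 ≤ t) (s k : ℕ) : stepSeq t s k ≤ stepSeq t s s := by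
  rw [stepSeq_self]; unfold stepSeq; split_ifs <;> linarith

theorem stepSeq_antitone {t : ℝ} (ht : 0 ≤ t) (s : ℕ) : Antitone (stepSeq t s) := by
  intro i j hij
  unfold stepSeq
  split_ifs <;> first | omega | linarith

theorem sum_rearr_stepSeq {n s : ℕ} (hsn : s ≤ n) {t U : ℝ} (ht : 0 ≤ t) (hU : 0 < U) (w : ℕ → ℝ) :
    ∑ i ∈ Finset.Icc 1 n, w i * rearr n (fun j : Fin n => stepSeq t s (j.1 + 1)) i ^ U =
      (∑ i ∈ Finset.Icc 1 s, w i) * t ^ U := by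
  have h : ∀ i ∈ Finset.Icc 1 n, w i * rearr n (fun j : Fin n => stepSeq t s (j.1 + 1)) i ^ U =
      w i * stepSeq t s i ^ U := fun i hi => by
    obtain ⟨h1, h2⟩ := Finset.mem_Icc.1 hi
    rw [rearr_of_antitone (stepSeq_antitone ht s) (stepSeq_nonneg ht s) h1 h2]
  rw [Finset.sum_congr rfl h, sum_Icc_one_split hsn, Finset.sum_mul,
    Finset.sum_eq_zero (s := Finset.Ioc s n), add_zero]
  · refine Finset.sum_congr rfl fun i hi => ?_
    rw [stepSeq, if_pos (Finset.mem_Icc.1 hi).2]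
  · intro i hi
    rw [stepSeq, if_neg (by have := (Finset.mem_Ioc.1 hi).1; omega), Real.zero_rpow hU.ne', mul_zero]

theorem exists_lorentzNorm_stepSeq_le {p u : ℝ≥0∞} (hp0 : 0 < p) (hp : p ≠ ⊤) (hu0 : 0 < u) :
    ∃ K : ℝ, 0 < K ∧ ∀ (n s : ℕ), s ≤ n → ∀ t : ℝ, 0 ≤ t →
      lorentzNorm n p u (fun j : Fin n => stepSeq t s (j.1 + 1)) ≤
        K * ((s : ℝ) ^ (1 / p).toReal * t) := by
  have hα : 0 < (1 / p).toReal := by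
    simpa using ENNReal.toReal_pos hp0.ne' hp
  by_cases hu : u = ⊤
  · subst hu
    refine ⟨1, one_pos, fun n s hsn t ht => ?_⟩
    rw [one_mul, lorentzNorm_top_le_iff (by positivity)]
    intro i hi
    obtain ⟨h1, h2⟩ := Finset.mem_Icc.1 hi
    rw [rearr_of_antitone (stepSeq_antitone ht s) (stepSeq_nonneg ht s) h1 h2, stepSeq]
    split_ifs with h
    · gcongr
    · rw [mul_zero]; positivity
  · have hU := ENNReal.toReal_pos hu0.ne' hu
    obtain ⟨c, C, -, hC, hb⟩ := exists_sum_rpow_bounds (mul_pos hU hα)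
    refine ⟨C ^ (u.toReal)⁻¹, by positivity, fun n s hsn t ht => ?_⟩
    rw [lorentzNorm_le_iff hu0 hu (by positivity), sum_rearr_stepSeq hsn ht hU,
      Real.mul_rpow (by positivity) (by positivity), Real.mul_rpow (by positivity) ht,
      Real.rpow_inv_rpow hC.le hU.ne', ← Real.rpow_mul (by positivity), ← mul_assoc,
      mul_comm (1 / p).toReal]
    exact mul_le_mul_of_nonneg_right (hb s).2 (by positivity)

theorem lorentzNorm_stepSeq_of_top {v : ℝ≥0∞} (hv0 : 0 < v) {n s : ℕ} (hs : 1 ≤ s) (hsn : s ≤ n)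
    {t : ℝ} (ht : 0 ≤ t) :
    lorentzNorm n ⊤ v (fun j : Fin n => stepSeq t s (j.1 + 1)) =
      t * (∑ i ∈ Finset.Icc 1 s, (i : ℝ)⁻¹) ^ (1 / v).toReal := by
  by_cases hv : v = ⊤
  · subst hv
    have hr : ∀ i ∈ Finset.Icc 1 n, rearr n (fun j : Fin n => stepSeq t s (j.1 + 1)) i =
      stepSeq t s i := fun i hi => rearr_of_antitone (stepSeq_antitone ht s) (stepSeq_nonneg ht s)
        (Finset.mem_Icc.1 hi).1 (Finset.mem_Icc.1 hi).2
    have hmem : s ∈ Finset.Icc 1 n := Finset.mem_Icc.2 ⟨hs, hsn⟩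
    simp only [ENNReal.div_top, ENNReal.toReal_zero, Real.rpow_zero, mul_one]
    refine le_antisymm ((lorentzNorm_top_le_iff ht).2 fun i hi => ?_) ?_
    · simpa [hr i hi, stepSeq_self] using stepSeq_le ht s i
    · simpa [hr s hmem, stepSeq_self] using le_lorentzNorm_top (p := ⊤)
        (x := fun j : Fin n => stepSeq t s (j.1 + 1)) hmem
  · have hV := ENNReal.toReal_pos hv0.ne' hv
    rw [lorentzNorm_of_ne_top hv, sum_rearr_stepSeq hsn ht hV,
      Real.mul_rpow (Finset.sum_nonneg fun i _ => by positivity) (by positivity), one_div v.toReal,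
      Real.rpow_rpow_inv ht hV.ne', mul_comm]
    simp [Real.rpow_neg_one]

theorem exists_truncation_le {p u : ℝ≥0∞} (hp0 : 0 < p) (hp : p ≠ ⊤) (hu0 : 0 < u) :
    ∃ K : ℝ, 0 < K ∧ ∀ (n s : ℕ) (x : Fin n → ℝ), 1 ≤ s → s ≤ n → lorentzNorm n p u x ≤ 1 →
      ∀ i ∈ Finset.Icc 1 n, rearr n
        (fun j : Fin n => min (rearr n x s) (rearr n x (j.1 + 1))) i ≤
          K * ((max i s : ℕ) : ℝ) ^ (-(1 / p).toReal) := by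
  obtain ⟨K, hK, h⟩ := exists_rearr_le hp0 hp hu0
  refine ⟨K, hK, fun n s x hs hsn hx i hi => ?_⟩
  rw [rearr_truncation x hi]
  rcases le_total i s with his | his
  · rw [max_eq_right his]
    exact (min_le_left _ _).trans (h n x hx s (Finset.mem_Icc.2 ⟨hs, hsn⟩))
  · rw [max_eq_left his]
    exact (min_le_right _ _).trans (h n x hx i hi)

/-! ### The three regimes -/

theorem log_succ_pos {s : ℕ} (hs : 1 ≤ s) : 0 < Real.log ((s : ℝ) + 1) := by
  have : (1 : ℝ) ≤ s := by exact_mod_cast hs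
  exact Real.log_pos (by linarith)

theorem exists_truncFunctional_bounds_of_target_top {p u v : ℝ≥0∞} (hp0 : 0 < p) (hp : p ≠ ⊤)
    (hu0 : 0 < u) (hv0 : 0 < v) :
    ∃ c C : ℝ, 0 < c ∧ 0 < C ∧ ∀ n s : ℕ, 1 ≤ s → s ≤ n →
      c * ((s : ℝ) ^ (-(1 / p).toReal) * Real.log ((s : ℝ) + 1) ^ (1 / v).toReal) ≤
          truncFunctional n p u ⊤ v s ∧
        truncFunctional n p u ⊤ v s ≤
          C * ((s : ℝ) ^ (-(1 / p).toReal) * Real.log ((s : ℝ) + 1) ^ (1 / v).toReal) := by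
  obtain ⟨K, hK, hstep⟩ := exists_lorentzNorm_stepSeq_le hp0 hp hu0
  obtain ⟨A, hA, htr⟩ := exists_truncation_le hp0 hp hu0
  have hα : 0 < (1 / p).toReal := by
    simpa using ENNReal.toReal_pos hp0.ne' hp
  set α := (1 / p).toReal
  have hupper : ∃ C : ℝ, 0 < C ∧ ∀ n s : ℕ, 1 ≤ s → s ≤ n → ∀ x : Fin n → ℝ,
      lorentzNorm n p u x ≤ 1 →
      lorentzNorm n ⊤ v (fun i : Fin n => min (rearr n x s) (rearr n x (i.1 + 1))) ≤
        C * ((s : ℝ) ^ (-α) * Real.log ((s : ℝ) + 1) ^ (1 / v).toReal) := by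
    by_cases hv : v = ⊤
    · subst hv
      refine ⟨A, hA, fun n s hs hsn x hx => ?_⟩
      have hs0 : (0 : ℝ) < s := by exact_mod_cast hs
      simp only [ENNReal.div_top, ENNReal.toReal_zero, Real.rpow_zero, mul_one]
      rw [lorentzNorm_top_le_iff (by positivity)]
      intro i hi
      simp only [ENNReal.div_top, ENNReal.toReal_zero, Real.rpow_zero, one_mul]
      refine (htr n s x hs hsn hx i hi).trans ?_
      gcongr ?_ * ?_
      exact Real.rpow_le_rpow_of_nonpos hs0 (by exact_mod_cast le_max_right _ _) (by linarith)
    · have hV := ENNReal.toReal_pos hv0.ne' hv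
      set V := v.toReal
      have hVα := mul_pos hV hα
      refine ⟨A * (3 + 2 * (V * α)⁻¹) ^ V⁻¹, by positivity, fun n s hs hsn x hx => ?_⟩
      have hL := half_le_log_of_two_le (x := (s : ℝ) + 1)
        (by have : (1 : ℝ) ≤ s := by exact_mod_cast hs
            linarith)
      have hs0 : (0 : ℝ) < s := by exact_mod_cast hs
      set L := Real.log ((s : ℝ) + 1)
      have hL0 : 0 < L := by linarith
      have hv1 : (1 / v).toReal = V⁻¹ := by simp [V]
      rw [lorentzNorm_le_iff hv0 hv (by positivity), hv1]
      have hrhs : (A * (3 + 2 * (V * α)⁻¹) ^ V⁻¹ * ((s : ℝ) ^ (-α) * L ^ V⁻¹)) ^ V =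
          A ^ V * ((3 + 2 * (V * α)⁻¹) * L * (s : ℝ) ^ (-(V * α))) := by
        rw [Real.mul_rpow (by positivity) (by positivity),
          Real.mul_rpow (by positivity) (by positivity),
          Real.mul_rpow (by positivity) (by positivity),
          Real.rpow_inv_rpow (by positivity) hV.ne', Real.rpow_inv_rpow (by positivity) hV.ne',
          ← Real.rpow_mul hs0.le, show -α * V = -(V * α) by ring]
        ring
      rw [hrhs]
      have hterm : ∀ i ∈ Finset.Icc 1 n, (i : ℝ) ^ (v.toReal * (1 / (⊤ : ℝ≥0∞)).toReal - 1) *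
          rearr n (fun j : Fin n => min (rearr n x s) (rearr n x (j.1 + 1))) i ^ v.toReal ≤
          A ^ V * ((i : ℝ)⁻¹ * ((max i s : ℕ) : ℝ) ^ (-(V * α))) := fun i hi => by
        have h1 := Real.rpow_le_rpow (rearr_nonneg _ _ _) (htr n s x hs hsn hx i hi) hV.le
        rw [Real.mul_rpow hA.le (by positivity), ← Real.rpow_mul (by positivity),
          show -α * V = -(V * α) by ring] at h1
        simp only [ENNReal.div_top, ENNReal.toReal_zero, mul_zero, zero_sub, Real.rpow_neg_one]
        have h2 := mul_le_mul_of_nonneg_left h1 (by positivity : 0 ≤ (i : ℝ)⁻¹)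
        linarith
      refine (Finset.sum_le_sum hterm).trans ?_
      rw [← Finset.mul_sum]
      refine mul_le_mul_of_nonneg_left ?_ (by positivity)
      rw [sum_Icc_one_split hsn]
      have e1 : ∑ i ∈ Finset.Icc 1 s, (i : ℝ)⁻¹ * ((max i s : ℕ) : ℝ) ^ (-(V * α)) =
          (∑ i ∈ Finset.Icc 1 s, (i : ℝ)⁻¹) * (s : ℝ) ^ (-(V * α)) := by
        rw [Finset.sum_mul]
        refine Finset.sum_congr rfl fun i hi => ?_
        rw [max_eq_right (Finset.mem_Icc.1 hi).2]
      have e2 : ∑ i ∈ Finset.Ioc s n, (i : ℝ)⁻¹ * ((max i s : ℕ) : ℝ) ^ (-(V * α)) =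
          ∑ i ∈ Finset.Ioc s n, (i : ℝ) ^ (-(V * α) - 1) := by
        refine Finset.sum_congr rfl fun i hi => ?_
        have hi' := (Finset.mem_Ioc.1 hi).1
        have hi0 : (0 : ℝ) < i := by exact_mod_cast (by omega : 0 < i)
        rw [max_eq_left hi'.le, Real.rpow_sub_one hi0.ne', div_eq_mul_inv, mul_comm]
      rw [e1, e2]
      have hP : (0 : ℝ) < (s : ℝ) ^ (-(V * α)) := by positivity
      have h1 := mul_le_mul_of_nonneg_right (sum_inv_le_log_succ hs) hP.le
      have h2 := sum_Ioc_rpow_le hVα hs hsn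
      have h3 : (V * α)⁻¹ * (s : ℝ) ^ (-(V * α)) ≤ 2 * (V * α)⁻¹ * L * (s : ℝ) ^ (-(V * α)) := by
        refine mul_le_mul_of_nonneg_right ?_ hP.le
        have : 0 < (V * α)⁻¹ := by positivity
        nlinarith
      linarith
  obtain ⟨C, hC, hupper⟩ := hupper
  refine ⟨K⁻¹, C, by positivity, hC, fun n s hs hsn => ?_⟩
  have hs0 : (0 : ℝ) < s := by exact_mod_cast hs
  have ht : 0 ≤ K⁻¹ * (s : ℝ) ^ (-α) := by positivity
  refine truncFunctional_bounds hs hsn (stepSeq_antitone ht s) (stepSeq_nonneg ht s)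
    (stepSeq_le ht s) ?_ ?_ (hupper n s hs hsn)
  · refine (hstep n s hsn _ ht).trans (le_of_eq ?_)
    rw [Real.rpow_neg hs0.le]
    field_simp
  · rw [lorentzNorm_stepSeq_of_top hv0 hs hsn ht, ← mul_assoc]
    have := (log_succ_pos hs).le
    gcongr
    exact log_succ_le_sum_inv s

theorem exists_truncFunctional_bounds_of_top {u v : ℝ≥0∞} (hu0 : 0 < u) (huv : u < v) :
    ∃ c C : ℝ, 0 < c ∧ 0 < C ∧ ∀ n s : ℕ, 1 ≤ s → s ≤ n →
      c * Real.log ((s : ℝ) + 1) ^ ((1 / v).toReal - (1 / u).toReal) ≤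
          truncFunctional n ⊤ u ⊤ v s ∧
        truncFunctional n ⊤ u ⊤ v s ≤
          C * Real.log ((s : ℝ) + 1) ^ ((1 / v).toReal - (1 / u).toReal) := by
  have hu : u ≠ ⊤ := (huv.trans_le le_top).ne
  have hv0 : 0 < v := hu0.trans huv
  have hU := ENNReal.toReal_pos hu0.ne' hu
  set U := u.toReal
  have hu1 : (1 / u).toReal = U⁻¹ := by simp [U]
  set w := (1 / v).toReal
  have hwu : w - U⁻¹ ≤ 0 := by
    rw [← hu1, sub_nonpos]
    exact ENNReal.toReal_mono (by simp [hu0.ne']) (ENNReal.div_le_div_left huv.le 1)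
  rw [hu1]
  refine ⟨3 ^ (w - U⁻¹), 1, by positivity, one_pos, fun n s hs hsn => ?_⟩
  have hL := log_succ_pos hs
  have hH := log_succ_le_sum_inv s
  have hH3 := sum_inv_le_log_succ hs
  set H := ∑ i ∈ Finset.Icc 1 s, (i : ℝ)⁻¹ with hHdef
  have hH0 : 0 < H := hL.trans_le hH
  have ht : 0 ≤ H ^ (-U⁻¹) := by positivity
  refine truncFunctional_bounds hs hsn (stepSeq_antitone ht s) (stepSeq_nonneg ht s)
    (stepSeq_le ht s) ?_ ?_ fun x hx => ?_
  · rw [lorentzNorm_stepSeq_of_top hu0 hs hsn ht, hu1, ← hHdef, ← Real.rpow_add hH0]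
    simp
  · rw [lorentzNorm_stepSeq_of_top hv0 hs hsn ht, ← hHdef, ← Real.rpow_add hH0,
      ← Real.mul_rpow (by norm_num) hL.le, neg_add_eq_sub]
    exact Real.rpow_le_rpow_of_nonpos hH0 hH3 hwu
  · rw [one_mul]
    refine le_trans ?_ (Real.rpow_le_rpow_of_nonpos hL hH hwu)
    have h1 := (lorentzNorm_le_iff hu0 hu zero_le_one).1 hx
    simp only [ENNReal.div_top, ENNReal.toReal_zero, mul_zero, zero_sub, Real.rpow_neg_one,
      Real.one_rpow] at h1
    have has := rearr_nonneg n x s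
    have h2 : H * rearr n x s ^ U ≤ 1 := by
      rw [hHdef, Finset.sum_mul]
      refine le_trans (Finset.sum_le_sum fun i hi => ?_) (le_trans
        (Finset.sum_le_sum_of_subset_of_nonneg (Finset.Icc_subset_Icc_right hsn) fun i _ _ => ?_) h1)
      · have := rearr_antitone n x (Finset.mem_Icc.1 hi).2
        gcongr
      · have := rearr_nonneg n x i
        positivity
    have h3 : rearr n x s ≤ H ^ (-U⁻¹) := by
      rw [← Real.rpow_le_rpow_iff has (by positivity) hU, ← Real.rpow_mul hH0.le,
        neg_mul, inv_mul_cancel₀ hU.ne', Real.rpow_neg_one, ← one_div, le_div_iff₀ hH0]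
      linarith
    by_cases hv : v = ⊤
    · have hw : w = 0 := by simp [w, hv]
      rw [hw, zero_sub, hv, lorentzNorm_top_le_iff (by positivity)]
      intro i hi
      simpa [rearr_truncation x hi] using Or.inl h3
    · have hV := ENNReal.toReal_pos hv0.ne' hv
      have hw : w = v.toReal⁻¹ := by simp [w]
      have hUV : U < v.toReal := (ENNReal.toReal_lt_toReal hu hv).2 huv
      set V := v.toReal
      rw [lorentzNorm_le_iff hv0 hv (by positivity), hw, ← Real.rpow_mul hH0.le]
      simp only [ENNReal.div_top, ENNReal.toReal_zero, mul_zero, zero_sub, Real.rpow_neg_one]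
      have hterm : ∀ i ∈ Finset.Icc 1 n, (i : ℝ)⁻¹ * rearr n
          (fun j : Fin n => min (rearr n x s) (rearr n x (j.1 + 1))) i ^ V ≤
          (H ^ (-U⁻¹)) ^ (V - U) * ((i : ℝ)⁻¹ * rearr n x i ^ U) := fun i hi => by
        have hai := rearr_nonneg n x i
        have hm : 0 ≤ min (rearr n x s) (rearr n x i) := le_min has hai
        rw [rearr_truncation x hi, mul_left_comm]
        refine mul_le_mul_of_nonneg_left ?_ (by positivity)
        calc min (rearr n x s) (rearr n x i) ^ V
            = min (rearr n x s) (rearr n x i) ^ (V - U) * min (rearr n x s) (rearr n x i) ^ U := by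
              rw [← Real.rpow_add_of_nonneg hm (by linarith) hU.le, sub_add_cancel]
          _ ≤ _ := by
              have := (min_le_left (rearr n x s) (rearr n x i)).trans h3
              have := min_le_right (rearr n x s) (rearr n x i)
              have : 0 ≤ V - U := by linarith
              gcongr
      refine (Finset.sum_le_sum hterm).trans ?_
      rw [← Finset.mul_sum]
      refine (mul_le_of_le_one_right (by positivity) h1).trans (le_of_eq ?_)
      rw [← Real.rpow_mul hH0.le]
      congr 1
      field_simp
      ring

/-- Hölder bound for the tail of an `ℓ_{p,v}`-norm on the unit ball of `ℓ_{p,u}`, `v < u`. -/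
theorem exists_sum_Ioc_rearr_le {p u v : ℝ≥0∞} (hp0 : 0 < p) (hp : p ≠ ⊤) (hv0 : 0 < v)
    (hvu : v < u) :
    ∃ C : ℝ, 0 < C ∧ ∀ n s : ℕ, 1 ≤ s → s ≤ n → ∀ x : Fin n → ℝ, lorentzNorm n p u x ≤ 1 →
      ∑ i ∈ Finset.Ioc s n, (i : ℝ) ^ (v.toReal * (1 / p).toReal - 1) * rearr n x i ^ v.toReal ≤
        C * Real.log ((n : ℝ) / s + 1) ^ (1 - v.toReal * (1 / u).toReal) := by
  have hv : v ≠ ⊤ := (hvu.trans_le le_top).ne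
  have hu0 : 0 < u := hv0.trans hvu
  have hV := ENNReal.toReal_pos hv0.ne' hv
  set V := v.toReal
  set α := (1 / p).toReal
  have hsum (n s : ℕ) (hs : 1 ≤ s) (hsn : s ≤ n) :
      ∑ i ∈ Finset.Ioc s n, (i : ℝ)⁻¹ ≤ Real.log ((n : ℝ) / s + 1) := by
    have hs0 : (0 : ℝ) < s := by exact_mod_cast hs
    have hn0 : (0 : ℝ) < n := by exact_mod_cast hs.trans hsn
    exact (sum_Ioc_inv_le hs hsn).trans (Real.log_le_log (by positivity) (by linarith))
  by_cases hu : u = ⊤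
  · obtain ⟨K, hK, h⟩ := exists_rearr_le hp0 hp hu0
    refine ⟨K ^ V, by positivity, fun n s hs hsn x hx => ?_⟩
    simp only [hu, ENNReal.div_top, ENNReal.toReal_zero, mul_zero, sub_zero, Real.rpow_one]
    refine le_trans ?_ (mul_le_mul_of_nonneg_left (hsum n s hs hsn) (by positivity))
    rw [Finset.mul_sum]
    refine Finset.sum_le_sum fun i hi => ?_
    obtain ⟨h1, h2⟩ := Finset.mem_Ioc.1 hi
    have hi0 : (0 : ℝ) < i := by exact_mod_cast (by omega : 0 < i)
    have h3 := Real.rpow_le_rpow (rearr_nonneg _ _ _)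
      (h n x hx i (Finset.mem_Icc.2 ⟨by omega, h2⟩)) hV.le
    refine (mul_le_mul_of_nonneg_left h3 (by positivity)).trans (le_of_eq ?_)
    rw [Real.mul_rpow hK.le (by positivity), ← Real.rpow_mul hi0.le, mul_left_comm,
      ← Real.rpow_add hi0, ← Real.rpow_neg_one]
    congr 2
    ring
  · have hU := ENNReal.toReal_pos hu0.ne' hu
    have hVU : V < u.toReal := (ENNReal.toReal_lt_toReal hv hu).2 hvu
    refine ⟨1, one_pos, fun n s hs hsn x hx => ?_⟩
    have hu1 : (1 / u).toReal = u.toReal⁻¹ := by simp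
    rw [hu1, one_mul]
    have h1 := (lorentzNorm_le_iff hu0 hu zero_le_one).1 hx
    rw [Real.one_rpow] at h1
    set U := u.toReal
    have hθ : 0 < 1 - V * U⁻¹ := by
      rw [sub_pos, ← div_eq_mul_inv, div_lt_one hU]; exact hVU
    have hconj : ((1 - V * U⁻¹)⁻¹).HolderConjugate (V * U⁻¹)⁻¹ := by
      rw [Real.holderConjugate_iff]
      refine ⟨(one_lt_inv₀ hθ).2 (by have : 0 < V * U⁻¹ := by positivity
                                     linarith), ?_⟩
      rw [inv_inv, inv_inv]; ring
    have hH := Real.inner_le_Lp_mul_Lq_of_nonneg (s := Finset.Ioc s n)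
      (f := fun i : ℕ => (i : ℝ) ^ (-(1 - V * U⁻¹)))
      (g := fun i : ℕ => (i : ℝ) ^ (V * α - V * U⁻¹) * rearr n x i ^ V) hconj
      (fun i _ => by positivity)
      (fun i _ => mul_nonneg (by positivity) (Real.rpow_nonneg (rearr_nonneg _ _ _) _))
    have e1 : ∑ i ∈ Finset.Ioc s n, (i : ℝ) ^ (-(1 - V * U⁻¹)) *
        ((i : ℝ) ^ (V * α - V * U⁻¹) * rearr n x i ^ V) =
        ∑ i ∈ Finset.Ioc s n, (i : ℝ) ^ (V * α - 1) * rearr n x i ^ V := by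
      refine Finset.sum_congr rfl fun i hi => ?_
      have hi0 : (0 : ℝ) < i := by
        exact_mod_cast (by have := (Finset.mem_Ioc.1 hi).1; omega : 0 < i)
      rw [← mul_assoc, ← Real.rpow_add hi0]
      congr 2
      ring
    have e2 : ∑ i ∈ Finset.Ioc s n, ((i : ℝ) ^ (-(1 - V * U⁻¹))) ^ (1 - V * U⁻¹)⁻¹ =
        ∑ i ∈ Finset.Ioc s n, (i : ℝ)⁻¹ := by
      refine Finset.sum_congr rfl fun i _ => ?_
      rw [← Real.rpow_mul (by positivity), neg_mul, mul_inv_cancel₀ hθ.ne', Real.rpow_neg_one]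
    have e3 : ∑ i ∈ Finset.Ioc s n,
        ((i : ℝ) ^ (V * α - V * U⁻¹) * rearr n x i ^ V) ^ (V * U⁻¹)⁻¹ =
        ∑ i ∈ Finset.Ioc s n, (i : ℝ) ^ (U * α - 1) * rearr n x i ^ U := by
      refine Finset.sum_congr rfl fun i _ => ?_
      have hai := rearr_nonneg n x i
      rw [Real.mul_rpow (by positivity) (by positivity), ← Real.rpow_mul (by positivity),
        ← Real.rpow_mul hai]
      congr 2 <;> field_simp
    rw [e1, e2, e3, one_div, one_div, inv_inv, inv_inv] at hH
    have h0 (i : ℕ) : 0 ≤ (i : ℝ) ^ (U * α - 1) * rearr n x i ^ U :=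
      mul_nonneg (by positivity) (Real.rpow_nonneg (rearr_nonneg _ _ _) _)
    have h2 : ∑ i ∈ Finset.Ioc s n, (i : ℝ) ^ (U * α - 1) * rearr n x i ^ U ≤ 1 :=
      (Finset.sum_le_sum_of_subset_of_nonneg (fun i hi => by
        rw [Finset.mem_Ioc] at hi; rw [Finset.mem_Icc]; omega) fun i _ _ => h0 i).trans h1
    refine hH.trans ((mul_le_of_le_one_right (by positivity)
      (Real.rpow_le_one (Finset.sum_nonneg fun i _ => h0 i) h2 (by positivity))).trans ?_)
    exact Real.rpow_le_rpow (Finset.sum_nonneg fun i _ => by positivity) (hsum n s hs hsn) hθ.le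

/-- The sequence `k ↦ t max(k,s)^{-α}`. -/
noncomputable def powSeq (t α : ℝ) (s k : ℕ) : ℝ := t * ((max k s : ℕ) : ℝ) ^ (-α)

theorem powSeq_nonneg {t : ℝ} (ht : 0 ≤ t) (α : ℝ) (s k : ℕ) : 0 ≤ powSeq t α s k := by
  unfold powSeq; positivity

theorem powSeq_antitone {t α : ℝ} (ht : 0 ≤ t) (hα : 0 ≤ α) {s : ℕ} (hs : 1 ≤ s) :
    Antitone (powSeq t α s) := by
  intro i j hij
  refine mul_le_mul_of_nonneg_left (Real.rpow_le_rpow_of_nonpos ?_ ?_ (by linarith)) ht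
  · exact_mod_cast (by omega : 0 < max i s)
  · exact_mod_cast max_le_max_right s hij

theorem powSeq_le {t α : ℝ} (ht : 0 ≤ t) (hα : 0 ≤ α) {s : ℕ} (hs : 1 ≤ s) (k : ℕ) :
    powSeq t α s k ≤ powSeq t α s s := by
  rcases le_total k s with h | h
  · simp [powSeq, max_eq_right h]
  · exact powSeq_antitone ht hα hs h

theorem sum_rearr_powSeq {n s : ℕ} {t α U : ℝ} (hs : 1 ≤ s) (ht : 0 ≤ t) (hα : 0 ≤ α)
    (w : ℕ → ℝ) :
    ∑ i ∈ Finset.Icc 1 n, w i * rearr n (fun j : Fin n => powSeq t α s (j.1 + 1)) i ^ U =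
      t ^ U * ∑ i ∈ Finset.Icc 1 n, w i * ((max i s : ℕ) : ℝ) ^ (-(U * α)) := by
  rw [Finset.mul_sum]
  refine Finset.sum_congr rfl fun i hi => ?_
  obtain ⟨h1, h2⟩ := Finset.mem_Icc.1 hi
  rw [rearr_of_antitone (powSeq_antitone ht hα hs) (powSeq_nonneg ht α s) h1 h2, powSeq,
    Real.mul_rpow ht (by positivity), ← Real.rpow_mul (by positivity), mul_left_comm]
  congr 3
  ring

theorem exists_lorentzNorm_powSeq_le {p u : ℝ≥0∞} (hp0 : 0 < p) (hp : p ≠ ⊤) (hu0 : 0 < u) :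
    ∃ K : ℝ, 0 < K ∧ ∀ n s : ℕ, 1 ≤ s → s ≤ n → ∀ t : ℝ, 0 ≤ t →
      lorentzNorm n p u (fun j : Fin n => powSeq t (1 / p).toReal s (j.1 + 1)) ≤
        K * (t * Real.log ((n : ℝ) / s + 1) ^ (1 / u).toReal) := by
  have hα : 0 < (1 / p).toReal := by
    simpa using ENNReal.toReal_pos hp0.ne' hp
  by_cases hu : u = ⊤
  · subst hu
    refine ⟨1, one_pos, fun n s hs hsn t ht => ?_⟩
    simp only [ENNReal.div_top, ENNReal.toReal_zero, Real.rpow_zero, mul_one, one_mul]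
    rw [lorentzNorm_top_le_iff ht]
    intro i hi
    obtain ⟨h1, h2⟩ := Finset.mem_Icc.1 hi
    have hm0 : (0 : ℝ) < (max i s : ℕ) := by exact_mod_cast (by omega : 0 < max i s)
    rw [rearr_of_antitone (powSeq_antitone ht hα.le hs) (powSeq_nonneg ht _ s) h1 h2, powSeq,
      mul_left_comm]
    refine mul_le_of_le_one_right ht ?_
    rw [Real.rpow_neg hm0.le, ← div_eq_mul_inv, div_le_one (by positivity)]
    exact Real.rpow_le_rpow (by positivity) (by exact_mod_cast le_max_left i s) hα.le
  · have hU := ENNReal.toReal_pos hu0.ne' hu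
    obtain ⟨c, C, -, hC, hb⟩ := exists_sum_rpow_mul_max_bounds (mul_pos hU hα)
    refine ⟨C ^ (u.toReal)⁻¹, by positivity, fun n s hs hsn t ht => ?_⟩
    have hL : 0 ≤ Real.log ((n : ℝ) / s + 1) := Real.log_nonneg (by
      have : 0 ≤ (n : ℝ) / s := by positivity
      linarith)
    have hu1 : (1 / u).toReal = u.toReal⁻¹ := by simp
    rw [lorentzNorm_le_iff hu0 hu (by positivity), sum_rearr_powSeq hs ht hα.le, hu1,
      Real.mul_rpow (by positivity) (by positivity), Real.mul_rpow ht (by positivity),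
      Real.rpow_inv_rpow hC.le hU.ne', Real.rpow_inv_rpow hL hU.ne', mul_left_comm]
    exact mul_le_mul_of_nonneg_left (hb n s hs hsn).2 (by positivity)

theorem exists_le_lorentzNorm_powSeq {p v : ℝ≥0∞} (hp0 : 0 < p) (hp : p ≠ ⊤) (hv0 : 0 < v)
    (hv : v ≠ ⊤) :
    ∃ K : ℝ, 0 < K ∧ ∀ n s : ℕ, 1 ≤ s → s ≤ n → ∀ t : ℝ, 0 ≤ t →
      K * (t * Real.log ((n : ℝ) / s + 1) ^ (1 / v).toReal) ≤
        lorentzNorm n p v (fun j : Fin n => powSeq t (1 / p).toReal s (j.1 + 1)) := by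
  have hα : 0 < (1 / p).toReal := by
    simpa using ENNReal.toReal_pos hp0.ne' hp
  have hV := ENNReal.toReal_pos hv0.ne' hv
  obtain ⟨c, C, hc, -, hb⟩ := exists_sum_rpow_mul_max_bounds (mul_pos hV hα)
  refine ⟨c ^ (v.toReal)⁻¹, by positivity, fun n s hs hsn t ht => ?_⟩
  have hL : 0 ≤ Real.log ((n : ℝ) / s + 1) := Real.log_nonneg (by
    have : 0 ≤ (n : ℝ) / s := by positivity
    linarith)
  have hv1 : (1 / v).toReal = v.toReal⁻¹ := by simp
  rw [le_lorentzNorm_iff hv0 hv (by positivity), sum_rearr_powSeq hs ht hα.le, hv1,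
    Real.mul_rpow (by positivity) (by positivity), Real.mul_rpow ht (by positivity),
    Real.rpow_inv_rpow hc.le hV.ne', Real.rpow_inv_rpow hL hV.ne', mul_left_comm]
  exact mul_le_mul_of_nonneg_left (hb n s hs hsn).1 (by positivity)

theorem exists_truncFunctional_bounds_of_eq {p u v : ℝ≥0∞} (hp0 : 0 < p) (hp : p ≠ ⊤)
    (hv0 : 0 < v) (hvu : v < u) :
    ∃ c C : ℝ, 0 < c ∧ 0 < C ∧ ∀ n s : ℕ, 1 ≤ s → s ≤ n →
      c * Real.log ((n : ℝ) / s + 1) ^ ((1 / v).toReal - (1 / u).toReal) ≤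
          truncFunctional n p u p v s ∧
        truncFunctional n p u p v s ≤
          C * Real.log ((n : ℝ) / s + 1) ^ ((1 / v).toReal - (1 / u).toReal) := by
  have hv : v ≠ ⊤ := (hvu.trans_le le_top).ne
  have hu0 : 0 < u := hv0.trans hvu
  have hα : 0 < (1 / p).toReal := by
    simpa using ENNReal.toReal_pos hp0.ne' hp
  have hV := ENNReal.toReal_pos hv0.ne' hv
  obtain ⟨K, hK, hnorm⟩ := exists_lorentzNorm_powSeq_le hp0 hp hu0
  obtain ⟨k, hk, hlow⟩ := exists_le_lorentzNorm_powSeq hp0 hp hv0 hv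
  obtain ⟨A, hA, hdecay⟩ := exists_rearr_le hp0 hp hu0
  obtain ⟨B, hB, htail⟩ := exists_sum_Ioc_rearr_le hp0 hp hv0 hvu
  obtain ⟨_, D, -, hD, hsum⟩ := exists_sum_rpow_bounds (mul_pos hV hα)
  have hv1 : (1 / v).toReal = v.toReal⁻¹ := by simp
  have hwu : 0 ≤ v.toReal⁻¹ - (1 / u).toReal := by
    rw [← hv1, sub_nonneg]
    exact ENNReal.toReal_mono (by simp [hv0.ne']) (ENNReal.div_le_div_left hvu.le 1)
  rw [hv1]
  rw [hv1] at hlow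
  set V := v.toReal
  set α := (1 / p).toReal
  set w := (1 / u).toReal
  have hθ : (V⁻¹ - w) * V = 1 - V * w := by field_simp
  have hθ0 : 0 ≤ 1 - V * w := by rw [← hθ]; positivity
  refine ⟨k * K⁻¹, (A ^ V * D * 2 ^ (1 - V * w) + B) ^ V⁻¹, by positivity, by positivity,
    fun n s hs hsn => ?_⟩
  have hs0 : (0 : ℝ) < s := by exact_mod_cast hs
  have hL := half_le_log_of_two_le (x := (n : ℝ) / s + 1) (by
    have : 1 ≤ (n : ℝ) / s := (one_le_div hs0).2 (by exact_mod_cast hsn)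
    linarith)
  specialize hnorm n s hs hsn
  specialize hlow n s hs hsn
  specialize htail n s hs hsn
  set L := Real.log ((n : ℝ) / s + 1)
  have hL0 : 0 < L := by linarith
  have ht : 0 ≤ K⁻¹ * L ^ (-w) := by positivity
  refine truncFunctional_bounds hs hsn (powSeq_antitone ht hα.le hs) (powSeq_nonneg ht α s)
    (powSeq_le ht hα.le hs) ?_ ?_ fun x hx => ?_
  · refine (hnorm _ ht).trans (le_of_eq ?_)
    rw [Real.rpow_neg hL0.le]
    field_simp
  · refine le_trans (le_of_eq ?_) (hlow _ ht)
    rw [sub_eq_add_neg, Real.rpow_add hL0]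
    ring
  · rw [lorentzNorm_le_iff hv0 hv (by positivity), Real.mul_rpow (by positivity) (by positivity),
      Real.rpow_inv_rpow (by positivity) hV.ne', ← Real.rpow_mul hL0.le, hθ,
      sum_Icc_one_split hsn, add_mul]
    refine add_le_add ?_ (le_trans (Finset.sum_le_sum fun i hi => ?_) (htail x hx))
    · have hss := hdecay n x hx s (Finset.mem_Icc.2 ⟨hs, hsn⟩)
      have h1 : ∑ i ∈ Finset.Icc 1 s, (i : ℝ) ^ (V * α - 1) *
          rearr n (fun j : Fin n => min (rearr n x s) (rearr n x (j.1 + 1))) i ^ V ≤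
          (∑ i ∈ Finset.Icc 1 s, (i : ℝ) ^ (V * α - 1)) * (A ^ V * (s : ℝ) ^ (-(V * α))) := by
        rw [Finset.sum_mul]
        refine Finset.sum_le_sum fun i hi => ?_
        obtain ⟨hi1, hi2⟩ := Finset.mem_Icc.1 hi
        refine mul_le_mul_of_nonneg_left ?_ (by positivity)
        have h2 := Real.rpow_le_rpow (rearr_nonneg _ _ _) ((rearr_truncation x
          (Finset.mem_Icc.2 ⟨hi1, hi2.trans hsn⟩)).trans_le ((min_le_left _ _).trans hss)) hV.le
        rwa [Real.mul_rpow hA.le (by positivity), ← Real.rpow_mul hs0.le,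
          show -α * V = -(V * α) by ring] at h2
      have h2 := mul_le_mul_of_nonneg_right (hsum s).2
        (by positivity : 0 ≤ A ^ V * (s : ℝ) ^ (-(V * α)))
      have h3 : D * (s : ℝ) ^ (V * α) * (A ^ V * (s : ℝ) ^ (-(V * α))) = A ^ V * D := by
        rw [Real.rpow_neg hs0.le]
        field_simp
      have h4 : 1 ≤ 2 ^ (1 - V * w) * L ^ (1 - V * w) := by
        rw [← Real.mul_rpow (by norm_num) hL0.le]
        exact Real.one_le_rpow (by linarith) hθ0
      have h5 := mul_le_mul_of_nonneg_left h4 (by positivity : 0 ≤ A ^ V * D)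
      linarith
    · obtain ⟨hi1, hi2⟩ := Finset.mem_Ioc.1 hi
      rw [rearr_truncation x (Finset.mem_Icc.2 ⟨by omega, hi2⟩)]
      refine mul_le_mul_of_nonneg_left (Real.rpow_le_rpow (le_min (rearr_nonneg _ _ _)
        (rearr_nonneg _ _ _)) (min_le_right _ _) hV.le) (by positivity)

theorem le_of_lt_div_log_three {n s : ℕ} (h : (s : ℝ) < (n : ℝ) / Real.log 3) : s ≤ n := by
  have h3 : 1 ≤ Real.log 3 := by
    rw [Real.le_log_iff_exp_le (by norm_num)]
    linarith [Real.exp_one_lt_d9]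
  exact_mod_cast h.le.trans (div_le_self (by positivity) h3)

/-- Asymptotics of the truncation functional `u(ℓ_{p,u}^n, ℓ_{q,v}^n, s)` for
`1 ≤ s < n / log 3`: it is `≍ s^{-1/p} (log(s+1))^{1/v}` if `p < q = ∞`,
`≍ (log(n/s + 1))^{1/v - 1/u}` if `p = q < ∞` and `u > v`, and
`≍ (log(s+1))^{1/v - 1/u}` if `p = q = ∞` and `u < v`. -/
theorem truncFunctional_asymp
    (p q u v : ℝ≥0∞) (hp : 0 < p) (hq : 0 < q) (hu : 0 < u) (hv : 0 < v) :
    ∃ c C : ℝ, 0 < c ∧ 0 < C ∧ ∀ n s : ℕ, 1 ≤ s → (s : ℝ) < (n : ℝ) / Real.log 3 →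
      ((p ≠ ⊤ ∧ q = ⊤) →
        c * ((s : ℝ) ^ (-(1 / p).toReal) * Real.log ((s : ℝ) + 1) ^ (1 / v).toReal) ≤
            truncFunctional n p u q v s ∧
          truncFunctional n p u q v s ≤
            C * ((s : ℝ) ^ (-(1 / p).toReal) * Real.log ((s : ℝ) + 1) ^ (1 / v).toReal)) ∧
      ((p = q ∧ p ≠ ⊤ ∧ v < u) →
        c * Real.log ((n : ℝ) / (s : ℝ) + 1) ^ ((1 / v).toReal - (1 / u).toReal) ≤
            truncFunctional n p u q v s ∧
          truncFunctional n p u q v s ≤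
            C * Real.log ((n : ℝ) / (s : ℝ) + 1) ^ ((1 / v).toReal - (1 / u).toReal)) ∧
      ((p = ⊤ ∧ q = ⊤ ∧ u < v) →
        c * Real.log ((s : ℝ) + 1) ^ ((1 / v).toReal - (1 / u).toReal) ≤
            truncFunctional n p u q v s ∧
          truncFunctional n p u q v s ≤
            C * Real.log ((s : ℝ) + 1) ^ ((1 / v).toReal - (1 / u).toReal)) := by
  by_cases h1 : p ≠ ⊤ ∧ q = ⊤
  · obtain ⟨hpt, rfl⟩ := h1
    obtain ⟨c, C, hc, hC, h⟩ := exists_truncFunctional_bounds_of_target_top hp hpt hu hv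
    exact ⟨c, C, hc, hC, fun n s hs hsn =>
      ⟨fun _ => h n s hs (le_of_lt_div_log_three hsn), fun h' => absurd h'.1 h'.2.1,
        fun h' => absurd h'.1 hpt⟩⟩
  by_cases h2 : p = q ∧ p ≠ ⊤ ∧ v < u
  · obtain ⟨rfl, hpt, hvu⟩ := h2
    obtain ⟨c, C, hc, hC, h⟩ := exists_truncFunctional_bounds_of_eq hp hpt hv hvu
    exact ⟨c, C, hc, hC, fun n s hs hsn =>
      ⟨fun h' => absurd h' h1, fun _ => h n s hs (le_of_lt_div_log_three hsn),
        fun h' => absurd h'.1 hpt⟩⟩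
  by_cases h3 : p = ⊤ ∧ q = ⊤ ∧ u < v
  · obtain ⟨rfl, rfl, huv⟩ := h3
    obtain ⟨c, C, hc, hC, h⟩ := exists_truncFunctional_bounds_of_top hu huv
    exact ⟨c, C, hc, hC, fun n s hs hsn =>
      ⟨fun h' => absurd h' h1, fun h' => absurd h' h2,
        fun _ => h n s hs (le_of_lt_div_log_three hsn)⟩⟩
  exact ⟨1, 1, one_pos, one_pos, fun _ _ _ _ =>
    ⟨fun h' => absurd h' h1, fun h' => absurd h' h2, fun h' => absurd h' h3⟩⟩
end
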